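/- (Maximal interval of existence and lower semicontinuity of the existence time.) Let 1<p<∞, μ∈(1/p,1], let V_μ ⊆ X_{γ,μ} be open and nonempty, let (A,F): V_μ → B(X_1,X_0) × X_0 be locally Lipschitz continuous, and assume A(v) ∈ MR_p(X_0) for all v ∈ V_μ. Then for each u_0 ∈ V_μ the solution u(·,u_0) of the quasilinear problem u̇+A(u)u=F(u), u(0)=u_0, has a maximal interval of existence [0,t^+(u_0)) with t^+(u_0) ∈ (0,∞]: there is a function u defined on [0,t^+(u_0)) such that for each T ∈ (0,t^+(u_0)) the restriction u|_{[0,T]} ∈ E_{1,μ}(0,T) ∩ C([0,T];X_{γ,μ}) is the unique solution on [0,T], and u admits no extension to a solution on a strictly larger interval. Moreover, the map u_0 ↦ t^+(u_0) from V_μ to (0,∞] is lower semicontinuous. -/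

import Mathlib

open MeasureTheory Set

noncomputable section

/-- Membership in the weighted space `L_{p,μ}(s;X)`: `f` is (a.e.) strongly measurable on `s`
and `t ↦ t^(1-μ) f t` is `p`-integrable on `s`. -/
def MemWLp {X : Type*} [NormedAddCommGroup X] (p μ : ℝ) (s : Set ℝ) (f : ℝ → X) : Prop :=
  AEStronglyMeasurable f (volume.restrict s) ∧
    IntegrableOn (fun t : ℝ => (t ^ (1 - μ) * ‖f t‖) ^ p) s

/-- The norm of the weighted space `L_{p,μ}(s;X)`. -/
def wLpNorm {X : Type*} [NormedAddCommGroup X] (p μ : ℝ) (s : Set ℝ) (f : ℝ → X) : ℝ :=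
  (∫ t in s, (t ^ (1 - μ) * ‖f t‖) ^ p) ^ (1 / p)

/-- `g` is the weak (distributional) derivative of `u` on the open set `s ⊆ ℝ`;
in particular `u, g ∈ L_{1,loc}(s;X)`. -/
def IsWeakDeriv {X : Type*} [NormedAddCommGroup X] [NormedSpace ℂ X]
    (s : Set ℝ) (u g : ℝ → X) : Prop :=
  LocallyIntegrableOn u s ∧ LocallyIntegrableOn g s ∧
    ∀ φ : ℝ → ℝ, ContDiff ℝ (⊤ : ℕ∞) φ → HasCompactSupport φ → tsupport φ ⊆ s →
      (∫ t in s, deriv φ t • u t) = -∫ t in s, φ t • g t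

/-- `v : s → X` has trace `x` at `t = 0`: it has a representative `w` which is continuous
on `{0} ∪ s` with `w 0 = x`. -/
def HasTrace {X : Type*} [NormedAddCommGroup X] (s : Set ℝ) (v : ℝ → X) (x : X) : Prop :=
  ∃ w : ℝ → X, ContinuousOn w (insert 0 s) ∧
    (∀ᵐ t ∂(volume.restrict s), w t = v t) ∧ w 0 = x

variable {X₀ X₁ : Type*} [NormedAddCommGroup X₀] [NormedSpace ℂ X₀] [CompleteSpace X₀]
  [NormedAddCommGroup X₁] [NormedSpace ℂ X₁] [CompleteSpace X₁]

/-- The graph norm of `A` (with respect to the embedding `ι : X₁ → X₀`) is equivalent to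
the norm of `X₁`. -/
def GraphNormEquiv (ι A : X₁ →L[ℂ] X₀) : Prop :=
  ∃ c₁ > (0 : ℝ), ∃ c₂ > (0 : ℝ), ∀ x : X₁,
    c₁ * ‖x‖ ≤ ‖ι x‖ + ‖A x‖ ∧ ‖ι x‖ + ‖A x‖ ≤ c₂ * ‖x‖

/-- Membership (of the pair `(u, u')`, `u'` being the weak derivative of `u`) in the maximal
regularity class `E_{1,μ}(s) = W^1_{p,μ}(s;X₀) ∩ L_{p,μ}(s;X₁)`, where `ι : X₁ → X₀` is the
embedding. -/
def MemE (p μ : ℝ) (s : Set ℝ) (ι : X₁ →L[ℂ] X₀) (u : ℝ → X₁) (u' : ℝ → X₀) : Prop :=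
  MemWLp p μ s u ∧ MemWLp p μ s (fun t => ι (u t)) ∧ MemWLp p μ s u' ∧
    IsWeakDeriv s (fun t => ι (u t)) u'

/-- The norm of the maximal regularity class `E_{1,μ}(s)`. -/
def eNorm (p μ : ℝ) (s : Set ℝ) (u : ℝ → X₁) (u' : ℝ → X₀) : ℝ :=
  (wLpNorm p μ s u ^ p + wLpNorm p μ s u' ^ p) ^ (1 / p)

/-- `(u, u')` (with `u'` the weak derivative of `u`) solves the linear problem
`u̇ + A u = f` a.e. on `s`, `u(0) = x`, in the class `E_{1,μ}(s)`. -/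
def IsLinSol (p μ : ℝ) (s : Set ℝ) (ι A : X₁ →L[ℂ] X₀) (f : ℝ → X₀) (x : X₀)
    (u : ℝ → X₁) (u' : ℝ → X₀) : Prop :=
  MemE p μ s ι u u' ∧
    (∀ᵐ t ∂(volume.restrict s), u' t + A (u t) = f t) ∧
    HasTrace s (fun t => ι (u t)) x

/-- `A` has maximal `L_{p,μ}`-regularity, `A ∈ MR_{p,μ}(X₀)`: for every
`f ∈ L_{p,μ}(ℝ₊;X₀)` there is a solution `u ∈ W^1_{p,μ}(ℝ₊;X₀) ∩ L_{p,μ}(ℝ₊;X₁)` of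
`u̇ + A u = f`, `u(0) = 0`, and it is unique (up to a.e. equality). -/
def MRw (p μ : ℝ) (ι A : X₁ →L[ℂ] X₀) : Prop :=
  ∀ f : ℝ → X₀, MemWLp p μ (Set.Ioi 0) f →
    (∃ u u', IsLinSol p μ (Set.Ioi 0) ι A f 0 u u') ∧
    ∀ u₁ u₁' u₂ u₂', IsLinSol p μ (Set.Ioi 0) ι A f 0 u₁ u₁' →
      IsLinSol p μ (Set.Ioi 0) ι A f 0 u₂ u₂' →
      ∀ᵐ t ∂(volume.restrict (Set.Ioi 0)), u₁ t = u₂ t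

/-- `x` belongs to the trace space `X_{γ,μ} = {u(0) : u ∈ E_{1,μ}}`. -/
def InTrace (p μ : ℝ) (ι : X₁ →L[ℂ] X₀) (x : X₀) : Prop :=
  ∃ u u', MemE p μ (Set.Ioi 0) ι u u' ∧ HasTrace (Set.Ioi 0) (fun t => ι (u t)) x

/-- The trace norm `‖x‖_{X_{γ,μ}} = inf {‖u‖_{E_{1,μ}} : u ∈ E_{1,μ}, u(0) = x}`. -/
def traceNorm (p μ : ℝ) (ι : X₁ →L[ℂ] X₀) (x : X₀) : ℝ :=
  sInf {r : ℝ | ∃ u u', MemE p μ (Set.Ioi 0) ι u u' ∧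
    HasTrace (Set.Ioi 0) (fun t => ι (u t)) x ∧ r = eNorm p μ (Set.Ioi 0) u u'}

/-- `(u, u')` is a solution on `[0,T]` of the quasilinear problem
`u̇ + A(u) u = F(u)` a.e. on `(0,T)`, `u(0) = x`, in the class
`E_{1,μ}(0,T) ∩ C([0,T]; V)`: membership in `E_{1,μ}(0,T)`, the equation a.e., and a
representative `w` which satisfies `w 0 = x`, takes values in `V` on `[0,T]` and is
continuous on `[0,T]` with respect to the trace norm of `X_{γ,μ}`. -/
def IsQLSol (p μ T : ℝ) (ι : X₁ →L[ℂ] X₀) (A : X₀ → X₁ →L[ℂ] X₀) (F : X₀ → X₀)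
    (V : Set X₀) (x : X₀) (u : ℝ → X₁) (u' : ℝ → X₀) : Prop :=
  MemE p μ (Set.Ioo 0 T) ι u u' ∧
  (∀ᵐ t ∂(volume.restrict (Set.Ioo 0 T)), u' t + A (ι (u t)) (u t) = F (ι (u t))) ∧
  ∃ w : ℝ → X₀,
    (∀ᵐ t ∂(volume.restrict (Set.Ioo 0 T)), w t = ι (u t)) ∧
    w 0 = x ∧ (∀ t ∈ Set.Icc 0 T, w t ∈ V) ∧
    ∀ t ∈ Set.Icc 0 T, ∀ ε > (0 : ℝ), ∃ δ > (0 : ℝ), ∀ t' ∈ Set.Icc 0 T, |t' - t| < δ →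
      traceNorm p μ ι (w t' - w t) < ε

/-- `V` is an open subset of the trace space `X_{γ,μ}` (with respect to the trace norm). -/
def TraceOpen (p μ : ℝ) (ι : X₁ →L[ℂ] X₀) (V : Set X₀) : Prop :=
  (∀ x ∈ V, InTrace p μ ι x) ∧
  ∀ x ∈ V, ∃ r > (0 : ℝ), ∀ y, InTrace p μ ι y → traceNorm p μ ι (y - x) < r → y ∈ V

/-- `(A, F) : V → B(X₁,X₀) × X₀` is locally Lipschitz continuous with respect to the trace
norm of `X_{γ,μ}` on `V`. -/
def LocLip (p μ : ℝ) (ι : X₁ →L[ℂ] X₀) (A : X₀ → X₁ →L[ℂ] X₀) (F : X₀ → X₀)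
    (V : Set X₀) : Prop :=
  ∀ x ∈ V, ∃ ε > (0 : ℝ), ∃ L > (0 : ℝ), ∀ y ∈ V, ∀ z ∈ V,
    traceNorm p μ ι (y - x) ≤ ε → traceNorm p μ ι (z - x) ≤ ε →
    ‖A y - A z‖ ≤ L * traceNorm p μ ι (y - z) ∧
    ‖F y - F z‖ ≤ L * traceNorm p μ ι (y - z)

section qlcalc
open Filter Topology intervalIntegral
variable {X : Type*} [NormedAddCommGroup X] [NormedSpace ℝ X] [CompleteSpace X]

theorem ql_ibp {g : ℝ → ℝ} {f : ℝ → X} {t : ℝ} (ht : 0 ≤ t)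
    (hg : IntervalIntegrable g volume 0 t) (hf : IntervalIntegrable f volume 0 t) :
    (∫ s in (0:ℝ)..t, g s) • (∫ s in (0:ℝ)..t, f s) =
      ∫ s in (0:ℝ)..t, (g s • (∫ r in (0:ℝ)..s, f r) + (∫ r in (0:ℝ)..s, g r) • f s) := by
  have hg' : IntegrableOn g (Ioc 0 t) := by rwa [intervalIntegrable_iff_integrableOn_Ioc_of_le ht] at hg
  have hf' : IntegrableOn f (Ioc 0 t) := by rwa [intervalIntegrable_iff_integrableOn_Ioc_of_le ht] at hf
  set m := (volume : Measure ℝ).restrict (Ioc 0 t) with hm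
  have hgf : Integrable (fun z : ℝ × ℝ => g z.1 • f z.2) (m.prod m) := Integrable.smul_prod hg' hf'
  let D : Set (ℝ × ℝ) := {z | z.1 ≤ z.2}
  have hD : MeasurableSet D := measurableSet_le measurable_fst measurable_snd
  have h1 : Integrable (D.indicator (fun z : ℝ × ℝ => g z.1 • f z.2)) (m.prod m) := hgf.indicator hD
  have h2 : Integrable (Dᶜ.indicator (fun z : ℝ × ℝ => g z.1 • f z.2)) (m.prod m) := hgf.indicator hD.compl
  have e0 : (∫ s in (0:ℝ)..t, g s) • (∫ s in (0:ℝ)..t, f s) = ∫ z, g z.1 • f z.2 ∂(m.prod m) := by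
    rw [integral_of_le ht, integral_of_le ht, integral_prod_smul]
  have e1 : ∫ z, D.indicator (fun z : ℝ × ℝ => g z.1 • f z.2) z ∂(m.prod m)
      = ∫ s in (0:ℝ)..t, (∫ r in (0:ℝ)..s, g r) • f s := by
    rw [integral_prod_symm _ h1, integral_of_le ht]
    refine setIntegral_congr_fun measurableSet_Ioc fun s hs => ?_
    have : (fun r => D.indicator (fun z : ℝ × ℝ => g z.1 • f z.2) (r, s))
        = (Iic s).indicator (fun r => g r • f s) := by
      ext r; by_cases h : r ≤ s <;> simp [D, indicator, h]
    rw [this, MeasureTheory.integral_indicator measurableSet_Iic, hm, Measure.restrict_restrict measurableSet_Iic,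
      _root_.integral_smul_const, integral_of_le hs.1.le]
    congr 3
    ext r; simp only [mem_inter_iff, mem_Iic, mem_Ioc]
    constructor
    · rintro ⟨a, b, c⟩; exact ⟨b, a⟩
    · rintro ⟨a, b⟩; exact ⟨b, a, b.trans hs.2⟩
  have e2 : ∫ z, Dᶜ.indicator (fun z : ℝ × ℝ => g z.1 • f z.2) z ∂(m.prod m)
      = ∫ s in (0:ℝ)..t, g s • (∫ r in (0:ℝ)..s, f r) := by
    rw [integral_prod _ h2, integral_of_le ht]
    refine setIntegral_congr_fun measurableSet_Ioc fun s hs => ?_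
    have : (fun r => Dᶜ.indicator (fun z : ℝ × ℝ => g z.1 • f z.2) (s, r))
        = (Iio s).indicator (fun r => g s • f r) := by
      ext r; by_cases h : s ≤ r
      · simp [D, indicator, h]
      · simp [D, indicator, h, not_le.1 h]
    rw [this, MeasureTheory.integral_indicator measurableSet_Iio, hm, Measure.restrict_restrict measurableSet_Iio,
      MeasureTheory.integral_smul, integral_of_le hs.1.le, integral_Ioc_eq_integral_Ioo]
    congr 3
    ext r; simp only [mem_inter_iff, mem_Iio, mem_Ioc, mem_Ioo]
    constructor
    · rintro ⟨a, b, c⟩; exact ⟨b, a⟩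
    · rintro ⟨a, b⟩; exact ⟨b, a, b.le.trans hs.2⟩
  have i1 : IntervalIntegrable (fun s => g s • (∫ r in (0:ℝ)..s, f r)) volume 0 t := by
    refine hg.smul_continuousOn ?_
    exact continuousOn_primitive_interval (by rwa [uIcc_of_le ht, integrableOn_Icc_iff_integrableOn_Ioc])
  have i2 : IntervalIntegrable (fun s => (∫ r in (0:ℝ)..s, g r) • f s) volume 0 t := by
    refine hf.continuousOn_smul ?_
    exact continuousOn_primitive_interval (by rwa [uIcc_of_le ht, integrableOn_Icc_iff_integrableOn_Ioc])
  rw [e0, intervalIntegral.integral_add i1 i2, ← e1, ← e2, ← MeasureTheory.integral_add h2 h1]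
  congr 1 with z
  by_cases hz : z ∈ D <;> simp [hz]

end qlcalc

section qlweak
open Filter Topology intervalIntegral
variable {X : Type*} [NormedAddCommGroup X] [NormedSpace ℂ X] [CompleteSpace X]

theorem ql_prim_continuousOn {s : Set ℝ} (hs : IsOpen s) (hs0 : s ⊆ Ioi 0)
    {g : ℝ → X} (hg : ∀ t ∈ s, IntervalIntegrable g volume 0 t) :
    ContinuousOn (fun t => ∫ r in (0:ℝ)..t, g r) s := by
  intro t ht
  obtain ⟨t', htt', ht'⟩ : ∃ t', t < t' ∧ t' ∈ s := by
    have := (hs.mem_nhds ht)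
    obtain ⟨ε, he, h⟩ := Metric.mem_nhds_iff.1 this
    exact ⟨t + ε/2, by linarith, h (by simp [abs_of_pos he]; linarith)⟩
  have h0 : 0 < t := hs0 ht
  have h2 : ContinuousOn (fun t => ∫ r in (0:ℝ)..t, g r) (uIcc 0 t') :=
    continuousOn_primitive_interval' (hg t' ht') (by simp)
  have : uIcc 0 t' ∈ 𝓝 t := by
    rw [uIcc_of_le (by linarith)]; exact Icc_mem_nhds h0 htt'
  exact (h2.continuousAt this).continuousWithinAt

theorem ql_locInt {s : Set ℝ} (hs : IsOpen s) (hs0 : s ⊆ Ioi 0)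
    {g : ℝ → X} (hg : ∀ t ∈ s, IntervalIntegrable g volume 0 t) : LocallyIntegrableOn g s := by
  intro t ht
  obtain ⟨t', htt', ht'⟩ : ∃ t', t < t' ∧ t' ∈ s := by
    have := (hs.mem_nhds ht)
    obtain ⟨ε, he, h⟩ := Metric.mem_nhds_iff.1 this
    exact ⟨t + ε/2, by linarith, h (by simp [abs_of_pos he]; linarith)⟩
  have h0 : 0 < t := hs0 ht
  refine ⟨Ioc 0 t', mem_nhdsWithin_of_mem_nhds (Ioc_mem_nhds h0 htt'), ?_⟩
  rw [← intervalIntegrable_iff_integrableOn_Ioc_of_le (by linarith)]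
  exact hg t' ht'

theorem ql_weak_of_int {s : Set ℝ} (hs : IsOpen s) (hs0 : s ⊆ Ioi 0)
    (hsi : ∀ t ∈ s, Ioc 0 t ⊆ s) {U g : ℝ → X} {x : X}
    (hg : ∀ t ∈ s, IntervalIntegrable g volume 0 t)
    (hU : ∀ᵐ t ∂(volume.restrict s), U t = x + ∫ r in (0:ℝ)..t, g r) : IsWeakDeriv s U g := by
  have hcont := ql_prim_continuousOn hs hs0 hg
  have hc2 : ContinuousOn (fun t => x + ∫ r in (0:ℝ)..t, g r) s := continuousOn_const.add hcont
  refine ⟨?_, ql_locInt hs hs0 hg, ?_⟩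
  · have h1 := hc2.locallyIntegrableOn (μ := volume) hs.measurableSet
    intro t ht
    obtain ⟨w, hw, hw2⟩ := h1 t ht
    refine ⟨w ∩ s, inter_mem hw self_mem_nhdsWithin, ?_⟩
    refine (hw2.mono_set inter_subset_left).congr ?_
    have : volume.restrict (w ∩ s) ≤ volume.restrict s := Measure.restrict_mono inter_subset_right le_rfl
    filter_upwards [ae_mono this hU] with t ht using ht.symm
  · intro φ hφ hφc hφs
    obtain ⟨T, hT0, hTs, hTφ⟩ : ∃ T, 0 ≤ T ∧ Ioc 0 T ⊆ s ∧ (∀ t, T ≤ t → φ t = 0) ∧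
        (0 < T → T ∈ s) := by
      rcases (tsupport φ).eq_empty_or_nonempty with h | h
      · refine ⟨0, le_rfl, by simp, ?_, by simp⟩
        intro t _
        exact image_eq_zero_of_notMem_tsupport (by simp [h])
      · obtain ⟨m, hm, hmax⟩ := hφc.isCompact.exists_isGreatest h
        obtain ⟨ε, he, h⟩ := Metric.mem_nhds_iff.1 (hs.mem_nhds (hφs hm))
        have hms : m + ε/2 ∈ s := h (by simp [abs_of_pos he]; linarith)
        refine ⟨m + ε/2, (hs0 hms).le, hsi _ hms, ?_, fun _ => hms⟩
        intro t ht
        refine image_eq_zero_of_notMem_tsupport fun hh => ?_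
        have := hmax hh
        linarith
    obtain ⟨hTφ, hTm⟩ := hTφ
    have hφ0 : ∀ t, t ≤ 0 → φ t = 0 := fun t ht =>
      image_eq_zero_of_notMem_tsupport fun hh => absurd (hs0 (hφs hh)) (by simpa using ht)
    have hdφs : ∀ t, t ∉ tsupport φ → deriv φ t = 0 := fun t ht =>
      image_eq_zero_of_notMem_tsupport fun hh => ht (tsupport_deriv_subset hh)
    have hφT : ∀ t, t ∉ Ioc 0 T → φ t = 0 := by
      intro t ht
      rcases le_total t 0 with h | h
      · exact hφ0 t h
      · rcases le_or_gt T t with h' | h'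
        · exact hTφ t h'
        · rcases h.eq_or_lt with h'' | h''
          · exact hφ0 t h''.symm.le
          · exact absurd ⟨h'', h'.le⟩ ht
    have htsupp : tsupport φ ⊆ Icc 0 T := by
      refine closure_minimal ?_ isClosed_Icc
      intro t ht
      by_contra h
      exact ht (hφT t fun hh => h ⟨hh.1.le, hh.2⟩)
    have hdφT : ∀ t, t ∉ Ioc 0 T → deriv φ t = 0 := by
      intro t ht
      refine hdφs t fun hh => ht ⟨hs0 (hφs hh), (htsupp hh).2⟩
    have gT : IntervalIntegrable g volume 0 T := by
      rcases hT0.eq_or_lt with h | h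
      · rw [← h]
      · exact hg T (hTm h)
    have key : ∀ h : ℝ → X, ∀ ψ : ℝ → ℝ, (∀ t, t ∉ Ioc 0 T → ψ t = 0) →
        ∫ t in s, ψ t • h t = ∫ t in (0:ℝ)..T, ψ t • h t := by
      intro h ψ hψ
      rw [integral_of_le hT0]
      refine setIntegral_eq_of_subset_of_forall_diff_eq_zero hs.measurableSet hTs ?_
      intro t ht
      simp [hψ t ht.2]
    have hdc : Continuous (deriv φ) := hφ.continuous_deriv (by simp)
    have hprim : ∀ t, ∫ r in (0:ℝ)..t, deriv φ r = φ t := by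
      intro t
      rw [integral_deriv_eq_sub (fun x _ => (hφ.differentiable (by simp)).differentiableAt)
        (hdc.intervalIntegrable _ _), hφ0 0 le_rfl, sub_zero]
    have e1 : ∫ t in s, deriv φ t • U t = ∫ t in s, deriv φ t • (x + ∫ r in (0:ℝ)..t, g r) := by
      refine integral_congr_ae ?_
      filter_upwards [hU] with t ht
      rw [ht]
    rw [e1, key _ _ hdφT, key _ _ hφT]
    have ib := ql_ibp hT0 (hdc.intervalIntegrable 0 T) gT
    rw [hprim, hTφ T le_rfl, zero_smul] at ib
    simp only [hprim] at ib
    have i1 : IntervalIntegrable (fun s => deriv φ s • (∫ r in (0:ℝ)..s, g r)) volume 0 T :=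
      (hdc.intervalIntegrable 0 T).smul_continuousOn (continuousOn_primitive_interval' gT (by simp))
    have i2 : IntervalIntegrable (fun s => φ s • g s) volume 0 T :=
      gT.continuousOn_smul hφ.continuous.continuousOn
    have i3 : IntervalIntegrable (fun s => deriv φ s • x) volume 0 T :=
      (hdc.smul continuous_const).intervalIntegrable 0 T
    rw [intervalIntegral.integral_add i1 i2] at ib
    simp only [smul_add]
    rw [intervalIntegral.integral_add i3 i1, intervalIntegral.integral_smul_const, hprim, hTφ T le_rfl,
      zero_smul, zero_add]
    exact eq_neg_of_add_eq_zero_left ib.symm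

theorem ql_weak_mono {s s' : Set ℝ} (hs' : MeasurableSet s') (hs : MeasurableSet s)
    (hss : s' ⊆ s) {U g : ℝ → X} (h : IsWeakDeriv s U g) : IsWeakDeriv s' U g := by
  obtain ⟨h1, h2, h3⟩ := h
  refine ⟨h1.mono_set hss, h2.mono_set hss, fun φ a b c => ?_⟩
  have := h3 φ a b (c.trans hss)
  have key : ∀ ψ : ℝ → ℝ, (∀ t, t ∉ s' → ψ t = 0) → ∀ h : ℝ → X,
      ∫ t in s, ψ t • h t = ∫ t in s', ψ t • h t := by
    intro ψ hψ h
    refine setIntegral_eq_of_subset_of_forall_diff_eq_zero hs hss ?_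
    intro t ht
    simp [hψ t ht.2]
  rw [key _ (fun t ht => ?_), key _ (fun t ht => ?_)] at this
  · exact this
  · exact image_eq_zero_of_notMem_tsupport fun hh => ht (c hh)
  · exact image_eq_zero_of_notMem_tsupport fun hh => ht (c (tsupport_deriv_subset hh))

theorem ql_int_of_weak {T : ℝ} (hT : 0 < T) {U g : ℝ → X}
    (h : IsWeakDeriv (Ioo 0 T) U g) (hg : IntegrableOn g (Ioo 0 T)) :
    ∃ c, ∀ᵐ t ∂(volume.restrict (Ioo 0 T)), U t = c + ∫ r in (0:ℝ)..t, g r := by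
  have hgi : IntervalIntegrable g volume 0 T := by
    rwa [intervalIntegrable_iff_integrableOn_Ioo_of_le hT.le]
  have hgt : ∀ t ∈ Ioo 0 T, IntervalIntegrable g volume 0 t := fun t ht =>
    hgi.mono_set (by rw [uIcc_of_le ht.1.le, uIcc_of_le hT.le]; exact Icc_subset_Icc_right ht.2.le)
  have hw : IsWeakDeriv (Ioo 0 T) (fun t => ∫ r in (0:ℝ)..t, g r) g :=
    ql_weak_of_int isOpen_Ioo (fun t ht => ht.1)
      (fun t ht r hr => ⟨hr.1, hr.2.trans_lt ht.2⟩) (x := 0) hgt (by simp)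
  set G := fun t => ∫ r in (0:ℝ)..t, g r with hG
  obtain ⟨a1, a2, a3⟩ := h
  obtain ⟨b1, b2, b3⟩ := hw
  have hloc : LocallyIntegrableOn (fun t => U t - G t) (Ioo 0 T) := a1.sub b1
  have hint : ∀ h : ℝ → X, LocallyIntegrableOn h (Ioo 0 T) → ∀ ψ : ℝ → ℝ, Continuous ψ →
      HasCompactSupport ψ → tsupport ψ ⊆ Ioo 0 T → IntegrableOn (fun t => ψ t • h t) (Ioo 0 T) := by
    intro h hh ψ h1 h2 h3
    have q1 : IntegrableOn h (tsupport ψ) := hh.integrableOn_compact_subset h3 h2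
    have q2 : IntegrableOn (fun t => ψ t • h t) (tsupport ψ) :=
      q1.continuousOn_smul h1.continuousOn h2
    rw [integrableOn_iff_integrable_of_support_subset] at q2
    · exact q2.integrableOn
    · intro t ht
      refine subset_tsupport _ fun h0 => ht ?_
      simp [h0]
  have hz : ∀ φ : ℝ → ℝ, ContDiff ℝ (⊤ : ℕ∞) φ → HasCompactSupport φ → tsupport φ ⊆ Ioo 0 T →
      ∫ t in Ioo 0 T, deriv φ t • (U t - G t) = 0 := by
    intro φ h1 h2 h3
    have hc : Continuous (deriv φ) := h1.continuous_deriv (by simp)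
    have hs : tsupport (deriv φ) ⊆ Ioo 0 T := fun t ht => h3 (tsupport_deriv_subset ht)
    simp only [smul_sub]
    rw [integral_sub (hint U a1 _ hc h2.deriv hs) (hint G b1 _ hc h2.deriv hs), a3 φ h1 h2 h3, b3 φ h1 h2 h3]
    simp
  -- a fixed bump
  obtain ⟨ψ0, p1, p2, p3, p4⟩ : ∃ ψ : ℝ → ℝ, ContDiff ℝ (⊤ : ℕ∞) ψ ∧ HasCompactSupport ψ ∧
      tsupport ψ ⊆ Icc (T/4) (3*T/4) ∧ ∫ t, ψ t = 1 := by
    let b : ContDiffBump (T/2 : ℝ) := ⟨T/8, T/4, by linarith, by linarith⟩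
    refine ⟨b.normed volume, b.contDiff_normed, b.hasCompactSupport_normed, ?_, b.integral_normed⟩
    rw [b.tsupport_normed_eq, Real.closedBall_eq_Icc]
    apply Icc_subset_Icc <;> (simp only [b]; linarith)
  have p3' : tsupport ψ0 ⊆ Ioo 0 T := p3.trans (fun t ht => ⟨by linarith [ht.1], by linarith [ht.2]⟩)
  set c := ∫ t in Ioo 0 T, ψ0 t • (U t - G t) with hc
  refine ⟨c, ?_⟩
  have main : ∀ᵐ t ∂volume, t ∈ Ioo 0 T → (U t - G t) - c = 0 := by
    refine isOpen_Ioo.ae_eq_zero_of_integral_contDiff_smul_eq_zero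
      (hloc.sub ((locallyIntegrable_const c).locallyIntegrableOn _)) ?_
    intro ψ h1 h2 h3
    set k := ∫ t, ψ t with hk
    let χ : ℝ → ℝ := fun t => ψ t - k * ψ0 t
    have χs : ContDiff ℝ (⊤ : ℕ∞) χ := h1.sub (contDiff_const.mul p1)
    obtain ⟨q, hq0, hq⟩ : ∃ q, 0 < q ∧ tsupport ψ ⊆ Icc q (T - q) := by
      rcases (tsupport ψ).eq_empty_or_nonempty with h | h
      · exact ⟨1, one_pos, by simp [h]⟩
      · obtain ⟨m, hm, hmax⟩ := h2.isCompact.exists_isGreatest h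
        obtain ⟨n, hn, hmin⟩ := h2.isCompact.exists_isLeast h
        refine ⟨min n (T - m), lt_min (h3 hn).1 (by linarith [(h3 hm).2]), fun t ht => ⟨?_, ?_⟩⟩
        · exact (min_le_left _ _).trans (hmin ht)
        · have := min_le_right n (T - m)
          have := hmax ht
          linarith
    set q' := min q (T/4) with hq'
    have hq'0 : 0 < q' := lt_min hq0 (by linarith)
    have hq'q : q' ≤ q := min_le_left _ _
    have hq'T : q' ≤ T/4 := min_le_right _ _
    have χ0 : ∀ t, t ∉ Icc q' (T - q') → χ t = 0 := by
      intro t ht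
      have u1 : ψ t = 0 := image_eq_zero_of_notMem_tsupport fun hh => ht
        ⟨by linarith [(hq hh).1], by linarith [(hq hh).2]⟩
      have u2 : ψ0 t = 0 := image_eq_zero_of_notMem_tsupport fun hh => ht
        ⟨by linarith [(p3 hh).1], by linarith [(p3 hh).2]⟩
      simp [χ, u1, u2]
    have χint : ∫ t, χ t = 0 := by
      simp only [χ]
      rw [integral_sub (h1.continuous.integrable_of_hasCompactSupport h2)
        ((p1.continuous.integrable_of_hasCompactSupport p2).const_mul _), MeasureTheory.integral_const_mul, p4]
      simp [hk]
    let φ : ℝ → ℝ := fun t => ∫ r in (0:ℝ)..t, χ r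
    have hd : ∀ t, HasDerivAt φ (χ t) t := fun t =>
      integral_hasDerivAt_right (χs.continuous.intervalIntegrable _ _)
        (χs.continuous.stronglyMeasurableAtFilter _ _) χs.continuous.continuousAt
    have hdφ : deriv φ = χ := funext fun t => (hd t).deriv
    have φs : ContDiff ℝ (⊤ : ℕ∞) φ := by
      rw [contDiff_infty_iff_deriv]
      exact ⟨fun t => (hd t).differentiableAt, hdφ ▸ χs⟩
    have φ0 : ∀ t, t ∉ Icc q' (T - q') → φ t = 0 := by
      intro t ht
      rcases lt_or_ge t q' with h | h
      · simp only [φ]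
        rw [integral_congr (g := fun _ => 0)]
        · simp
        · intro r hr
          refine χ0 r fun hh => ?_
          have : r ≤ max 0 t := hr.2
          rcases le_total 0 t with h' | h'
          · rw [max_eq_right h'] at this; linarith [hh.1]
          · rw [max_eq_left h'] at this; linarith [hh.1]
      · have h' : T - q' < t := by
          by_contra h'
          exact ht ⟨h, not_lt.1 h'⟩
        simp only [φ]
        rw [integral_of_le (by linarith), ← χint]
        refine setIntegral_eq_integral_of_forall_compl_eq_zero fun r hr => χ0 r fun hh => hr ?_
        exact ⟨by linarith [hh.1], by linarith [hh.2]⟩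
    have φt : tsupport φ ⊆ Icc q' (T - q') := by
      refine closure_minimal ?_ isClosed_Icc
      intro t ht
      by_contra h
      exact ht (φ0 t h)
    have φc : HasCompactSupport φ := isCompact_Icc.of_isClosed_subset (isClosed_tsupport _) φt
    have := hz φ φs φc (φt.trans fun t ht => ⟨by linarith [ht.1], by linarith [ht.2]⟩)
    rw [hdφ] at this
    have j1 := hint _ hloc ψ h1.continuous h2 h3
    have j2 := hint _ hloc ψ0 p1.continuous p2 p3'
    simp only [χ, sub_smul, mul_smul] at this
    have j2' : IntegrableOn (fun t => k • ψ0 t • (U t - G t)) (Ioo 0 T) := j2.smul k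
    rw [integral_sub j1 j2', MeasureTheory.integral_smul, ← hc] at this
    have e1 : ∫ t, ψ t • (U t - G t - c) = ∫ t in Ioo 0 T, ψ t • (U t - G t - c) := by
      refine (setIntegral_eq_integral_of_forall_compl_eq_zero fun r hr => ?_).symm
      rw [image_eq_zero_of_notMem_tsupport fun hh => hr (h3 hh), zero_smul]
    have e2 : ∫ t in Ioo 0 T, ψ t = k :=
      setIntegral_eq_integral_of_forall_compl_eq_zero fun r hr => 
        image_eq_zero_of_notMem_tsupport fun hh => hr (h3 hh)
    rw [e1]
    simp only [smul_sub _ _ c]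
    rw [integral_sub j1 ((h1.continuous.integrable_of_hasCompactSupport h2).integrableOn.smul_const c),
      _root_.integral_smul_const, e2]
    exact this
  rw [ae_restrict_iff' measurableSet_Ioo]
  filter_upwards [main] with t ht h
  have := ht h
  rw [sub_sub, sub_eq_zero] at this
  rw [this, add_comm]

end qlweak

section qlnu
open Filter Topology intervalIntegral
open scoped ENNReal NNReal

def qlm : Measure ℝ := volume.restrict (Ioi 0)

def qlnu (p μ : ℝ) : Measure ℝ := qlm.withDensity (fun t => ENNReal.ofReal (t ^ ((1 - μ) * p)))

instance qlFactP (p : ℝ) [hp : Fact (1 < p)] : Fact (1 ≤ ENNReal.ofReal p) :=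
  ⟨by rw [← ENNReal.ofReal_one]; exact ENNReal.ofReal_le_ofReal hp.out.le⟩
instance qlFactOne1 (p : ℝ) [hp : Fact (1 < p)] : Fact (1 / p < 1) :=
  ⟨by rw [div_lt_one (by linarith [hp.out])]; exact hp.out⟩
instance qlFactOne2 : Fact ((1:ℝ) ≤ 1) := ⟨le_rfl⟩

theorem ql_meas_dens (k : ℝ) : Measurable (fun t : ℝ => ENNReal.ofReal (t ^ k)) :=
  ENNReal.measurable_ofReal.comp (measurable_id.pow_const k)

theorem ql_ae (p μ : ℝ) : ae (qlnu p μ) = ae qlm := by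
  refine le_antisymm (withDensity_absolutelyContinuous _ _).ae_le
    (withDensity_absolutelyContinuous' (ql_meas_dens _).aemeasurable ?_).ae_le
  unfold qlm
  filter_upwards [ae_restrict_mem measurableSet_Ioi] with t ht
  simp only [ne_eq, ENNReal.ofReal_eq_zero, not_le]
  exact Real.rpow_pos_of_pos ht _

theorem ql_nu_one (p : ℝ) : qlnu p 1 = qlm := by
  unfold qlnu
  simp

theorem ql_asm {X : Type*} [TopologicalSpace X] (p μ : ℝ) (f : ℝ → X) :
    AEStronglyMeasurable f (qlnu p μ) ↔ AEStronglyMeasurable f qlm := by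
  constructor
  · intro h
    refine h.mono_ac (ν := qlm) (μ := qlnu p μ) ?_
    rw [← Measure.ae_le_iff_absolutelyContinuous, ql_ae]
  · intro h
    exact h.mono_ac (withDensity_absolutelyContinuous _ _)

variable {X : Type*} [NormedAddCommGroup X]

theorem ql_eLp {p : ℝ} [hp : Fact (1 < p)] (m : Measure ℝ) (f : ℝ → X) :
    eLpNorm f (ENNReal.ofReal p) m = (∫⁻ t, ‖f t‖ₑ ^ p ∂m) ^ (1 / p) := by
  have h0 : 0 < p := by linarith [hp.out]
  rw [eLpNorm_eq_lintegral_rpow_enorm_toReal (by simpa using h0) ENNReal.ofReal_ne_top,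
    ENNReal.toReal_ofReal h0.le]

theorem ql_lint (p μ : ℝ) {s : Set ℝ} (hs : MeasurableSet s)
    (hs0 : s ⊆ Ioi 0) (g : ℝ → ℝ≥0∞) :
    ∫⁻ t in s, g t ∂(qlnu p μ) = ∫⁻ t in s, ENNReal.ofReal (t ^ ((1 - μ) * p)) * g t := by
  unfold qlnu
  rw [restrict_withDensity hs]
  have : qlm.restrict s = volume.restrict s := by
    unfold qlm
    rw [Measure.restrict_restrict hs, inter_eq_left.2 hs0]
  rw [this, lintegral_withDensity_eq_lintegral_mul_non_measurable _ (ql_meas_dens _)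
    (Eventually.of_forall fun _ => ENNReal.ofReal_lt_top)]
  rfl

theorem ql_asm_restrict {X : Type*} [TopologicalSpace X] (p μ : ℝ) {s : Set ℝ} (hs : MeasurableSet s)
    (hs0 : s ⊆ Ioi 0) (f : ℝ → X) :
    AEStronglyMeasurable f ((qlnu p μ).restrict s) ↔ AEStronglyMeasurable f (volume.restrict s) := by
  have h2 : qlm.restrict s = volume.restrict s := by
    unfold qlm
    rw [Measure.restrict_restrict hs, inter_eq_left.2 hs0]
  constructor
  · intro h
    refine h.mono_ac ?_
    rw [← h2]
    refine Measure.AbsolutelyContinuous.restrict ?_ s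
    rw [← Measure.ae_le_iff_absolutelyContinuous, ql_ae]
  · intro h
    refine h.mono_ac ?_
    rw [← h2]
    exact Measure.AbsolutelyContinuous.restrict (withDensity_absolutelyContinuous _ _) s

theorem ql_ae_restrict (p μ : ℝ) {s : Set ℝ} (hs : MeasurableSet s)
    (hs0 : s ⊆ Ioi 0) : ae ((qlnu p μ).restrict s) = ae (volume.restrict s) := by
  have h2 : qlm.restrict s = volume.restrict s := by
    unfold qlm
    rw [Measure.restrict_restrict hs, inter_eq_left.2 hs0]
  rw [← h2, ae_restrict_eq hs, ae_restrict_eq hs, ql_ae]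

theorem ql_pt {p : ℝ} [hp : Fact (1 < p)] (μ : ℝ) {t : ℝ} (ht : 0 < t) (y : X) :
    ENNReal.ofReal ((t ^ (1 - μ) * ‖y‖) ^ p) = ENNReal.ofReal (t ^ ((1 - μ) * p)) * ‖y‖ₑ ^ p := by
  have h0 : 0 < p := by linarith [hp.out]
  have h1 : 0 ≤ t ^ (1 - μ) := Real.rpow_nonneg ht.le _
  rw [Real.mul_rpow h1 (norm_nonneg _), ENNReal.ofReal_mul (by positivity), ← Real.rpow_mul ht.le,
    ← ENNReal.ofReal_rpow_of_nonneg (norm_nonneg _) h0.le, ofReal_norm]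

theorem ql_memLp_iff {p : ℝ} [hp : Fact (1 < p)] (μ : ℝ) {s : Set ℝ} (hs : MeasurableSet s)
    (hs0 : s ⊆ Ioi 0) (f : ℝ → X) :
    MemWLp p μ s f ↔ MemLp f (ENNReal.ofReal p) ((qlnu p μ).restrict s) := by
  have h0 : 0 < p := by linarith [hp.out]
  unfold MemWLp MemLp
  rw [ql_asm_restrict p μ hs hs0]
  refine and_congr_right fun hf => ?_
  rw [ql_eLp, ql_lint p μ hs hs0]
  have e : ∫⁻ t in s, ENNReal.ofReal (t ^ ((1 - μ) * p)) * ‖f t‖ₑ ^ p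
      = ∫⁻ t in s, ENNReal.ofReal ((t ^ (1 - μ) * ‖f t‖) ^ p) := by
    refine setLIntegral_congr_fun hs fun t ht => ?_
    exact (ql_pt μ (hs0 ht) _).symm
  rw [e, ENNReal.rpow_lt_top_iff_of_pos (by positivity)]
  have hm : AEStronglyMeasurable (fun t : ℝ => (t ^ (1 - μ) * ‖f t‖) ^ p) (volume.restrict s) := by
    refine AEMeasurable.aestronglyMeasurable ?_
    exact ((measurable_id.pow_const _).aemeasurable.mul hf.norm.aemeasurable).pow_const _
  unfold IntegrableOn Integrable
  simp only [hm, true_and]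
  rw [hasFiniteIntegral_iff_ofReal]
  filter_upwards [ae_restrict_mem hs] with t ht
  have h1 : 0 ≤ t ^ (1 - μ) := Real.rpow_nonneg (hs0 ht).le _
  positivity

theorem ql_wLpNorm {p : ℝ} [hp : Fact (1 < p)] (μ : ℝ) {s : Set ℝ} (hs : MeasurableSet s)
    (hs0 : s ⊆ Ioi 0) (f : ℝ → X) (hf : MemWLp p μ s f) :
    wLpNorm p μ s f = (eLpNorm f (ENNReal.ofReal p) ((qlnu p μ).restrict s)).toReal := by
  have h0 : 0 < p := by linarith [hp.out]
  unfold wLpNorm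
  rw [ql_eLp, ql_lint p μ hs hs0]
  have e : ∫⁻ t in s, ENNReal.ofReal (t ^ ((1 - μ) * p)) * ‖f t‖ₑ ^ p
      = ∫⁻ t in s, ENNReal.ofReal ((t ^ (1 - μ) * ‖f t‖) ^ p) := by
    refine setLIntegral_congr_fun hs fun t ht => ?_
    exact (ql_pt μ (hs0 ht) _).symm
  rw [e, ← ENNReal.toReal_rpow, integral_eq_lintegral_of_nonneg_ae _ hf.2.1]
  filter_upwards [ae_restrict_mem hs] with t ht
  have h1 : 0 ≤ t ^ (1 - μ) := Real.rpow_nonneg (hs0 ht).le _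
  positivity

theorem ql_nu_Ioi (p μ : ℝ) : (qlnu p μ).restrict (Ioi 0) = qlnu p μ := by
  unfold qlnu
  rw [restrict_withDensity measurableSet_Ioi]
  unfold qlm
  rw [Measure.restrict_restrict measurableSet_Ioi, inter_self]

theorem ql_holder (p : ℝ) [hp : Fact (1 < p)] (μ : ℝ) [hμ : Fact (1 / p < μ)] [hμ1 : Fact (μ ≤ 1)] (b : ℝ) :
    ∃ C : ℝ≥0, ∀ {X : Type _} [NormedAddCommGroup X] (f : ℝ → X),
      AEStronglyMeasurable f (volume.restrict (Ioo 0 b)) →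
      ∫⁻ t in Ioo 0 b, ‖f t‖ₑ ≤ C * eLpNorm f (ENNReal.ofReal p) ((qlnu p μ).restrict (Ioo 0 b)) := by
  have h1 := hp.out
  have h2 := hμ.out
  have h3 := hμ1.out
  have h0 : 0 < p := by linarith
  set q := p / (p - 1) with hq
  have hpq : p.HolderConjugate q := Real.HolderConjugate.conjExponent h1
  have hq0 : 0 < q := hpq.symm.pos
  have hlt : -1 < (μ - 1) * q := by
    rw [hq, mul_div_assoc', lt_div_iff₀ (by linarith)]
    rw [div_lt_iff₀ h0] at h2
    linarith
  set K := ∫⁻ t in Ioo 0 b, (ENNReal.ofReal (t ^ (μ - 1))) ^ q with hK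
  have hKt : K ≠ ⊤ := by
    rcases le_or_gt b 0 with hb | hb
    · simp [hK, hb]
    have : IntegrableOn (fun t : ℝ => t ^ ((μ - 1) * q)) (Ioo 0 b) := by
      rw [← intervalIntegrable_iff_integrableOn_Ioo_of_le hb.le]
      exact intervalIntegrable_rpow' hlt
    have h4 := (hasFiniteIntegral_iff_ofReal (by
      filter_upwards [ae_restrict_mem measurableSet_Ioo] with t ht
      exact Real.rpow_nonneg ht.1.le _)).1 this.2
    refine ne_of_lt (lt_of_le_of_lt (le_of_eq ?_) h4)
    refine setLIntegral_congr_fun measurableSet_Ioo fun t ht => ?_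
    rw [ENNReal.ofReal_rpow_of_nonneg (Real.rpow_nonneg ht.1.le _) hq0.le, ← Real.rpow_mul ht.1.le]
  refine ⟨(K ^ (1 / q)).toNNReal, fun {X} _ f hf => ?_⟩
  rw [ENNReal.coe_toNNReal (ENNReal.rpow_ne_top_of_nonneg (by positivity) hKt)]
  have H := ENNReal.lintegral_mul_le_Lp_mul_Lq (volume.restrict (Ioo 0 b)) hpq.symm
    (f := fun t => ENNReal.ofReal (t ^ (μ - 1))) (g := fun t => ENNReal.ofReal (t ^ (1 - μ)) * ‖f t‖ₑ)
    (ql_meas_dens _).aemeasurable ((ql_meas_dens _).aemeasurable.mul hf.enorm)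
  rw [ql_eLp, ql_lint p μ measurableSet_Ioo (fun t ht => ht.1)]
  refine le_trans (le_of_eq ?_) (H.trans (le_of_eq ?_))
  · refine setLIntegral_congr_fun measurableSet_Ioo fun t ht => ?_
    simp only [Pi.mul_apply]
    rw [← mul_assoc, ← ENNReal.ofReal_mul (Real.rpow_nonneg ht.1.le _), ← Real.rpow_add ht.1]
    simp
  · congr 2
    refine setLIntegral_congr_fun measurableSet_Ioo fun t ht => ?_
    rw [ENNReal.mul_rpow_of_nonneg _ _ h0.le, ENNReal.ofReal_rpow_of_nonneg (Real.rpow_nonneg ht.1.le _) h0.le,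
      ← Real.rpow_mul ht.1.le]

theorem ql_int_of_memLp {p : ℝ} [hp : Fact (1 < p)] {μ : ℝ} [hμ : Fact (1 / p < μ)] [hμ1 : Fact (μ ≤ 1)]
    {b : ℝ} {f : ℝ → X} (hf : MemLp f (ENNReal.ofReal p) ((qlnu p μ).restrict (Ioo 0 b))) :
    IntegrableOn f (Ioo 0 b) := by
  obtain ⟨C, hC⟩ := ql_holder p μ b
  have hm := (ql_asm_restrict p μ measurableSet_Ioo (fun t ht => ht.1) f).1 hf.1
  refine ⟨hm, ?_⟩
  exact (hC f hm).trans_lt (ENNReal.mul_lt_top ENNReal.coe_lt_top hf.2)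

theorem ql_ii_of_memLp {p : ℝ} [hp : Fact (1 < p)] {μ : ℝ} [hμ : Fact (1 / p < μ)] [hμ1 : Fact (μ ≤ 1)]
    {b : ℝ} (hb : 0 ≤ b) {f : ℝ → X} (hf : MemLp f (ENNReal.ofReal p) (qlnu p μ)) :
    IntervalIntegrable f volume 0 b := by
  rw [intervalIntegrable_iff_integrableOn_Ioo_of_le hb]
  exact ql_int_of_memLp (hf.restrict _)

end qlnu

section qlpr
open Filter Topology intervalIntegral
open scoped ENNReal NNReal

def QPr (ι : X₁ →L[ℂ] X₀) (b : ℝ) (x : X₀) (u : ℝ → X₁) (u' : ℝ → X₀) : Prop :=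
  IntegrableOn u (Ioo 0 b) ∧ IntegrableOn u' (Ioo 0 b) ∧
    ∀ᵐ t ∂(volume.restrict (Ioo 0 b)), ι (u t) = x + ∫ r in (0:ℝ)..t, u' r

theorem ql_ii {X : Type*} [NormedAddCommGroup X] {f : ℝ → X} {b a c : ℝ}
    (hf : IntegrableOn f (Ioo 0 b)) (ha : 0 ≤ a) (hc : 0 ≤ c) (hab : a ≤ b) (hcb : c ≤ b) :
    IntervalIntegrable f volume a c := by
  have h : IntervalIntegrable f volume 0 b := by
    rwa [intervalIntegrable_iff_integrableOn_Ioo_of_le (ha.trans hab)]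
  refine h.mono_set ?_
  rw [uIcc_of_le (ha.trans hab)]
  exact uIcc_subset_Icc ⟨ha, hab⟩ ⟨hc, hcb⟩

theorem ql_icongr {X : Type*} [NormedAddCommGroup X] [NormedSpace ℝ X] {f g : ℝ → X} {b t : ℝ}
    (h : ∀ᵐ t ∂(volume.restrict (Ioo 0 b)), f t = g t) (ht : 0 ≤ t) (htb : t ≤ b) :
    ∫ r in (0:ℝ)..t, f r = ∫ r in (0:ℝ)..t, g r := by
  rw [integral_of_le ht, integral_of_le ht, integral_Ioc_eq_integral_Ioo, integral_Ioc_eq_integral_Ioo]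
  exact integral_congr_ae (ae_mono (Measure.restrict_mono (Ioo_subset_Ioo_right htb) le_rfl) h)

theorem ql_ae_shift {P : ℝ → Prop} {a b : ℝ} (ha : 0 ≤ a)
    (h : ∀ᵐ t ∂(volume.restrict (Ioo 0 b)), P t) :
    ∀ᵐ t ∂(volume.restrict (Ioo 0 (b - a))), P (a + t) := by
  rw [ae_restrict_iff' measurableSet_Ioo] at h ⊢
  filter_upwards [(measurePreserving_add_left volume a).quasiMeasurePreserving.ae h] with t ht ht2
  exact ht ⟨by linarith [ht2.1], by linarith [ht2.2]⟩

theorem ql_int_shift {X : Type*} [NormedAddCommGroup X] {f : ℝ → X} {a b : ℝ} (ha : 0 ≤ a)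
    (h : IntegrableOn f (Ioo 0 b)) : IntegrableOn (fun t => f (a + t)) (Ioo 0 (b - a)) := by
  have h2 : IntegrableOn f (Ioo a b) := h.mono_set (Ioo_subset_Ioo_left ha)
  have h3 := (measurePreserving_add_left volume a).integrableOn_comp_preimage
    (measurableEmbedding_addLeft a) (f := f) (s := Ioo a b)
  rw [preimage_const_add_Ioo, sub_self] at h3
  exact h3.2 h2

variable {ι : X₁ →L[ℂ] X₀} {b : ℝ} {x y : X₀} {u v : ℝ → X₁} {u' v' : ℝ → X₀}

theorem QPr.mono (h : QPr ι b x u u') {c : ℝ} (hc : c ≤ b) : QPr ι c x u u' :=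
  ⟨h.1.mono_set (Ioo_subset_Ioo_right hc), h.2.1.mono_set (Ioo_subset_Ioo_right hc),
    ae_mono (Measure.restrict_mono (Ioo_subset_Ioo_right hc) le_rfl) h.2.2⟩

theorem QPr.add (h : QPr ι b x u u') (k : QPr ι b y v v') :
    QPr ι b (x + y) (fun t => u t + v t) (fun t => u' t + v' t) := by
  refine ⟨h.1.add k.1, h.2.1.add k.2.1, ?_⟩
  filter_upwards [h.2.2, k.2.2, ae_restrict_mem measurableSet_Ioo] with t h1 h2 h3
  rw [map_add, h1, h2, intervalIntegral.integral_add (ql_ii h.2.1 le_rfl h3.1.le (h3.1.trans h3.2).le h3.2.le)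
    (ql_ii k.2.1 le_rfl h3.1.le (h3.1.trans h3.2).le h3.2.le)]
  abel

theorem QPr.sub (h : QPr ι b x u u') (k : QPr ι b y v v') :
    QPr ι b (x - y) (fun t => u t - v t) (fun t => u' t - v' t) := by
  refine ⟨h.1.sub k.1, h.2.1.sub k.2.1, ?_⟩
  filter_upwards [h.2.2, k.2.2, ae_restrict_mem measurableSet_Ioo] with t h1 h2 h3
  rw [map_sub, h1, h2, intervalIntegral.integral_sub (ql_ii h.2.1 le_rfl h3.1.le (h3.1.trans h3.2).le h3.2.le)
    (ql_ii k.2.1 le_rfl h3.1.le (h3.1.trans h3.2).le h3.2.le)]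
  abel

theorem QPr.congr (h : QPr ι b x u u') (hu : ∀ᵐ t ∂(volume.restrict (Ioo 0 b)), u t = v t)
    (hu' : ∀ᵐ t ∂(volume.restrict (Ioo 0 b)), u' t = v' t) : QPr ι b x v v' := by
  refine ⟨h.1.congr hu, h.2.1.congr hu', ?_⟩
  filter_upwards [h.2.2, hu, ae_restrict_mem measurableSet_Ioo] with t h1 h2 h3
  rw [← h2, h1, ql_icongr hu' h3.1.le h3.2.le]

theorem QPr.shift (h : QPr ι b x u u') {a : ℝ} (ha : 0 ≤ a) :
    QPr ι (b - a) (x + ∫ r in (0:ℝ)..a, u' r) (fun t => u (a + t)) (fun t => u' (a + t)) := by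
  refine ⟨ql_int_shift ha h.1, ql_int_shift ha h.2.1, ?_⟩
  filter_upwards [ql_ae_shift ha h.2.2, ae_restrict_mem measurableSet_Ioo] with t h1 h3
  have hb : a + t ≤ b := by linarith [h3.2]
  have ht := h3.1
  rw [h1, intervalIntegral.integral_comp_add_left (fun t => u' t), add_zero, add_assoc,
    integral_add_adjacent_intervals (ql_ii h.2.1 le_rfl ha (by linarith) (by linarith))
      (ql_ii h.2.1 ha (by linarith) (by linarith) (by linarith))]

/-- continuous functions on `[0,b)` equal a.e. -/
theorem ql_cont_ae {X : Type*} [NormedAddCommGroup X] {f g : ℝ → X} {b : ℝ}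
    (hf : ContinuousOn f (Ico 0 b)) (hg : ContinuousOn g (Ico 0 b))
    (h : ∀ᵐ t ∂(volume.restrict (Ioo 0 b)), f t = g t) : EqOn f g (Ico 0 b) := by
  have h1 : EqOn f g (Ioo 0 b) := by
    refine Measure.eqOn_open_of_ae_eq h isOpen_Ioo (hf.mono Ioo_subset_Ico_self) (hg.mono Ioo_subset_Ico_self)
  intro t ht
  refine h1.of_subset_closure hf hg Ioo_subset_Ico_self ?_ ht
  rw [closure_Ioo (by have := ht.1.trans_lt ht.2; exact this.ne)]
  exact Ico_subset_Icc_self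

theorem ql_prim_cont {X : Type*} [NormedAddCommGroup X] [NormedSpace ℝ X] {f : ℝ → X} {b : ℝ} (x : X)
    (hf : IntegrableOn f (Ioo 0 b)) : ContinuousOn (fun t => x + ∫ r in (0:ℝ)..t, f r) (Icc 0 b) := by
  rcases lt_or_ge b 0 with hb | hb
  · simp [Icc_eq_empty (not_le.2 hb)]
  refine continuousOn_const.add ?_
  have := continuousOn_primitive_interval' (ql_ii hf le_rfl hb hb le_rfl) (a := 0) (by simp)
  rwa [uIcc_of_le hb] at this

/-- zero function has zero derivative -/
theorem ql_zero_deriv {X : Type*} [NormedAddCommGroup X] [NormedSpace ℝ X] [CompleteSpace X]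
    {f : ℝ → X} {b : ℝ} {x : X}
    (hf : IntegrableOn f (Ioo 0 b)) (h : ∀ᵐ t ∂(volume.restrict (Ioo 0 b)), x + ∫ r in (0:ℝ)..t, f r = 0) :
    ∀ᵐ t ∂(volume.restrict (Ioo 0 b)), f t = 0 := by
  have h1 := ql_cont_ae ((ql_prim_cont x hf).mono Ico_subset_Icc_self) (continuousOn_const (c := (0:X))) h
  have h2 : LocallyIntegrable ((Ioo 0 b).indicator f) :=
    (hf.integrable_indicator measurableSet_Ioo).locallyIntegrable
  have h3 : ∀ t ∈ Ico 0 b, ∫ r in (0:ℝ)..t, f r = -x := fun t ht => eq_neg_of_add_eq_zero_right (h1 ht)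
  rw [ae_restrict_iff' measurableSet_Ioo]
  have hI : IntervalIntegrable ((Ioo 0 b).indicator f) volume 0 b :=
    (hf.integrable_indicator measurableSet_Ioo).intervalIntegrable
  filter_upwards [hI.ae_hasDerivAt_integral] with t ht ht2
  have hb : 0 ≤ b := (ht2.1.trans ht2.2).le
  have h4 := ht (by rw [uIcc_of_le hb]; exact ⟨ht2.1.le, ht2.2.le⟩) 0 (by simp)
  rw [indicator_of_mem ht2] at h4
  have h5 : (fun t => ∫ r in (0:ℝ)..t, (Ioo 0 b).indicator f r) =ᶠ[𝓝 t] fun _ => -x := by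
    filter_upwards [Ioo_mem_nhds ht2.1 ht2.2] with s hs
    rw [← h3 s ⟨hs.1.le, hs.2⟩]
    refine ql_icongr (b := b) ?_ hs.1.le hs.2.le
    filter_upwards [ae_restrict_mem measurableSet_Ioo] with r hr
    rw [indicator_of_mem hr]
  exact (h4.congr_of_eventuallyEq h5.symm).unique (hasDerivAt_const t (-x))

end qlpr

section qlEE
open Filter Topology intervalIntegral
open scoped ENNReal NNReal

theorem QPr.smul {ι : X₁ →L[ℂ] X₀} {b : ℝ} {x : X₀} {u : ℝ → X₁} {u' : ℝ → X₀}
    (h : QPr ι b x u u') (c : ℂ) : QPr ι b (c • x) (fun t => c • u t) (fun t => c • u' t) := by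
  refine ⟨h.1.smul c, h.2.1.smul c, ?_⟩
  filter_upwards [h.2.2] with t h1
  rw [map_smul, h1, intervalIntegral.integral_smul, smul_add]

theorem ql_ae_loc {P : ℝ → Prop} (b : ℝ) (h : ∀ᵐ t ∂qlm, P t) : ∀ᵐ t ∂(volume.restrict (Ioo 0 b)), P t :=
  ae_mono (Measure.restrict_mono (fun _ ht => ht.1) le_rfl) h

theorem ql_ae_nu {P : ℝ → Prop} {p μ : ℝ} (b : ℝ) (h : ∀ᵐ t ∂(qlnu p μ), P t) :
    ∀ᵐ t ∂(volume.restrict (Ioo 0 b)), P t := by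
  rw [ql_ae] at h
  exact ql_ae_loc b h

theorem ql_ae_glob {P : ℝ → Prop} (h : ∀ b, ∀ᵐ t ∂(volume.restrict (Ioo 0 b)), P t) :
    ∀ᵐ t ∂qlm, P t := by
  have h1 : ∀ n : ℕ, ∀ᵐ t ∂(volume.restrict (Ioo 0 (n:ℝ))), P t := fun n => h n
  simp only [ae_restrict_iff' measurableSet_Ioo] at h1
  rw [← ae_all_iff] at h1
  unfold qlm
  rw [ae_restrict_iff' measurableSet_Ioi]
  filter_upwards [h1] with t ht h0
  obtain ⟨n, hn⟩ := exists_nat_gt t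
  exact ht n ⟨h0, hn⟩

variable (p : ℝ) [hp : Fact (1 < p)] (μ : ℝ) [hμ : Fact (1 / p < μ)] [hμ1 : Fact (μ ≤ 1)]

abbrev QTT (X₀ X₁ : Type*) [NormedAddCommGroup X₀] [NormedAddCommGroup X₁] (p μ : ℝ) :=
  X₀ × Lp X₁ (ENNReal.ofReal p) (qlnu p μ) × Lp X₀ (ENNReal.ofReal p) (qlnu p μ)

def QEE (ι : X₁ →L[ℂ] X₀) : Submodule ℂ (QTT X₀ X₁ p μ) where
  carrier := {e | ∀ b, QPr ι b e.1 e.2.1 e.2.2}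
  zero_mem' := by
    intro b
    have h : QPr ι b 0 (fun _ => 0) (fun _ => 0) := ⟨integrableOn_zero, integrableOn_zero, by simp⟩
    refine h.congr (ql_ae_nu (p := p) (μ := μ) b ?_) (ql_ae_nu (p := p) (μ := μ) b ?_)
    · filter_upwards [Lp.coeFn_zero X₁ (ENNReal.ofReal p) (qlnu p μ)] with t ht using ht.symm
    · filter_upwards [Lp.coeFn_zero X₀ (ENNReal.ofReal p) (qlnu p μ)] with t ht using ht.symm
  add_mem' := by
    intro e f he hf b
    refine ((he b).add (hf b)).congr (ql_ae_nu (p := p) (μ := μ) b ?_) (ql_ae_nu (p := p) (μ := μ) b ?_)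
    · filter_upwards [Lp.coeFn_add e.2.1 f.2.1] with t ht using ht.symm
    · filter_upwards [Lp.coeFn_add e.2.2 f.2.2] with t ht using ht.symm
  smul_mem' := by
    intro c e he b
    refine ((he b).smul c).congr (ql_ae_nu (p := p) (μ := μ) b ?_) (ql_ae_nu (p := p) (μ := μ) b ?_)
    · filter_upwards [Lp.coeFn_smul c e.2.1] with t ht using ht.symm
    · filter_upwards [Lp.coeFn_smul c e.2.2] with t ht using ht.symm

variable {p μ}
theorem ql_Lp_int {X : Type*} [NormedAddCommGroup X] (b : ℝ) (f : Lp X (ENNReal.ofReal p) (qlnu p μ)) :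
    IntegrableOn f (Ioo 0 b) := ql_int_of_memLp ((Lp.memLp f).restrict _)

theorem ql_Lp_bd (p μ : ℝ) [hp : Fact (1 < p)] [hμ : Fact (1 / p < μ)] [hμ1 : Fact (μ ≤ 1)]
    (X : Type*) [NormedAddCommGroup X] (b : ℝ) : ∃ C : ℝ, 0 ≤ C ∧
    ∀ f : Lp X (ENNReal.ofReal p) (qlnu p μ), ∫ t in Ioo 0 b, ‖f t‖ ≤ C * ‖f‖ := by
  obtain ⟨C, hC⟩ := ql_holder p μ b
  refine ⟨C, C.2, fun f => ?_⟩
  have h1 := hC f (ql_Lp_int b f).1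
  rw [integral_norm_eq_lintegral_enorm (ql_Lp_int b f).1, Lp.norm_def]
  have h3 : eLpNorm f (ENNReal.ofReal p) (qlnu p μ) ≠ ⊤ := (Lp.memLp f).2.ne
  have := ENNReal.toReal_mono (ENNReal.mul_ne_top ENNReal.coe_ne_top h3) (h1.trans (mul_le_mul_right
    (eLpNorm_mono_measure f Measure.restrict_le_self) _))
  rwa [ENNReal.toReal_mul, ENNReal.coe_toReal] at this

theorem ql_norm_prim_le {X : Type*} [NormedAddCommGroup X] [NormedSpace ℝ X] {f : ℝ → X} {b t : ℝ}
    (hf : IntegrableOn f (Ioo 0 b)) (ht : 0 ≤ t) (htb : t ≤ b) :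
    ‖∫ r in (0:ℝ)..t, f r‖ ≤ ∫ r in Ioo 0 b, ‖f r‖ := by
  refine (intervalIntegral.norm_integral_le_integral_norm ht).trans ?_
  rw [integral_of_le ht, integral_Ioc_eq_integral_Ioo]
  exact setIntegral_mono_set hf.norm (Eventually.of_forall fun _ => norm_nonneg _)
    (HasSubset.Subset.eventuallyLE (Ioo_subset_Ioo_right htb))

theorem QEE_closed (ι : X₁ →L[ℂ] X₀) : IsClosed (QEE p μ ι : Set (QTT X₀ X₁ p μ)) := by
  rw [← isSeqClosed_iff_isClosed]
  intro s e hs hlim b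
  refine ⟨ql_Lp_int b _, ql_Lp_int b _, ?_⟩
  rcases le_or_gt b 0 with hb | hb
  · simp [hb]
  obtain ⟨C0, hC0, h0⟩ := ql_Lp_bd p μ X₀ b
  obtain ⟨C1, hC1, h1⟩ := ql_Lp_bd p μ X₁ b
  set φ := fun t => ι (e.2.1 t) - (e.1 + ∫ r in (0:ℝ)..t, e.2.2 r) with hφ
  have hp1 : IntegrableOn (fun t => e.1 + ∫ r in (0:ℝ)..t, e.2.2 r) (Ioo 0 b) :=
    ((ql_prim_cont e.1 (ql_Lp_int b e.2.2)).integrableOn_Icc).mono_set Ioo_subset_Icc_self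
  have hi : IntegrableOn φ (Ioo 0 b) := (ι.integrable_comp (ql_Lp_int b e.2.1)).sub hp1
  have key : ∀ n, ∫ t in Ioo 0 b, ‖φ t‖ ≤ (‖ι‖ * C1 + b * (1 + C0)) * ‖e - s n‖ := by
    intro n
    have a1 : ∀ᵐ t ∂(volume.restrict (Ioo 0 b)), ‖φ t‖ ≤ ‖ι‖ * ‖(e - s n).2.1 t‖ + (1 + C0) * ‖e - s n‖ := by
      filter_upwards [(hs n b).2.2, ql_ae_nu b (Lp.coeFn_sub e.2.1 (s n).2.1), ae_restrict_mem measurableSet_Ioo]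
        with t q1 q2 q3
      have q4 : ∫ r in (0:ℝ)..t, (e - s n).2.2 r = (∫ r in (0:ℝ)..t, e.2.2 r) - ∫ r in (0:ℝ)..t, (s n).2.2 r := by
        rw [← intervalIntegral.integral_sub]
        · refine ql_icongr (b := b) ?_ q3.1.le q3.2.le
          exact ql_ae_nu b (Lp.coeFn_sub e.2.2 (s n).2.2)
        · exact ql_ii (ql_Lp_int b _) le_rfl q3.1.le hb.le q3.2.le
        · exact ql_ii (ql_Lp_int b _) le_rfl q3.1.le hb.le q3.2.le
      have q5 : φ t = ι ((e - s n).2.1 t) - ((e - s n).1 + ∫ r in (0:ℝ)..t, (e - s n).2.2 r) := by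
        have : (e - s n).2.1 t = e.2.1 t - (s n).2.1 t := q2
        rw [q4, this, map_sub, q1, hφ]
        simp only [Prod.fst_sub]
        abel
      rw [q5]
      refine (norm_sub_le _ _).trans (add_le_add (ι.le_opNorm _) ?_)
      refine (norm_add_le _ _).trans ?_
      rw [add_mul, one_mul]
      refine add_le_add (norm_fst_le _) ?_
      refine (ql_norm_prim_le (ql_Lp_int b _) q3.1.le q3.2.le).trans ((h0 _).trans ?_)
      exact mul_le_mul_of_nonneg_left ((norm_snd_le _).trans (norm_snd_le _)) hC0
    have i1 : IntegrableOn (fun t => ‖ι‖ * ‖(e - s n).2.1 t‖) (Ioo 0 b) :=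
      (ql_Lp_int b (e - s n).2.1).norm.const_mul _
    have i2 : IntegrableOn (fun t : ℝ => (1 + C0) * ‖e - s n‖) (Ioo 0 b) := integrableOn_const (by simp)
    refine (integral_mono_ae hi.norm (i1.add i2) a1).trans ?_
    have : ∫ t in Ioo 0 b, (‖ι‖ * ‖(e - s n).2.1 t‖ + (1 + C0) * ‖e - s n‖)
        = ‖ι‖ * (∫ t in Ioo 0 b, ‖(e - s n).2.1 t‖) + b * ((1 + C0) * ‖e - s n‖) := by
      rw [integral_add i1 i2, MeasureTheory.integral_const_mul, setIntegral_const]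
      simp [hb.le]
    refine this.le.trans ?_
    have h2 := (h1 (e - s n).2.1).trans (mul_le_mul_of_nonneg_left ((norm_fst_le _).trans (norm_snd_le (e - s n))) hC1)
    have := mul_le_mul_of_nonneg_left h2 (norm_nonneg ι)
    nlinarith
  have hl : Tendsto (fun n => (‖ι‖ * C1 + b * (1 + C0)) * ‖e - s n‖) atTop (𝓝 0) := by
    have : Tendsto (fun n => ‖e - s n‖) atTop (𝓝 0) := by
      have := (tendsto_iff_norm_sub_tendsto_zero.1 hlim)
      simpa [norm_sub_rev] using this
    simpa using this.const_mul (‖ι‖ * C1 + b * (1 + C0))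
  have hz : ∫ t in Ioo 0 b, ‖φ t‖ ≤ 0 := ge_of_tendsto' hl key
  have hz' := (integral_eq_zero_iff_of_nonneg (fun _ => norm_nonneg _) hi.norm).1
    (le_antisymm hz (integral_nonneg fun _ => norm_nonneg _))
  filter_upwards [hz'] with t ht
  have : φ t = 0 := norm_eq_zero.1 ht
  exact sub_eq_zero.1 this

end qlEE

section qlbridge
open Filter Topology intervalIntegral
open scoped ENNReal NNReal
variable {p : ℝ} [hp : Fact (1 < p)] {μ : ℝ} [hμ : Fact (1 / p < μ)] [hμ1 : Fact (μ ≤ 1)]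
variable {ι : X₁ →L[ℂ] X₀} {b : ℝ} {x y : X₀} {u v : ℝ → X₁} {u' v' : ℝ → X₀}

theorem ql_memE_of {s : Set ℝ} (hs : IsOpen s) (hs0 : s ⊆ Ioi 0) (hsi : ∀ t ∈ s, Ioc 0 t ⊆ s)
    (hu : MemLp u (ENNReal.ofReal p) ((qlnu p μ).restrict s))
    (hu' : MemLp u' (ENNReal.ofReal p) ((qlnu p μ).restrict s))
    (h : ∀ᵐ t ∂(volume.restrict s), ι (u t) = x + ∫ r in (0:ℝ)..t, u' r) : MemE p μ s ι u u' := by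
  have hm := hs.measurableSet
  refine ⟨(ql_memLp_iff μ hm hs0 _).2 hu, (ql_memLp_iff μ hm hs0 _).2 (ι.comp_memLp' hu),
    (ql_memLp_iff μ hm hs0 _).2 hu', ql_weak_of_int hs hs0 hsi (x := x) ?_ h⟩
  intro t ht
  rw [intervalIntegrable_iff_integrableOn_Ioo_of_le (le_of_lt (hs0 ht))]
  refine ql_int_of_memLp (p := p) (μ := μ) (hu'.mono_measure (Measure.restrict_mono ?_ le_rfl))
  exact Ioo_subset_Ioc_self.trans (hsi t ht)

theorem ql_glob_of (hu : MemLp u (ENNReal.ofReal p) (qlnu p μ))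
    (hu' : MemLp u' (ENNReal.ofReal p) (qlnu p μ)) (h : ∀ b, QPr ι b x u u') :
    MemE p μ (Ioi 0) ι u u' ∧ HasTrace (Ioi 0) (fun t => ι (u t)) x := by
  have hae := ql_ae_glob (fun b => (h b).2.2)
  constructor
  · exact ql_memE_of isOpen_Ioi le_rfl (fun t _ r hr => hr.1) (by rwa [ql_nu_Ioi]) (by rwa [ql_nu_Ioi]) hae
  · refine ⟨fun t => x + ∫ r in (0:ℝ)..t, u' r, ?_, ?_, by simp⟩
    · rw [Ioi_insert]
      intro t ht
      have := ql_prim_cont x (h (t + 1)).2.1 t ⟨ht, by linarith⟩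
      refine this.mono_of_mem_nhdsWithin ?_
      rw [← Ici_inter_Iic]
      exact inter_mem self_mem_nhdsWithin (mem_nhdsWithin_of_mem_nhds (Iic_mem_nhds (by linarith)))
    · filter_upwards [hae] with t ht using ht.symm

theorem ql_loc_to {T : ℝ} (hT : 0 < T) (h : MemE p μ (Ioo 0 T) ι u u') :
    MemLp u (ENNReal.ofReal p) ((qlnu p μ).restrict (Ioo 0 T)) ∧
    MemLp u' (ENNReal.ofReal p) ((qlnu p μ).restrict (Ioo 0 T)) ∧ ∃ c, QPr ι T c u u' := by
  obtain ⟨h1, h2, h3, h4⟩ := h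
  rw [ql_memLp_iff μ measurableSet_Ioo (fun t ht => ht.1)] at h1 h3
  refine ⟨h1, h3, ?_⟩
  obtain ⟨c, hc⟩ := ql_int_of_weak hT h4 (ql_int_of_memLp h3)
  exact ⟨c, ql_int_of_memLp h1, ql_int_of_memLp h3, hc⟩

theorem ql_trace_eq {T : ℝ} (hT : 0 < T) (h : QPr ι T x u u') {w : ℝ → X₀}
    (hw : ContinuousOn w (Ico 0 T)) (hwu : ∀ᵐ t ∂(volume.restrict (Ioo 0 T)), w t = ι (u t)) :
    EqOn w (fun t => x + ∫ r in (0:ℝ)..t, u' r) (Ico 0 T) := by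
  refine ql_cont_ae hw ((ql_prim_cont x h.2.1).mono Ico_subset_Icc_self) ?_
  filter_upwards [hwu, h.2.2] with t h1 h2
  rw [h1, h2]

theorem ql_glob_to (h : MemE p μ (Ioi 0) ι u u') (ht : HasTrace (Ioi 0) (fun t => ι (u t)) x) :
    MemLp u (ENNReal.ofReal p) (qlnu p μ) ∧ MemLp u' (ENNReal.ofReal p) (qlnu p μ) ∧
      ∀ b, QPr ι b x u u' := by
  obtain ⟨h1, h2, h3, h4⟩ := h
  have h1' := (ql_memLp_iff μ measurableSet_Ioi le_rfl _).1 h1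
  have h3' := (ql_memLp_iff μ measurableSet_Ioi le_rfl _).1 h3
  rw [ql_nu_Ioi] at h1' h3'
  refine ⟨h1', h3', fun b => ?_⟩
  wlog hb : 0 < b generalizing b
  · exact (this 1 one_pos).mono (by linarith)
  obtain ⟨c, hc⟩ := ql_int_of_weak hb (ql_weak_mono measurableSet_Ioo measurableSet_Ioi (fun t ht => ht.1) h4)
    (ql_int_of_memLp (h3'.restrict _))
  have hQ : QPr ι b c u u' := ⟨ql_int_of_memLp (h1'.restrict _), ql_int_of_memLp (h3'.restrict _), hc⟩
  obtain ⟨w, w1, w2, w3⟩ := ht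
  rw [Ioi_insert] at w1
  have := ql_trace_eq hb hQ (w1.mono fun t ht => ht.1) (ql_ae_loc b w2) (show (0:ℝ) ∈ Ico 0 b from ⟨le_rfl, hb⟩)
  simp only [integral_same, add_zero] at this
  rw [w3] at this
  rwa [this]

/-- pack functions into an element of the space -/
theorem ql_pack (hu : MemLp u (ENNReal.ofReal p) (qlnu p μ))
    (hu' : MemLp u' (ENNReal.ofReal p) (qlnu p μ)) (h : ∀ b, QPr ι b x u u') :
    ((x, hu.toLp u, hu'.toLp u') : QTT X₀ X₁ p μ) ∈ QEE p μ ι := by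
  intro b
  refine (h b).congr (ql_ae_nu (p := p) (μ := μ) b ?_) (ql_ae_nu (p := p) (μ := μ) b ?_)
  · filter_upwards [hu.coeFn_toLp] with t ht using ht.symm
  · filter_upwards [hu'.coeFn_toLp] with t ht using ht.symm

end qlbridge

section qlS
open Filter Topology intervalIntegral
open scoped ENNReal NNReal
variable (p : ℝ) [hp : Fact (1 < p)] (μ : ℝ) [hμ : Fact (1 / p < μ)] [hμ1 : Fact (μ ≤ 1)]

/-- zero trace -/
def QZZ (ι : X₁ →L[ℂ] X₀) : Submodule ℂ (QTT X₀ X₁ p μ) :=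
  QEE p μ ι ⊓ LinearMap.ker (LinearMap.fst ℂ X₀ (Lp X₁ (ENNReal.ofReal p) (qlnu p μ) × Lp X₀ (ENNReal.ofReal p) (qlnu p μ)))

theorem QZZ_mem (ι : X₁ →L[ℂ] X₀) (e : QTT X₀ X₁ p μ) : e ∈ QZZ p μ ι ↔ e ∈ QEE p μ ι ∧ e.1 = 0 := Iff.rfl

theorem QZZ_closed (ι : X₁ →L[ℂ] X₀) : IsClosed (QZZ p μ ι : Set (QTT X₀ X₁ p μ)) := by
  have : (QZZ p μ ι : Set (QTT X₀ X₁ p μ)) = (QEE p μ ι : Set (QTT X₀ X₁ p μ)) ∩ Prod.fst ⁻¹' {0} := by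
    ext e; rfl
  rw [this]
  exact (QEE_closed ι).inter (isClosed_singleton.preimage continuous_fst)

/-- the operator `u' + A u` -/
def QDD (A : X₁ →L[ℂ] X₀) : QTT X₀ X₁ p μ →L[ℂ] Lp X₀ (ENNReal.ofReal p) (qlnu p μ) :=
  (ContinuousLinearMap.snd ℂ _ _ + (A.compLpL (ENNReal.ofReal p) (qlnu p μ)).comp (ContinuousLinearMap.fst ℂ _ _)).comp
    (ContinuousLinearMap.snd ℂ _ _)

theorem QDD_ae (A : X₁ →L[ℂ] X₀) (e : QTT X₀ X₁ p μ) :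
    ∀ᵐ t ∂qlm, QDD p μ A e t = e.2.2 t + A (e.2.1 t) := by
  rw [← ql_ae p μ]
  filter_upwards [Lp.coeFn_add e.2.2 (A.compLp e.2.1), A.coeFn_compLp e.2.1] with t h1 h2
  have : QDD p μ A e = e.2.2 + A.compLp e.2.1 := rfl
  rw [this, h1, Pi.add_apply, h2]

/-- bounded inverse from bijectivity -/
theorem ql_inverse (ι A : X₁ →L[ℂ] X₀)
    (hinj : ∀ e ∈ QZZ p μ ι, QDD p μ A e = 0 → e = 0)
    (hsurj : ∀ f, ∃ e ∈ QZZ p μ ι, QDD p μ A e = f) :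
    ∃ S : Lp X₀ (ENNReal.ofReal p) (qlnu p μ) →L[ℂ] QTT X₀ X₁ p μ,
      (∀ f, S f ∈ QZZ p μ ι) ∧ (∀ f, QDD p μ A (S f) = f) := by
  have hc : CompleteSpace (QZZ p μ ι) := (QZZ_closed p μ ι).completeSpace_coe
  let D := (QDD p μ A).comp (QZZ p μ ι).subtypeL
  have h1 : LinearMap.ker (D : QZZ p μ ι →ₗ[ℂ] Lp X₀ (ENNReal.ofReal p) (qlnu p μ)) = ⊥ := by
    rw [LinearMap.ker_eq_bot']
    intro e he
    exact Subtype.ext (hinj e e.2 he)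
  have h2 : LinearMap.range (D : QZZ p μ ι →ₗ[ℂ] Lp X₀ (ENNReal.ofReal p) (qlnu p μ)) = ⊤ := by
    rw [LinearMap.range_eq_top]
    intro f
    obtain ⟨e, he, hf⟩ := hsurj f
    exact ⟨⟨e, he⟩, hf⟩
  let E := ContinuousLinearEquiv.ofBijective D h1 h2
  refine ⟨(QZZ p μ ι).subtypeL.comp (E.symm : _ →L[ℂ] _), fun f => (E.symm f).2, fun f => ?_⟩
  exact E.apply_symm_apply f

end qlS

section qllin
open Filter Topology intervalIntegral
open scoped ENNReal NNReal
variable {p : ℝ} [hp : Fact (1 < p)]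

def QMR (p : ℝ) (ι A : X₁ →L[ℂ] X₀) (M : ℝ≥0) : Prop :=
  (∀ f, MemLp f (ENNReal.ofReal p) qlm → ∃ u u', MemLp u (ENNReal.ofReal p) qlm ∧
    MemLp u' (ENNReal.ofReal p) qlm ∧ (∀ b, QPr ι b 0 u u') ∧ (∀ᵐ t ∂qlm, u' t + A (u t) = f t) ∧
    eLpNorm u (ENNReal.ofReal p) qlm ≤ M * eLpNorm f (ENNReal.ofReal p) qlm ∧
    eLpNorm u' (ENNReal.ofReal p) qlm ≤ M * eLpNorm f (ENNReal.ofReal p) qlm) ∧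
  (∀ u u', MemLp u (ENNReal.ofReal p) qlm → MemLp u' (ENNReal.ofReal p) qlm → (∀ b, QPr ι b 0 u u') →
    (∀ᵐ t ∂qlm, u' t + A (u t) = 0) → ∀ᵐ t ∂qlm, u t = 0)

theorem ql_QMR {ι A : X₁ →L[ℂ] X₀} (h : MRw p 1 ι A) : ∃ M, QMR p ι A M := by
  have huniq : (∀ u u', MemLp u (ENNReal.ofReal p) (qlnu p 1) → MemLp u' (ENNReal.ofReal p) (qlnu p 1) →
      (∀ b, QPr ι b 0 u u') →
      (∀ᵐ t ∂qlm, u' t + A (u t) = 0) → ∀ᵐ t ∂qlm, u t = 0) := by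
    intro u u' h1 h2 h3 h4
    have h0 : MemWLp p 1 (Ioi 0) (fun _ : ℝ => (0 : X₀)) := by
      rw [ql_memLp_iff 1 measurableSet_Ioi le_rfl]
      exact MemLp.zero'
    obtain ⟨k1, k2⟩ := ql_glob_of h1 h2 h3
    have hz : ∀ b, QPr ι b 0 (fun _ => 0) (fun _ => 0) := fun b =>
      ⟨integrableOn_zero, integrableOn_zero, by simp⟩
    obtain ⟨l1, l2⟩ := ql_glob_of (p := p) (μ := 1) (u := fun _ => (0 : X₁)) (u' := fun _ => (0 : X₀)) (x := 0) (ι := ι)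
      MemLp.zero' MemLp.zero' hz
    exact (h _ h0).2 u u' _ _ ⟨k1, h4, k2⟩ ⟨l1, by simp, l2⟩
  have hinj : ∀ e ∈ QZZ p 1 ι, QDD p 1 A e = 0 → e = 0 := by
    intro e he h0
    obtain ⟨he1, he2⟩ := (QZZ_mem p 1 ι e).1 he
    have e0 : ∀ b, QPr ι b 0 e.2.1 e.2.2 := fun b => he2 ▸ (he1 b)
    have e1 := huniq e.2.1 e.2.2 (Lp.memLp _) (Lp.memLp _) e0 (by
      have h1 := QDD_ae p 1 A e
      rw [h0] at h1
      have h2 := Lp.coeFn_zero X₀ (ENNReal.ofReal p) (qlnu p 1)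
      rw [ql_ae] at h2
      filter_upwards [h1, h2] with t q1 q2
      rw [← q1, q2]; rfl)
    have e2 : e.2.1 = 0 := by
      rw [Lp.eq_zero_iff_ae_eq_zero, ql_ae]
      exact e1
    have e3 : e.2.2 = 0 := by
      have : e.2.2 + A.compLpL (ENNReal.ofReal p) (qlnu p 1) e.2.1 = 0 := h0
      rwa [e2, map_zero, add_zero] at this
    exact Prod.ext he2 (Prod.ext e2 e3)
  have hsurj : ∀ f, ∃ e ∈ QZZ p 1 ι, QDD p 1 A e = f := by
    intro f
    obtain ⟨⟨u, u', k1, k2, k3⟩, -⟩ := h f (by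
      rw [ql_memLp_iff 1 measurableSet_Ioi le_rfl, ql_nu_Ioi]
      exact Lp.memLp f)
    obtain ⟨l1, l2, l3⟩ := ql_glob_to k1 k3
    refine ⟨(0, l1.toLp u, l2.toLp u'), ⟨ql_pack l1 l2 l3, rfl⟩, ?_⟩
    refine Lp.ext ?_
    have m1 := l1.coeFn_toLp
    have m2 := l2.coeFn_toLp
    rw [ql_ae] at m1 m2 ⊢
    filter_upwards [m1, m2, QDD_ae p 1 A (0, l1.toLp u, l2.toLp u'), k2] with t q1 q2 q3 q4
    rw [q3, q1, q2, q4]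
  obtain ⟨S, hS1, hS2⟩ := ql_inverse p 1 ι A hinj hsurj
  have hS3 : ∀ g b, QPr ι b 0 (S g).2.1 (S g).2.2 := fun g b => by
    obtain ⟨h1, h2⟩ := (QZZ_mem p 1 ι _).1 (hS1 g)
    exact h2 ▸ h1 b
  refine ⟨‖S‖₊, ?_, by rwa [ql_nu_one] at huniq⟩
  intro f hf
  rw [← ql_nu_one p] at hf ⊢
  set g := hf.toLp f with hg
  refine ⟨(S g).2.1, (S g).2.2, Lp.memLp _, Lp.memLp _, hS3 g, ?_, ?_, ?_⟩
  · have m1 := hf.coeFn_toLp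
    rw [ql_ae] at m1 ⊢
    filter_upwards [QDD_ae p 1 A (S g), m1] with t q1 q2
    rw [← q1, hS2, q2]
  · have : ‖(S g).2.1‖₊ ≤ ‖S‖₊ * ‖g‖₊ := ((norm_fst_le _).trans (norm_snd_le _)).trans (S.le_opNorm g)
    rw [← Lp.enorm_def, ← eLpNorm_congr_ae hf.coeFn_toLp, ← Lp.enorm_def] 
    rw [← hg, enorm_eq_nnnorm, enorm_eq_nnnorm]
    exact_mod_cast this
  · have : ‖(S g).2.2‖₊ ≤ ‖S‖₊ * ‖g‖₊ := ((norm_snd_le _).trans (norm_snd_le _)).trans (S.le_opNorm g)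
    rw [← Lp.enorm_def, ← eLpNorm_congr_ae hf.coeFn_toLp, ← Lp.enorm_def] 
    rw [← hg, enorm_eq_nnnorm, enorm_eq_nnnorm]
    exact_mod_cast this

theorem ql_memLp_rshift {X : Type*} [NormedAddCommGroup X] {w : ℝ → X} (hw : MemLp w (ENNReal.ofReal p) qlm) {b : ℝ}
    (hb : 0 ≤ b) : MemLp ((Ioi b).indicator (fun t => w (t - b))) (ENNReal.ofReal p) qlm := by
  rw [memLp_indicator_iff_restrict measurableSet_Ioi]
  have h1 : qlm.restrict (Ioi b) = volume.restrict (Ioi b) := by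
    unfold qlm
    rw [Measure.restrict_restrict measurableSet_Ioi, inter_eq_left.2 (Ioi_subset_Ioi hb)]
  rw [h1]
  have h2 := (measurePreserving_sub_right volume b).restrict_preimage (measurableSet_Ioi (a := (0:ℝ)))
  have h3 : (fun t : ℝ => t - b) ⁻¹' Ioi 0 = Ioi b := by ext t; simp
  rw [h3] at h2
  exact hw.comp_measurePreserving h2

theorem ql_memLp_lshift {X : Type*} [NormedAddCommGroup X] {w : ℝ → X} (hw : MemLp w (ENNReal.ofReal p) qlm) {b : ℝ}
    (hb : 0 ≤ b) : MemLp (fun t => w (b + t)) (ENNReal.ofReal p) qlm := by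
  have h2 := (measurePreserving_add_left volume b).restrict_preimage (measurableSet_Ioi (a := b))
  have h3 : (fun t : ℝ => b + t) ⁻¹' Ioi b = Ioi 0 := by ext t; simp
  rw [h3] at h2
  exact (hw.mono_measure (Measure.restrict_mono (Ioi_subset_Ioi hb) le_rfl)).comp_measurePreserving h2

theorem ql_int_rshift {X : Type*} [NormedAddCommGroup X] {f : ℝ → X} {b c : ℝ}
    (hf : IntegrableOn f (Ioo 0 c)) :
    IntegrableOn ((Ioi b).indicator (fun t => f (t - b))) (Ioo 0 (b + c)) := by
  rw [IntegrableOn, integrable_indicator_iff measurableSet_Ioi, IntegrableOn, Measure.restrict_restrict measurableSet_Ioi]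
  have h3 := (measurePreserving_sub_right volume b).integrableOn_comp_preimage
    (measurableEmbedding_subRight b) (f := f) (s := Ioo 0 c)
  refine (h3.2 hf).mono_set ?_
  rintro t ⟨h1, h2⟩
  exact ⟨by simpa using h1, by linarith [h2.2]⟩

theorem ql_QPr_rshift {ι : X₁ →L[ℂ] X₀} {w : ℝ → X₁} {w' : ℝ → X₀} {b c : ℝ} (hb : 0 ≤ b)
    (h : QPr ι c 0 w w') :
    QPr ι (b + c) 0 ((Ioi b).indicator (fun t => w (t - b))) ((Ioi b).indicator (fun t => w' (t - b))) := by
  refine ⟨ql_int_rshift h.1, ql_int_rshift h.2.1, ?_⟩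
  have h5 := h.2.2
  rw [ae_restrict_iff' measurableSet_Ioo] at h5 ⊢
  filter_upwards [(measurePreserving_sub_right volume b).quasiMeasurePreserving.ae h5] with t ht ht2
  have z : ∀ r, r ≤ b → ∫ r in (0:ℝ)..r, (Ioi b).indicator (fun t => w' (t - b)) r = 0 := by
    intro r hr
    refine integral_zero_ae (Eventually.of_forall fun s hs => ?_)
    refine indicator_of_notMem (fun hh => ?_) _
    rcases le_total 0 r with h' | h'
    · rw [uIoc_of_le h'] at hs; exact absurd hh (not_lt.2 (hs.2.trans hr))
    · rw [uIoc_of_ge h'] at hs; exact absurd hh (not_lt.2 (hs.2.trans hb))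
  rcases le_or_gt t b with h6 | h6
  · rw [indicator_of_notMem (by simpa using h6), map_zero, z t h6, zero_add]
  · rw [indicator_of_mem (mem_Ioi.2 h6), ht ⟨by linarith, by linarith [ht2.2]⟩]
    have i0 := ql_int_rshift (b := b) h.2.1
    rw [← integral_add_adjacent_intervals (b := b) (ql_ii i0 le_rfl hb (by linarith [ht2.1, ht2.2]) (by linarith [ht2.2]))
      (ql_ii i0 hb ht2.1.le (by linarith [ht2.2]) ht2.2.le), z b le_rfl, zero_add, zero_add, zero_add]
    have : ∫ r in b..t, (Ioi b).indicator (fun t => w' (t - b)) r = ∫ r in b..t, w' (r - b) := by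
      refine integral_congr_ae (Eventually.of_forall fun r hr => ?_)
      rw [uIoc_of_le h6.le] at hr
      rw [indicator_of_mem (mem_Ioi.2 hr.1)]
    rw [this, intervalIntegral.integral_comp_sub_right (fun t => w' t), sub_self]

variable {ι A : X₁ →L[ℂ] X₀} {M : ℝ≥0}

theorem ql_causal (h : QMR p ι A M) {b : ℝ} (hb : 0 ≤ b) {u : ℝ → X₁} {u' : ℝ → X₀}
    (hu : MemLp u (ENNReal.ofReal p) qlm) (hu' : MemLp u' (ENNReal.ofReal p) qlm) (hq : ∀ b, QPr ι b 0 u u')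
    (h0 : ∀ᵐ t ∂(volume.restrict (Ioo 0 b)), u' t + A (u t) = 0) :
    ∀ᵐ t ∂(volume.restrict (Ioo 0 b)), u t = 0 := by
  have hf : MemLp (fun t => u' t + A (u t)) (ENNReal.ofReal p) qlm := hu'.add (A.comp_memLp' hu)
  obtain ⟨w, w', w1, w2, w3, w4, -, -⟩ := h.1 _ (ql_memLp_lshift hf hb)
  have k := h.2 (fun t => u t - (Ioi b).indicator (fun t => w (t - b)) t)
    (fun t => u' t - (Ioi b).indicator (fun t => w' (t - b)) t)
    (hu.sub (ql_memLp_rshift w1 hb)) (hu'.sub (ql_memLp_rshift w2 hb)) (fun c => by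
      have := (hq c).sub ((ql_QPr_rshift hb (w3 (c - b))).mono (by linarith))
      rwa [sub_zero] at this) (by
      unfold qlm at w4 ⊢
      have hh := (measurePreserving_sub_right volume b).quasiMeasurePreserving.ae ((ae_restrict_iff' measurableSet_Ioi).1 w4)
      rw [ae_restrict_iff' measurableSet_Ioo] at h0
      rw [ae_restrict_iff' measurableSet_Ioi]
      have hne : ∀ᵐ t : ℝ, t ≠ b := by simp [ae_iff, measure_singleton]
      filter_upwards [hh, h0, hne] with t q1 q2 q3 q4
      rcases le_or_gt t b with h6 | h6
      · rw [indicator_of_notMem (by simpa using h6), indicator_of_notMem (by simpa using h6), sub_zero, sub_zero]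
        exact q2 ⟨q4, lt_of_le_of_ne h6 q3⟩
      · rw [indicator_of_mem (mem_Ioi.2 h6), indicator_of_mem (mem_Ioi.2 h6)]
        have := q1 (by simpa using h6)
        simp only [add_sub_cancel] at this
        rw [map_sub, ← add_sub_add_comm, this, sub_self])
  filter_upwards [ql_ae_loc b k, ae_restrict_mem measurableSet_Ioo] with t q1 q2
  rw [indicator_of_notMem (by simpa using q2.2.le), sub_zero] at q1
  exact q1

end qllin

section qllin2
open Filter Topology intervalIntegral
open scoped ENNReal NNReal
variable {p : ℝ} [hp : Fact (1 < p)] {ι A : X₁ →L[ℂ] X₀} {M : ℝ≥0}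

theorem ql_memLp_bdd {X : Type*} [NormedAddCommGroup X] {f : ℝ → X} {c K : ℝ}
    (hf : AEStronglyMeasurable f qlm) (hK : ∀ t, 0 < t → ‖f t‖ ≤ K) (hc : ∀ t, c < t → f t = 0) :
    MemLp f (ENNReal.ofReal p) qlm := by
  have h1 : (Ioc 0 c).indicator f =ᵐ[qlm] f := by
    unfold qlm
    filter_upwards [ae_restrict_mem measurableSet_Ioi] with t ht
    by_cases h : t ≤ c
    · rw [indicator_of_mem (show t ∈ Ioc 0 c from ⟨ht, h⟩)]
    · rw [indicator_of_notMem (fun hh => h hh.2), hc t (not_le.1 h)]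
  refine MemLp.ae_eq h1 ?_
  rw [memLp_indicator_iff_restrict measurableSet_Ioc]
  haveI : IsFiniteMeasure (qlm.restrict (Ioc 0 c)) := by
    constructor
    rw [Measure.restrict_apply_univ]
    exact (Measure.restrict_le_self _).trans_lt (by simp)
  refine MemLp.of_bound hf.restrict K ?_
  filter_upwards [ae_restrict_mem measurableSet_Ioc] with t ht using hK t ht.1

theorem ql_int_ind {X : Type*} [NormedAddCommGroup X] [NormedSpace ℝ X] {f : ℝ → X} {b t : ℝ}
    (ht : 0 ≤ t) (htb : t ≤ b) : ∫ r in (0:ℝ)..t, (Ioo 0 b).indicator f r = ∫ r in (0:ℝ)..t, f r := by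
  refine ql_icongr (b := b) ?_ ht htb
  filter_upwards [ae_restrict_mem measurableSet_Ioo] with r hr
  rw [indicator_of_mem hr]

/-- local uniqueness in `L¹` -/
theorem ql_uniq (h : QMR p ι A M) {b : ℝ} {d : ℝ → X₁} {d' : ℝ → X₀} (hq : QPr ι b 0 d d')
    (h0 : ∀ᵐ t ∂(volume.restrict (Ioo 0 b)), d' t + A (d t) = 0) :
    ∀ᵐ t ∂(volume.restrict (Ioo 0 b)), d t = 0 := by
  rcases le_or_gt b 0 with hb | hb
  · simp [hb]
  obtain ⟨hd, hd', he⟩ := hq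
  set y := ∫ r in (0:ℝ)..b, d r with hy
  set dh : ℝ → X₁ := fun t => (Ioo 0 b).indicator d t - (Ioc b (b + 1)).indicator (fun _ => y) t with hdh
  have i1 : Integrable ((Ioo 0 b).indicator d) := hd.integrable_indicator measurableSet_Ioo
  have i2 : Integrable ((Ioc b (b + 1)).indicator (fun _ => y)) :=
    (integrableOn_const (by simp)).integrable_indicator measurableSet_Ioc
  have i3 : Integrable dh := i1.sub i2
  set U : ℝ → X₁ := fun t => ∫ r in (0:ℝ)..t, dh r with hU
  have Uc : Continuous U := continuous_primitive (fun _ _ => i3.intervalIntegrable) 0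
  have U0 : ∀ t, b + 1 ≤ t → U t = 0 := by
    intro t ht
    rw [hU]
    simp only [hdh]
    rw [intervalIntegral.integral_sub i1.intervalIntegrable i2.intervalIntegrable]
    rw [integral_of_le (by linarith), integral_of_le (by linarith),
      setIntegral_indicator measurableSet_Ioo, setIntegral_indicator measurableSet_Ioc,
      inter_eq_right.2 (Ioo_subset_Ioc_self.trans (Ioc_subset_Ioc_right (by linarith))),
      inter_eq_right.2 (Ioc_subset_Ioc hb.le ht), setIntegral_const, hy, integral_of_le hb.le,
      integral_Ioc_eq_integral_Ioo]
    simp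
  have Ub : ∀ t ∈ Icc 0 b, U t = ∫ r in (0:ℝ)..t, d r := by
    intro t ht
    refine ql_icongr (b := b) ?_ ht.1 ht.2
    filter_upwards [ae_restrict_mem measurableSet_Ioo] with r hr
    rw [hdh]
    simp only
    rw [indicator_of_mem hr, indicator_of_notMem (fun hh => absurd hh.1 (not_lt.2 hr.2.le)), sub_zero]
  obtain ⟨K, hK⟩ : ∃ K, ∀ t, 0 < t → ‖U t‖ ≤ K := by
    obtain ⟨K, hK⟩ := (isCompact_Icc (a := (0:ℝ)) (b := b + 1)).exists_bound_of_continuousOn Uc.continuousOn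
    refine ⟨K, fun t ht => ?_⟩
    rcases le_total t (b + 1) with h | h
    · exact hK t ⟨ht.le, h⟩
    · rw [U0 t h, norm_zero]
      exact (norm_nonneg _).trans (hK 0 ⟨le_rfl, by linarith⟩)
  have hUm : MemLp U (ENNReal.ofReal p) qlm :=
    ql_memLp_bdd (c := b + 1) Uc.aestronglyMeasurable hK (fun t ht => U0 t ht.le)
  -- derivative
  set G : ℝ → X₀ := fun t => ∫ r in (0:ℝ)..t, (Ioo 0 b).indicator d' r with hG
  have Gc : Continuous G :=
    continuous_primitive (fun _ _ => (hd'.integrable_indicator measurableSet_Ioo).intervalIntegrable) 0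
  set U' : ℝ → X₀ := fun t => (Ioo 0 b).indicator G t - (Ioc b (b + 1)).indicator (fun _ => ι y) t with hU'
  have hU'm : MemLp U' (ENNReal.ofReal p) qlm := by
    obtain ⟨K, hK⟩ := (isCompact_Icc (a := (0:ℝ)) (b := b)).exists_bound_of_continuousOn Gc.continuousOn
    refine (ql_memLp_bdd (c := b) (K := K) ?_ ?_ ?_).sub (ql_memLp_bdd (c := b + 1) (K := ‖ι y‖) ?_ ?_ ?_)
    · exact (Gc.stronglyMeasurable.indicator measurableSet_Ioo).aestronglyMeasurable
    · intro t ht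
      by_cases h : t ∈ Ioo 0 b
      · rw [indicator_of_mem h]; exact hK t ⟨h.1.le, h.2.le⟩
      · rw [indicator_of_notMem h, norm_zero]
        exact (norm_nonneg _).trans (hK 0 ⟨le_rfl, hb.le⟩)
    · intro t ht
      exact indicator_of_notMem (fun h => absurd h.2 (not_lt.2 ht.le)) _
    · exact (stronglyMeasurable_const.indicator measurableSet_Ioc).aestronglyMeasurable
    · intro t ht
      exact norm_indicator_le_norm_self _ _
    · intro t ht
      exact indicator_of_notMem (fun h => absurd h.2 (not_le.2 ht)) _
  have hGd : ∀ᵐ t ∂(volume.restrict (Ioo 0 b)), G t = ι (d t) := by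
    filter_upwards [he, ae_restrict_mem measurableSet_Ioo] with t q1 q2
    rw [q1, zero_add, hG]
    exact ql_int_ind q2.1.le q2.2.le
  have hUQ : ∀ c, QPr ι c 0 U U' := by
    intro c
    refine ⟨Uc.integrableOn_Icc.mono_set Ioo_subset_Icc_self, ?_, Eventually.of_forall fun t => ?_⟩
    · rw [← ql_nu_one p] at hU'm
      exact ql_int_of_memLp (p := p) (μ := 1) (hU'm.restrict _)
    · rw [zero_add, hU, ← ι.intervalIntegral_comp_comm i3.intervalIntegrable]
      refine integral_congr_ae ?_
      rw [ae_restrict_iff' measurableSet_Ioo] at hGd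
      filter_upwards [hGd] with r q1 _
      simp only [hdh, hU', map_sub]
      congr 1
      · by_cases h : r ∈ Ioo 0 b
        · rw [indicator_of_mem h, indicator_of_mem h, q1 h]
        · rw [indicator_of_notMem h, indicator_of_notMem h, map_zero]
      · by_cases h : r ∈ Ioc b (b + 1)
        · rw [indicator_of_mem h, indicator_of_mem h]
        · rw [indicator_of_notMem h, indicator_of_notMem h, map_zero]
  have hz := ql_causal h hb.le hUm hU'm hUQ (by
    filter_upwards [ae_restrict_mem measurableSet_Ioo] with t ht
    simp only [hU']
    rw [indicator_of_mem ht, indicator_of_notMem (fun hh => absurd hh.1 (not_lt.2 ht.2.le)), sub_zero,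
      Ub t ⟨ht.1.le, ht.2.le⟩, ← A.intervalIntegral_comp_comm (ql_ii hd le_rfl ht.1.le hb.le ht.2.le), hG]
    simp only
    rw [ql_int_ind ht.1.le ht.2.le, ← intervalIntegral.integral_add (ql_ii hd' le_rfl ht.1.le hb.le ht.2.le)
      (ql_ii (A.integrable_comp hd) le_rfl ht.1.le hb.le ht.2.le)]
    have := ql_icongr h0 ht.1.le ht.2.le
    simpa using this)
  refine ql_zero_deriv (x := 0) hd ?_
  filter_upwards [hz, ae_restrict_mem measurableSet_Ioo] with t q1 q2
  rw [zero_add, ← Ub t ⟨q2.1.le, q2.2.le⟩, q1]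

theorem ql_qlm_restrict (b : ℝ) : qlm.restrict (Ioo 0 b) = volume.restrict (Ioo 0 b) := by
  unfold qlm
  rw [Measure.restrict_restrict measurableSet_Ioo, inter_eq_left.2 (fun t ht => ht.1)]

/-- solve locally -/
theorem ql_solve (h : QMR p ι A M) {b : ℝ} {g : ℝ → X₀} (hg : MemLp g (ENNReal.ofReal p) (volume.restrict (Ioo 0 b))) :
    ∃ z z', QPr ι b 0 z z' ∧ (∀ᵐ t ∂(volume.restrict (Ioo 0 b)), z' t + A (z t) = g t) ∧
      eLpNorm z (ENNReal.ofReal p) (volume.restrict (Ioo 0 b)) ≤ M * eLpNorm g (ENNReal.ofReal p) (volume.restrict (Ioo 0 b)) ∧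
      eLpNorm z' (ENNReal.ofReal p) (volume.restrict (Ioo 0 b)) ≤ M * eLpNorm g (ENNReal.ofReal p) (volume.restrict (Ioo 0 b)) := by
  have hf : MemLp ((Ioo 0 b).indicator g) (ENNReal.ofReal p) qlm := by
    rw [memLp_indicator_iff_restrict measurableSet_Ioo, ql_qlm_restrict]
    exact hg
  have hn : eLpNorm ((Ioo 0 b).indicator g) (ENNReal.ofReal p) qlm = eLpNorm g (ENNReal.ofReal p) (volume.restrict (Ioo 0 b)) := by
    rw [eLpNorm_indicator_eq_eLpNorm_restrict measurableSet_Ioo, ql_qlm_restrict]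
  obtain ⟨u, u', u1, u2, u3, u4, u5, u6⟩ := h.1 _ hf
  rw [hn] at u5 u6
  refine ⟨u, u', u3 b, ?_, ?_, ?_⟩
  · filter_upwards [ql_ae_loc b u4, ae_restrict_mem measurableSet_Ioo] with t q1 q2
    rw [q1, indicator_of_mem q2]
  · rw [← ql_qlm_restrict b]
    rw [← ql_qlm_restrict b] at u5
    exact (eLpNorm_mono_measure _ Measure.restrict_le_self).trans u5
  · rw [← ql_qlm_restrict b]
    rw [← ql_qlm_restrict b] at u6
    exact (eLpNorm_mono_measure _ Measure.restrict_le_self).trans u6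

theorem ql_est (h : QMR p ι A M) {b : ℝ} {g : ℝ → X₀} {z : ℝ → X₁} {z' : ℝ → X₀}
    (hg : MemLp g (ENNReal.ofReal p) (volume.restrict (Ioo 0 b))) (hq : QPr ι b 0 z z')
    (he : ∀ᵐ t ∂(volume.restrict (Ioo 0 b)), z' t + A (z t) = g t) :
    eLpNorm z (ENNReal.ofReal p) (volume.restrict (Ioo 0 b)) ≤ M * eLpNorm g (ENNReal.ofReal p) (volume.restrict (Ioo 0 b)) ∧
    eLpNorm z' (ENNReal.ofReal p) (volume.restrict (Ioo 0 b)) ≤ M * eLpNorm g (ENNReal.ofReal p) (volume.restrict (Ioo 0 b)) := by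
  obtain ⟨v, v', v1, v2, v3, v4⟩ := ql_solve h hg
  have hd := hq.sub v1
  rw [sub_zero] at hd
  have k := ql_uniq h hd (by
    filter_upwards [he, v2] with t q1 q2
    rw [map_sub, ← add_sub_add_comm, q1, q2, sub_self])
  have k1 : z =ᵐ[volume.restrict (Ioo 0 b)] v := by
    filter_upwards [k] with t ht using sub_eq_zero.1 ht
  have k2 : z' =ᵐ[volume.restrict (Ioo 0 b)] v' := by
    filter_upwards [k1, he, v2] with t q1 q2 q3
    rw [← q3, q1] at q2
    exact add_right_cancel q2
  rw [eLpNorm_congr_ae k1, eLpNorm_congr_ae k2]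
  exact ⟨v3, v4⟩

theorem ql_hold1 {X : Type*} [NormedAddCommGroup X] [NormedSpace ℝ X] {f : ℝ → X} {b : ℝ} (hb : 0 ≤ b)
    (hf : AEStronglyMeasurable f (volume.restrict (Ioo 0 b))) :
    ‖∫ r in (0:ℝ)..b, f r‖ₑ ≤ ENNReal.ofReal (b ^ (1 - 1 / p)) *
      eLpNorm f (ENNReal.ofReal p) (volume.restrict (Ioo 0 b)) := by
  have h0 : 0 < p := by linarith [hp.out]
  have h1 : 0 ≤ 1 - 1 / p := by
    have := (qlFactOne1 p).out
    linarith
  rw [integral_of_le hb, integral_Ioc_eq_integral_Ioo]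
  refine (enorm_integral_le_lintegral_enorm _).trans ?_
  rw [← eLpNorm_one_eq_lintegral_enorm]
  refine (eLpNorm_le_eLpNorm_mul_rpow_measure_univ (qlFactP p).out hf).trans (le_of_eq ?_)
  rw [mul_comm]
  congr 1
  rw [Measure.restrict_apply_univ, Real.volume_Ioo, sub_zero, ENNReal.toReal_ofReal h0.le, ENNReal.toReal_one,
    ENNReal.ofReal_rpow_of_nonneg hb (by simpa using h1)]
  simp

end qllin2

section qllin3
open Filter Topology intervalIntegral
open scoped ENNReal NNReal
variable {p : ℝ} [hp : Fact (1 < p)] {ι A : X₁ →L[ℂ] X₀} {M : ℝ≥0}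

theorem ql_phi_bd {X : Type*} [NormedAddCommGroup X] [NormedSpace ℝ X] {φ : ℝ → ℝ} {f : ℝ → X} {b : ℝ}
    (hφ : ContinuousOn φ (Icc 0 b)) (hf : IntegrableOn f (Ioo 0 b)) :
    IntegrableOn (fun t => φ t • f t) (Ioo 0 b) := by
  obtain ⟨K, hK⟩ := (isCompact_Icc (a := (0:ℝ)) (b := b)).exists_bound_of_continuousOn hφ
  refine Integrable.bdd_smul (C := K) hf ?_ ?_
  · exact (hφ.mono Ioo_subset_Icc_self).aestronglyMeasurable measurableSet_Ioo
  · filter_upwards [ae_restrict_mem measurableSet_Ioo] with t ht using hK t ⟨ht.1.le, ht.2.le⟩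

theorem ql_phi_bd2 {X : Type*} [NormedAddCommGroup X] [NormedSpace ℝ X] {g : ℝ → ℝ} {w : ℝ → X} {b : ℝ}
    (hw : ContinuousOn w (Icc 0 b)) (hg : IntegrableOn g (Ioo 0 b)) :
    IntegrableOn (fun t => g t • w t) (Ioo 0 b) := by
  obtain ⟨K, hK⟩ := (isCompact_Icc (a := (0:ℝ)) (b := b)).exists_bound_of_continuousOn hw
  refine Integrable.smul_bdd (C := K) hg ?_ ?_
  · exact (hw.mono Ioo_subset_Icc_self).aestronglyMeasurable measurableSet_Ioo
  · filter_upwards [ae_restrict_mem measurableSet_Ioo] with t ht using hK t ⟨ht.1.le, ht.2.le⟩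

theorem ql_mulprim {g : ℝ → ℝ} {f : ℝ → X₀} {x : X₀} {b t : ℝ} (hg : IntegrableOn g (Ioo 0 b))
    (hf : IntegrableOn f (Ioo 0 b)) (ht : 0 ≤ t) (htb : t ≤ b) :
    (∫ s in (0:ℝ)..t, g s) • (x + ∫ s in (0:ℝ)..t, f s) =
      ∫ s in (0:ℝ)..t, (g s • (x + ∫ r in (0:ℝ)..s, f r) + (∫ r in (0:ℝ)..s, g r) • f s) := by
  have hb := ht.trans htb
  have e1 := ql_ibp ht (ql_ii hg le_rfl ht hb htb) (ql_ii hf le_rfl ht hb htb)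
  have e2 : (∫ s in (0:ℝ)..t, g s) • x = ∫ s in (0:ℝ)..t, g s • x := by
    rw [intervalIntegral.integral_smul_const]
  have c1 := ql_prim_cont 0 hg
  have c2 := ql_prim_cont 0 hf
  simp only [zero_add] at c1 c2
  have i1 := ql_phi_bd c1 hf
  have i2 := ql_phi_bd2 c2 hg
  have i3 : IntegrableOn (fun s => g s • x) (Ioo 0 b) := Integrable.smul_const hg x
  rw [smul_add, e1, e2, ← intervalIntegral.integral_add (ql_ii i3 le_rfl ht hb htb)
    ((ql_ii i2 le_rfl ht hb htb).add (ql_ii i1 le_rfl ht hb htb))]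
  refine intervalIntegral.integral_congr fun s _ => ?_
  simp only [smul_add, add_assoc]

theorem ql_mulQPr {g : ℝ → ℝ} {u : ℝ → X₁} {u' : ℝ → X₀} {x : X₀} {b : ℝ} (hg : IntegrableOn g (Ioo 0 b))
    (h : QPr ι b x u u') :
    QPr ι b 0 (fun t => (∫ s in (0:ℝ)..t, g s) • u t)
      (fun s => g s • (x + ∫ r in (0:ℝ)..s, u' r) + (∫ r in (0:ℝ)..s, g r) • u' s) := by
  have c1 := ql_prim_cont 0 hg
  simp only [zero_add] at c1
  refine ⟨ql_phi_bd c1 h.1, (ql_phi_bd2 (ql_prim_cont x h.2.1) hg).add (ql_phi_bd c1 h.2.1), ?_⟩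
  filter_upwards [h.2.2, ae_restrict_mem measurableSet_Ioo] with t h1 h2
  rw [zero_add, ← ql_mulprim hg h.2.1 h2.1.le h2.2.le, ← h1]
  exact ι.map_smul_of_tower _ _

/-- homogeneous solutions -/
theorem ql_fact4 (h : QMR p ι A M) {b : ℝ} (hb : 0 < b) {x : X₀} {v : ℝ → X₁} {v' : ℝ → X₀}
    (hq : QPr ι b x v v') (h0 : ∀ᵐ t ∂(volume.restrict (Ioo 0 b)), v' t + A (v t) = 0) :
    ‖x + ∫ r in (0:ℝ)..b, v' r‖ₑ ≤ M * (M * ‖x‖ₑ) := by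
  have h1 : IntegrableOn (fun _ : ℝ => (1:ℝ)) (Ioo 0 b) := integrableOn_const (by simp)
  have cU := ql_prim_cont 0 hq.1
  have cU' := ql_prim_cont x hq.2.1
  simp only [zero_add] at cU
  have qU : QPr ι b 0 (fun t => ∫ r in (0:ℝ)..t, v r) (fun t => x + ∫ r in (0:ℝ)..t, v' r) := by
    refine ⟨cU.integrableOn_Icc.mono_set Ioo_subset_Icc_self, cU'.integrableOn_Icc.mono_set Ioo_subset_Icc_self, ?_⟩
    filter_upwards [ae_restrict_mem measurableSet_Ioo] with t ht
    rw [zero_add, ← ι.intervalIntegral_comp_comm (ql_ii hq.1 le_rfl ht.1.le hb.le ht.2.le)]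
    exact ql_icongr hq.2.2 ht.1.le ht.2.le
  have eU := ql_est h (g := fun _ => x) (memLp_const x) qU (by
    filter_upwards [ae_restrict_mem measurableSet_Ioo] with t ht
    rw [← A.intervalIntegral_comp_comm (ql_ii hq.1 le_rfl ht.1.le hb.le ht.2.le), add_assoc,
      ← intervalIntegral.integral_add (ql_ii hq.2.1 le_rfl ht.1.le hb.le ht.2.le)
      (ql_ii (A.integrable_comp hq.1) le_rfl ht.1.le hb.le ht.2.le)]
    have := ql_icongr h0 ht.1.le ht.2.le
    simp only [intervalIntegral.integral_zero] at this
    rw [this, add_zero])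
  have hUm : MemLp (fun t => x + ∫ r in (0:ℝ)..t, v' r) (ENNReal.ofReal p) (volume.restrict (Ioo 0 b)) := by
    refine ⟨(cU'.mono Ioo_subset_Icc_self).aestronglyMeasurable measurableSet_Ioo, eU.2.trans_lt ?_⟩
    exact ENNReal.mul_lt_top ENNReal.coe_lt_top (memLp_const x).2
  have qz := ql_mulQPr h1 hq
  have ez := ql_est h hUm qz (by
    filter_upwards [h0] with t ht
    have : A ((∫ s in (0:ℝ)..t, (1:ℝ)) • v t) = (∫ s in (0:ℝ)..t, (1:ℝ)) • A (v t) := A.map_smul_of_tower _ _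
    rw [this, add_assoc, ← smul_add, ht, smul_zero, add_zero, one_smul])
  have k := ql_hold1 (p := p) hb.le qz.2.1.aestronglyMeasurable
  rw [← ql_mulprim h1 hq.2.1 hb.le le_rfl] at k
  have k2 := k.trans (mul_le_mul_right (ez.2.trans (mul_le_mul_right eU.2 _)) _)
  have p0 : 0 < p := by linarith [hp.out]
  have e3 : eLpNorm (fun _ : ℝ => x) (ENNReal.ofReal p) (volume.restrict (Ioo 0 b)) = ‖x‖ₑ * ENNReal.ofReal (b ^ (1 / p)) := by
    rw [eLpNorm_const' x (by simpa using p0) (by simp), Measure.restrict_apply_univ, Real.volume_Ioo, sub_zero,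
      ENNReal.toReal_ofReal p0.le, ENNReal.ofReal_rpow_of_nonneg hb.le (by positivity)]
  rw [e3, enorm_smul, intervalIntegral.integral_const, sub_zero, smul_eq_mul, mul_one, Real.enorm_eq_ofReal hb.le] at k2
  have e4 : ENNReal.ofReal (b ^ (1 - 1 / p)) * ENNReal.ofReal (b ^ (1 / p)) = ENNReal.ofReal b := by
    rw [← ENNReal.ofReal_mul (by positivity), ← Real.rpow_add hb]
    simp
  have e5 : ENNReal.ofReal (b ^ (1 - 1 / p)) * (M * (M * (‖x‖ₑ * ENNReal.ofReal (b ^ (1 / p))))) =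
      ENNReal.ofReal b * (M * (M * ‖x‖ₑ)) := by
    rw [← e4]; ring
  rw [e5] at k2
  exact (ENNReal.mul_le_mul_iff_right (by simpa using hb) (by simp)).1 k2

theorem ql_fact5 (h : QMR p ι A M) {b : ℝ} (hb : 0 < b) {x : X₀} {u : ℝ → X₁} {u' g : ℝ → X₀}
    (hq : QPr ι b x u u') (hg : MemLp g (ENNReal.ofReal p) (volume.restrict (Ioo 0 b)))
    (h0 : ∀ᵐ t ∂(volume.restrict (Ioo 0 b)), u' t + A (u t) = g t) :
    ‖x + ∫ r in (0:ℝ)..b, u' r‖ₑ ≤ M * (M * ‖x‖ₑ) +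
      ENNReal.ofReal (b ^ (1 - 1 / p)) * (M * eLpNorm g (ENNReal.ofReal p) (volume.restrict (Ioo 0 b))) := by
  obtain ⟨z, z', z1, z2, z3, z4⟩ := ql_solve h hg
  have hd := hq.sub z1
  rw [sub_zero] at hd
  have k := ql_fact4 h hb hd (by
    filter_upwards [h0, z2] with t q1 q2
    rw [map_sub, ← add_sub_add_comm, q1, q2, sub_self])
  rw [intervalIntegral.integral_sub (ql_ii hq.2.1 le_rfl hb.le hb.le le_rfl) (ql_ii z1.2.1 le_rfl hb.le hb.le le_rfl)] at k
  have e : x + ∫ r in (0:ℝ)..b, u' r = (x + ((∫ r in (0:ℝ)..b, u' r) - ∫ r in (0:ℝ)..b, z' r)) + ∫ r in (0:ℝ)..b, z' r := by abel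
  rw [e]
  refine (enorm_add_le _ _).trans (add_le_add k ?_)
  refine (ql_hold1 (p := p) hb.le z1.2.1.aestronglyMeasurable).trans ?_
  gcongr
end qllin3

section qllin4
open Filter Topology intervalIntegral
open scoped ENNReal NNReal
variable {p : ℝ} [hp : Fact (1 < p)] {ι A : X₁ →L[ℂ] X₀} {M : ℝ≥0}

theorem ql_shiftnorm {X : Type*} [NormedAddCommGroup X] (f : ℝ → X) {a t α : ℝ} (ha : 0 < a) (hα : 0 ≤ α) :
    eLpNorm (fun s => f (a + s)) (ENNReal.ofReal p) (volume.restrict (Ioo 0 (t - a))) ≤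
      ENNReal.ofReal (a ^ (-α)) * (∫⁻ s in Ioo 0 t, ENNReal.ofReal (s ^ (α * p)) * ‖f s‖ₑ ^ p) ^ (1 / p) := by
  have p0 : 0 < p := by linarith [hp.out]
  rw [ql_eLp]
  have h1 := (measurePreserving_add_left volume a).setLIntegral_comp_preimage_emb
    (measurableEmbedding_addLeft a) (fun s => ‖f s‖ₑ ^ p) (Ioo a t)
  rw [preimage_const_add_Ioo, sub_self] at h1
  rw [h1]
  have h2 : ∫⁻ s in Ioo a t, ‖f s‖ₑ ^ p ≤ ENNReal.ofReal (a ^ (-α * p)) *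
      ∫⁻ s in Ioo 0 t, ENNReal.ofReal (s ^ (α * p)) * ‖f s‖ₑ ^ p := by
    rw [← lintegral_const_mul' _ _ ENNReal.ofReal_ne_top]
    refine le_trans ?_ (lintegral_mono_set (Ioo_subset_Ioo_left ha.le))
    refine setLIntegral_mono' measurableSet_Ioo fun s hs => ?_
    rw [← mul_assoc, ← ENNReal.ofReal_mul (by positivity)]
    have : (1:ℝ) ≤ a ^ (-α * p) * s ^ (α * p) := by
      rw [neg_mul, Real.rpow_neg ha.le, inv_mul_eq_div, one_le_div (by positivity)]
      exact Real.rpow_le_rpow ha.le hs.1.le (by positivity)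
    calc _ = ENNReal.ofReal 1 * ‖f s‖ₑ ^ p := by simp
      _ ≤ _ := by gcongr
  refine (ENNReal.rpow_le_rpow h2 (by positivity)).trans (le_of_eq ?_)
  rw [ENNReal.mul_rpow_of_nonneg _ _ (by positivity), ENNReal.ofReal_rpow_of_nonneg (by positivity) (by positivity),
    ← Real.rpow_mul ha.le]
  congr 3
  field_simp

theorem ql_fact6 (h : QMR p ι A M) {α : ℝ} (hα : 0 ≤ α) (hα1 : α < 1 - 1 / p) :
    ∃ K : ℝ, 0 ≤ K ∧ ∀ (ε : ℝ) (f : ℝ → X₀) (u : ℝ → X₁) (u' : ℝ → X₀), 0 < ε →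
      MemLp f (ENNReal.ofReal p) qlm → (∀ b, QPr ι b 0 u u') → (∀ᵐ t ∂qlm, u' t + A (u t) = f t) →
      (∀ t, 0 < t → t < ε → f t = 0) → ∀ t, 0 < t →
      ‖∫ r in (0:ℝ)..t, u' r‖ₑ ≤ ENNReal.ofReal (K * t ^ (1 - 1 / p - α)) *
        (∫⁻ s in Ioo 0 t, ENNReal.ofReal (s ^ (α * p)) * ‖f s‖ₑ ^ p) ^ (1 / p) := by
  have p0 : 0 < p := by linarith [hp.out]
  set β := 1 - 1 / p - α with hβ
  have hβ0 : 0 < β := by linarith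
  obtain ⟨l, hl1, hl2⟩ : ∃ l : ℝ, 1 < l ∧ (M:ℝ) * M * l ^ (-β) ≤ 1 / 2 := by
    have : Tendsto (fun l : ℝ => (M:ℝ) * M * l ^ (-β)) atTop (𝓝 ((M:ℝ) * M * 0)) :=
      (tendsto_rpow_neg_atTop hβ0).const_mul _
    rw [mul_zero] at this
    have h2 := (this.eventually (ge_mem_nhds (show (0:ℝ) < 1 / 2 by norm_num))).and (eventually_gt_atTop 1)
    obtain ⟨l, a1, a2⟩ := h2.exists
    exact ⟨l, a2, a1⟩
  have l0 : 0 < l := by linarith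
  refine ⟨2 * M * l ^ α, by positivity, ?_⟩
  intro ε f u u' hε hf hq he hf0
  set K := 2 * (M:ℝ) * l ^ α with hK
  have K0 : 0 ≤ K := by positivity
  have main : ∀ n : ℕ, ∀ t, 0 < t → t ≤ ε * l ^ n →
      ‖∫ r in (0:ℝ)..t, u' r‖ₑ ≤ ENNReal.ofReal (K * t ^ β) *
        (∫⁻ s in Ioo 0 t, ENNReal.ofReal (s ^ (α * p)) * ‖f s‖ₑ ^ p) ^ (1 / p) := by
    intro n
    induction n with
    | zero =>
      intro t ht hte
      rw [pow_zero, mul_one] at hte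
      have e0 : ∀ᵐ t ∂(volume.restrict (Ioo 0 ε)), u' t + A (u t) = 0 := by
        filter_upwards [ql_ae_loc ε he, ae_restrict_mem measurableSet_Ioo] with s q1 q2
        rw [q1, hf0 s q2.1 q2.2]
      have e1 := ql_uniq h (hq ε) e0
      have e2 : ∀ᵐ t ∂(volume.restrict (Ioo 0 ε)), u' t = 0 := by
        filter_upwards [e0, e1] with s q1 q2
        rwa [q2, map_zero, add_zero] at q1
      rw [ql_icongr e2 ht.le hte]
      simp
    | succ n ih =>
      intro t ht hte
      set a := t / l with ha
      have a0 : 0 < a := by positivity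
      have hat : a < t := by rw [ha, div_lt_iff₀ l0]; nlinarith
      have han : a ≤ ε * l ^ n := by
        rw [ha, div_le_iff₀ l0, mul_assoc, ← pow_succ]; exact hte
      have i1 := ih a a0 han
      have sh := (hq t).shift a0.le
      rw [zero_add] at sh
      have f5 := ql_fact5 h (sub_pos.2 hat) sh (g := fun s => f (a + s)) (by
        have h1 := (measurePreserving_add_left volume a).restrict_preimage_emb
          (measurableEmbedding_addLeft a) (Ioo a t)
        rw [preimage_const_add_Ioo, sub_self] at h1
        have h2 : MemLp f (ENNReal.ofReal p) (volume.restrict (Ioo a t)) := by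
          refine hf.mono_measure ?_
          unfold qlm
          exact Measure.restrict_mono (fun s hs => a0.trans hs.1) le_rfl
        exact h2.comp_measurePreserving h1) (by
        exact ql_ae_shift (b := t) a0.le (P := fun s => u' s + A (u s) = f s) (ql_ae_loc t he))
      have e1 : (∫ r in (0:ℝ)..a, u' r) + ∫ r in (0:ℝ)..(t - a), u' (a + r) = ∫ r in (0:ℝ)..t, u' r := by
        rw [intervalIntegral.integral_comp_add_left (fun r => u' r) a]
        rw [add_zero, add_sub_cancel]
        exact intervalIntegral.integral_add_adjacent_intervals (ql_ii (hq t).2.1 le_rfl a0.le ht.le hat.le)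
          (ql_ii (hq t).2.1 a0.le ht.le hat.le le_rfl)
      rw [e1] at f5
      refine f5.trans ?_
      set J := (∫⁻ s in Ioo 0 t, ENNReal.ofReal (s ^ (α * p)) * ‖f s‖ₑ ^ p) ^ (1 / p) with hJ
      have hJa : (∫⁻ s in Ioo 0 a, ENNReal.ofReal (s ^ (α * p)) * ‖f s‖ₑ ^ p) ^ (1 / p) ≤ J := by
        refine ENNReal.rpow_le_rpow (lintegral_mono_set (Ioo_subset_Ioo_right hat.le)) (by positivity)
      have sn := ql_shiftnorm (p := p) f (t := t) a0 hα
      have b1 : M * (M * ‖∫ r in (0:ℝ)..a, u' r‖ₑ) ≤ ENNReal.ofReal (K / 2 * t ^ β) * J := by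
        calc M * (M * ‖∫ r in (0:ℝ)..a, u' r‖ₑ) ≤ M * (M * (ENNReal.ofReal (K * a ^ β) * J)) := by
              gcongr
              exact i1.trans (by gcongr)
          _ = ENNReal.ofReal (M * (M * (K * a ^ β))) * J := by
              rw [ENNReal.ofReal_mul (p := (M:ℝ)) (by positivity), ENNReal.ofReal_mul (p := (M:ℝ)) (by positivity), ENNReal.ofReal_coe_nnreal]
              ring
          _ ≤ _ := by
              refine mul_le_mul_left (ENNReal.ofReal_le_ofReal ?_) _
              rw [ha, Real.div_rpow ht.le l0.le]
              rw [Real.rpow_neg l0.le] at hl2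
              have : (M:ℝ) * (M * (K * (t ^ β / l ^ β))) = (M * M * (l ^ β)⁻¹) * (K * t ^ β) := by
                field_simp
              rw [this]
              calc _ ≤ 1 / 2 * (K * t ^ β) := by gcongr
                _ = _ := by ring
      have b2 : ENNReal.ofReal ((t - a) ^ (1 - 1 / p)) * (M * eLpNorm (fun s => f (a + s)) (ENNReal.ofReal p)
          (volume.restrict (Ioo 0 (t - a)))) ≤ ENNReal.ofReal (K / 2 * t ^ β) * J := by
        calc _ ≤ ENNReal.ofReal (t ^ (1 - 1 / p)) * (M * (ENNReal.ofReal (a ^ (-α)) * J)) := by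
              gcongr
              · linarith
              · linarith
          _ = ENNReal.ofReal (t ^ (1 - 1 / p) * (M * a ^ (-α))) * J := by
              rw [ENNReal.ofReal_mul (by positivity), ENNReal.ofReal_mul (by positivity), ENNReal.ofReal_coe_nnreal]
              ring
          _ = _ := by
              congr 2
              have hb : t ^ β = t ^ (1 - 1 / p) * t ^ (-α) := by
                rw [← Real.rpow_add ht, hβ]; ring_nf
              rw [hb, ha, Real.div_rpow ht.le l0.le, Real.rpow_neg l0.le]
              have hK2 : K / 2 = M * l ^ α := by rw [hK]; ring
              rw [hK2]
              generalize t ^ (1 - 1 / p) = q1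
              generalize t ^ (-α) = q2
              field_simp
      refine (add_le_add b1 b2).trans (le_of_eq ?_)
      rw [← add_mul, ← ENNReal.ofReal_add (by positivity) (by positivity)]
      congr 2
      ring
  intro t ht
  obtain ⟨n, hn⟩ := pow_unbounded_of_one_lt (t / ε) hl1
  refine main n t ht ?_
  rw [div_lt_iff₀ hε] at hn
  linarith

theorem ql_tail {s γ : ℝ} (hs : 0 < s) (hγ : 0 < γ) :
    ∫⁻ t in Ioi s, ENNReal.ofReal (t ^ (-1 - γ)) = ENNReal.ofReal (s ^ (-γ) / γ) := by
  rw [← ofReal_integral_eq_lintegral_ofReal (integrableOn_Ioi_rpow_of_lt (by linarith) hs)]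
  · rw [integral_Ioi_rpow_of_lt (by linarith) hs]
    congr 1
    have : -1 - γ + 1 = -γ := by ring
    rw [this, neg_div_neg_eq]
  · filter_upwards [ae_restrict_mem measurableSet_Ioi] with t ht
    have : (0:ℝ) < t := hs.trans ht
    positivity

/-- a Hardy type inequality -/
theorem ql_hardy {G : ℝ → ℝ≥0∞} (hG : AEMeasurable G (volume.restrict (Ioi 0))) {γ : ℝ} (hγ : 0 < γ) :
    ∫⁻ t in Ioi 0, ENNReal.ofReal (t ^ (-1 - γ)) * ∫⁻ s in Ioo 0 t, G s =
      ∫⁻ s in Ioi 0, G s * ENNReal.ofReal (s ^ (-γ) / γ) := by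
  set m := (volume : Measure ℝ).restrict (Ioi 0) with hm
  have mD : MeasurableSet {z : ℝ × ℝ | z.2 < z.1} := measurableSet_lt measurable_snd measurable_fst
  have e1 : ∀ t ∈ Ioi (0:ℝ), ENNReal.ofReal (t ^ (-1 - γ)) * ∫⁻ s in Ioo 0 t, G s =
      ∫⁻ s in Ioi 0, {z : ℝ × ℝ | z.2 < z.1}.indicator (fun z => ENNReal.ofReal (z.1 ^ (-1 - γ)) * G z.2) (t, s) := by
    intro t ht
    rw [← lintegral_const_mul' _ _ ENNReal.ofReal_ne_top]
    have : Ioo 0 t = Iio t ∩ Ioi 0 := by ext s; simp [and_comm]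
    rw [this, ← Measure.restrict_restrict measurableSet_Iio, ← lintegral_indicator measurableSet_Iio]
    rfl
  rw [setLIntegral_congr_fun measurableSet_Ioi e1, lintegral_lintegral_swap]
  · refine setLIntegral_congr_fun measurableSet_Ioi fun s hs => ?_
    have e2 : ∀ t, {z : ℝ × ℝ | z.2 < z.1}.indicator (fun z => ENNReal.ofReal (z.1 ^ (-1 - γ)) * G z.2) (t, s) =
        (Ioi s).indicator (fun t => ENNReal.ofReal (t ^ (-1 - γ)) * G s) t := fun t => rfl
    have hs' : (0:ℝ) < s := hs
    rw [← ql_tail hs' hγ, lintegral_congr e2, lintegral_indicator measurableSet_Ioi,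
      Measure.restrict_restrict measurableSet_Ioi, inter_eq_left.2 (Ioi_subset_Ioi hs'.le), mul_comm (G s),
      lintegral_mul_const]
    exact ENNReal.measurable_ofReal.comp (measurable_id.pow_const _)
  · refine AEMeasurable.indicator ?_ mD
    refine AEMeasurable.mul ?_ hG.comp_snd
    exact (ENNReal.measurable_ofReal.comp (measurable_fst.pow_const _)).aemeasurable
end qllin4

section qllin5
open Filter Topology intervalIntegral
open scoped ENNReal NNReal
variable {p : ℝ} [hp : Fact (1 < p)] {μ : ℝ} [hμ : Fact (1 / p < μ)] [hμ1 : Fact (μ ≤ 1)]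
  {ι A : X₁ →L[ℂ] X₀} {M : ℝ≥0}

theorem ql_nu_lint (p μ : ℝ) (g : ℝ → ℝ≥0∞) :
    ∫⁻ t, g t ∂(qlnu p μ) = ∫⁻ t in Ioi 0, ENNReal.ofReal (t ^ ((1 - μ) * p)) * g t := by
  rw [← ql_lint p μ measurableSet_Ioi le_rfl, ql_nu_Ioi]

theorem ql_nuW {X : Type*} [NormedAddCommGroup X] [NormedSpace ℝ X] (μ : ℝ) (f : ℝ → X) :
    eLpNorm (fun t => t ^ (1 - μ) • f t) (ENNReal.ofReal p) qlm = eLpNorm f (ENNReal.ofReal p) (qlnu p μ) := by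
  have p0 : 0 < p := by linarith [hp.out]
  rw [ql_eLp, ql_eLp, ql_nu_lint]
  unfold qlm
  congr 1
  refine setLIntegral_congr_fun measurableSet_Ioi fun t ht => ?_
  have ht' : (0:ℝ) < t := ht
  rw [enorm_smul, ENNReal.mul_rpow_of_nonneg _ _ p0.le, Real.enorm_eq_ofReal (by positivity),
    ENNReal.ofReal_rpow_of_nonneg (by positivity) p0.le, ← Real.rpow_mul ht'.le]

theorem ql_asm_smul {X : Type*} [NormedAddCommGroup X] [NormedSpace ℝ X] {m : Measure ℝ} (k : ℝ) {f : ℝ → X}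
    (hf : AEStronglyMeasurable f m) : AEStronglyMeasurable (fun t => t ^ k • f t) m :=
  AEStronglyMeasurable.smul (measurable_id.pow_const _).aestronglyMeasurable hf

theorem ql_fact7 (h : QMR p ι A M) (μ : ℝ) [hμ : Fact (1 / p < μ)] [hμ1 : Fact (μ ≤ 1)] :
    ∃ C : ℝ≥0, ∀ (ε : ℝ) (f : ℝ → X₀) (u : ℝ → X₁) (u' : ℝ → X₀), 0 < ε →
      MemLp f (ENNReal.ofReal p) qlm → (∀ b, QPr ι b 0 u u') → (∀ᵐ t ∂qlm, u' t + A (u t) = f t) →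
      (∀ t, 0 < t → t < ε → f t = 0) →
      eLpNorm (fun t => t ^ (-μ) • ∫ r in (0:ℝ)..t, u' r) (ENNReal.ofReal p) qlm ≤
        C * eLpNorm f (ENNReal.ofReal p) (qlnu p μ) := by
  have p0 : 0 < p := by linarith [hp.out]
  have m1 := hμ.out
  have m2 := hμ1.out
  have m3 := (qlFactOne1 p).out
  set α := 1 - (μ + 1 / p) / 2 with hα
  obtain ⟨K, K0, hK⟩ := ql_fact6 h (α := α) (by linarith) (by linarith)
  set γ := (α - 1 + μ) * p with hγ
  have γ0 : 0 < γ := mul_pos (by linarith) p0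
  refine ⟨Real.toNNReal ((K ^ p / γ) ^ (1 / p)), ?_⟩
  intro ε f u u' hε hf hq he hf0
  have b6 := hK ε f u u' hε hf hq he hf0
  have key : ∫⁻ t in Ioi 0, ‖t ^ (-μ) • ∫ r in (0:ℝ)..t, u' r‖ₑ ^ p ≤
      ENNReal.ofReal (K ^ p / γ) * ∫⁻ s in Ioi 0, ENNReal.ofReal (s ^ ((1 - μ) * p)) * ‖f s‖ₑ ^ p := by
    have hG : AEMeasurable (fun s => ENNReal.ofReal (s ^ (α * p)) * ‖f s‖ₑ ^ p) (volume.restrict (Ioi 0)) :=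
      (ql_meas_dens _).aemeasurable.mul (hf.1.enorm.pow_const _)
    calc _ ≤ ∫⁻ t in Ioi 0, ENNReal.ofReal (K ^ p) * (ENNReal.ofReal (t ^ (-1 - γ)) *
            ∫⁻ s in Ioo 0 t, ENNReal.ofReal (s ^ (α * p)) * ‖f s‖ₑ ^ p) := by
          refine setLIntegral_mono' measurableSet_Ioi fun t ht => ?_
          have ht' : (0:ℝ) < t := ht
          rw [enorm_smul, Real.enorm_eq_ofReal (by positivity)]
          calc _ ≤ (ENNReal.ofReal (t ^ (-μ)) * (ENNReal.ofReal (K * t ^ (1 - 1 / p - α)) *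
                (∫⁻ s in Ioo 0 t, ENNReal.ofReal (s ^ (α * p)) * ‖f s‖ₑ ^ p) ^ (1 / p))) ^ p := by
                gcongr
                exact b6 t ht'
            _ = _ := by
                rw [ENNReal.mul_rpow_of_nonneg _ _ p0.le, ENNReal.mul_rpow_of_nonneg _ _ p0.le,
                  ← ENNReal.rpow_mul, one_div_mul_cancel p0.ne', ENNReal.rpow_one,
                  ENNReal.ofReal_rpow_of_nonneg (by positivity) p0.le,
                  ENNReal.ofReal_rpow_of_nonneg (by positivity) p0.le, ← mul_assoc, ← mul_assoc,
                  ← ENNReal.ofReal_mul (by positivity), ← ENNReal.ofReal_mul (by positivity)]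
                congr 2
                rw [Real.mul_rpow K0 (by positivity), ← Real.rpow_mul ht'.le, ← Real.rpow_mul ht'.le,
                  mul_left_comm, ← Real.rpow_add ht']
                congr 2
                rw [hγ]
                field_simp
                ring
      _ = ENNReal.ofReal (K ^ p) * ∫⁻ s in Ioi 0, (ENNReal.ofReal (s ^ (α * p)) * ‖f s‖ₑ ^ p) *
            ENNReal.ofReal (s ^ (-γ) / γ) := by
          rw [lintegral_const_mul' _ _ ENNReal.ofReal_ne_top, ql_hardy hG γ0]
      _ = _ := by
          rw [← lintegral_const_mul' _ _ ENNReal.ofReal_ne_top, ← lintegral_const_mul' _ _ ENNReal.ofReal_ne_top]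
          refine setLIntegral_congr_fun measurableSet_Ioi fun t ht => ?_
          have ht' : (0:ℝ) < t := ht
          have e1 : K ^ p * t ^ (α * p) * (t ^ (-γ) / γ) = K ^ p / γ * t ^ ((1 - μ) * p) := by
            have : t ^ ((1 - μ) * p) = t ^ (α * p) * t ^ (-γ) := by
              rw [← Real.rpow_add ht']; congr 1; rw [hγ]; ring
            rw [this]; ring
          calc _ = ENNReal.ofReal (K ^ p * t ^ (α * p) * (t ^ (-γ) / γ)) * ‖f t‖ₑ ^ p := by
                rw [ENNReal.ofReal_mul (by positivity), ENNReal.ofReal_mul (by positivity)]; ring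
            _ = _ := by rw [e1, ENNReal.ofReal_mul (by positivity)]; ring
  rw [ql_eLp, ql_eLp, ql_nu_lint]
  refine (ENNReal.rpow_le_rpow key (by positivity)).trans (le_of_eq ?_)
  rw [ENNReal.mul_rpow_of_nonneg _ _ (by positivity), ENNReal.ofReal_rpow_of_nonneg (by positivity) (by positivity)]
  rfl

theorem ql_globeq (h : QMR p ι A M) {u v : ℝ → X₁} {u' v' : ℝ → X₀} (hu : ∀ b, QPr ι b 0 u u')
    (hv : ∀ b, QPr ι b 0 v v') (he : ∀ᵐ t ∂qlm, u' t + A (u t) = v' t + A (v t)) :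
    u =ᵐ[qlm] v ∧ u' =ᵐ[qlm] v' := by
  have k1 : ∀ᵐ t ∂qlm, u t - v t = 0 := by
    refine ql_ae_glob fun b => ?_
    have := (hu b).sub (hv b)
    rw [sub_zero] at this
    refine ql_uniq h this ?_
    filter_upwards [ql_ae_loc b he] with t q1
    rw [map_sub, ← add_sub_add_comm, q1, sub_self]
  have k2 : u =ᵐ[qlm] v := by
    filter_upwards [k1] with t ht using sub_eq_zero.1 ht
  refine ⟨k2, ?_⟩
  filter_upwards [k2, he] with t q1 q2
  rw [q1] at q2
  exact add_right_cancel q2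

theorem ql_fact8 (h : QMR p ι A M) (μ : ℝ) [hμ : Fact (1 / p < μ)] [hμ1 : Fact (μ ≤ 1)] :
    ∃ C : ℝ≥0, ∀ (ε : ℝ) (f : ℝ → X₀) (u : ℝ → X₁) (u' : ℝ → X₀), 0 < ε →
      MemLp f (ENNReal.ofReal p) qlm → (∀ b, QPr ι b 0 u u') → (∀ᵐ t ∂qlm, u' t + A (u t) = f t) →
      (∀ t, 0 < t → t < ε → f t = 0) → MemLp f (ENNReal.ofReal p) (qlnu p μ) →
      eLpNorm u (ENNReal.ofReal p) (qlnu p μ) ≤ C * eLpNorm f (ENNReal.ofReal p) (qlnu p μ) ∧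
      eLpNorm u' (ENNReal.ofReal p) (qlnu p μ) ≤ C * eLpNorm f (ENNReal.ofReal p) (qlnu p μ) := by
  have p0 : 0 < p := by linarith [hp.out]
  rcases hμ1.out.lt_or_eq with hlt | heq
  swap
  · refine ⟨M, fun ε f u u' hε hf hq he hf0 hfn => ?_⟩
    rw [heq, ql_nu_one]
    obtain ⟨w, w', w1, w2, w3, w4, w5, w6⟩ := h.1 f hf
    obtain ⟨k1, k2⟩ := ql_globeq h hq w3 (by filter_upwards [he, w4] with t q1 q2; rw [q1, q2])
    rw [eLpNorm_congr_ae k1, eLpNorm_congr_ae k2]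
    exact ⟨w5, w6⟩
  obtain ⟨C, hC⟩ := ql_fact7 h μ
  have mpos : 0 < 1 - μ := by linarith
  refine ⟨M * (Real.toNNReal (1 - μ) * C + 1) + Real.toNNReal (1 - μ) * C, fun ε f u u' hε hf hq he hf0 hfn => ?_⟩
  set N := eLpNorm f (ENNReal.ofReal p) (qlnu p μ) with hN
  set g : ℝ → ℝ := fun s => (1 - μ) * s ^ (-μ) with hg
  have gi : ∀ b, IntegrableOn g (Ioo 0 b) := by
    intro b
    rcases le_or_gt b 0 with hb | hb
    · simp [hb]
    have : IntervalIntegrable g volume 0 b := (intervalIntegral.intervalIntegrable_rpow' (by linarith)).const_mul _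
    rwa [intervalIntegrable_iff_integrableOn_Ioo_of_le hb.le] at this
  have gp : ∀ t, 0 < t → ∫ s in (0:ℝ)..t, g s = t ^ (1 - μ) := by
    intro t ht
    rw [hg, intervalIntegral.integral_const_mul, integral_rpow (Or.inl (by linarith))]
    have : -μ + 1 = 1 - μ := by ring
    rw [this, Real.zero_rpow mpos.ne', sub_zero]
    field_simp
  set U : ℝ → X₀ := fun t => ∫ r in (0:ℝ)..t, u' r with hU
  have hW := fun b => ql_mulQPr (gi b) (hq b)
  set W : ℝ → X₁ := fun t => (∫ s in (0:ℝ)..t, g s) • u t with hWd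
  set W' : ℝ → X₀ := fun s => g s • (0 + ∫ r in (0:ℝ)..s, u' r) + (∫ r in (0:ℝ)..s, g r) • u' s with hWd'
  set Y : ℝ → X₀ := fun t => t ^ (-μ) • U t with hY
  have bY : eLpNorm Y (ENNReal.ofReal p) qlm ≤ C * N := hC ε f u u' hε hf hq he hf0
  have mY : AEStronglyMeasurable Y qlm := by
    have : ContinuousOn U (Ioi 0) := by
      intro t ht
      have ht' : (0:ℝ) < t := ht
      have c := ql_prim_cont (0:X₀) (hq (t+1)).2.1
      simp only [zero_add] at c
      exact (c.continuousAt (Icc_mem_nhds ht' (by linarith))).continuousWithinAt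
    exact ql_asm_smul _ (this.aestronglyMeasurable measurableSet_Ioi)
  have NfT : N < ⊤ := hfn.2
  have eY : MemLp Y (ENNReal.ofReal p) qlm := ⟨mY, bY.trans_lt (ENNReal.mul_lt_top ENNReal.coe_lt_top NfT)⟩
  set Z : ℝ → X₀ := fun t => t ^ (1 - μ) • f t with hZ
  have bZ : eLpNorm Z (ENNReal.ofReal p) qlm = N := ql_nuW μ f
  have eZ : MemLp Z (ENNReal.ofReal p) qlm :=
    ⟨ql_asm_smul _ hf.1, by rw [bZ]; exact NfT⟩
  have bY2 : eLpNorm ((1 - μ) • Y) (ENNReal.ofReal p) qlm ≤ Real.toNNReal (1 - μ) * C * N := by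
    rw [eLpNorm_const_smul, mul_assoc, Real.enorm_eq_ofReal mpos.le]
    gcongr
    rfl
  obtain ⟨w, w', w1, w2, w3, w4, w5, w6⟩ := h.1 ((1 - μ) • Y + Z) ((eY.const_smul _).add eZ)
  have bH : eLpNorm ((1 - μ) • Y + Z) (ENNReal.ofReal p) qlm ≤ (Real.toNNReal (1 - μ) * C + 1) * N := by
    refine (eLpNorm_add_le (eY.const_smul _).1 eZ.1 (qlFactP p).out).trans ?_
    rw [bZ, add_mul, one_mul]
    gcongr
  have pos : ∀ᵐ t ∂qlm, 0 < t := ae_restrict_mem measurableSet_Ioi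
  obtain ⟨k1, k2⟩ := ql_globeq h hW w3 (by
    filter_upwards [he, w4, pos] with t q1 q2 q3
    rw [q2]
    simp only [Pi.add_apply, Pi.smul_apply, hY, hZ]
    have : A ((∫ s in (0:ℝ)..t, g s) • u t) = (∫ s in (0:ℝ)..t, g s) • A (u t) := A.map_smul_of_tower _ _
    rw [this, add_assoc, ← smul_add, q1, gp t q3, zero_add, smul_smul])
  have bw : M * eLpNorm ((1 - μ) • Y + Z) (ENNReal.ofReal p) qlm ≤ M * (Real.toNNReal (1 - μ) * C + 1) * N := by
    rw [mul_assoc]; gcongr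
  push_cast
  constructor
  · rw [← ql_nuW μ u]
    have : (fun t => t ^ (1 - μ) • u t) =ᵐ[qlm] w := by
      filter_upwards [k1, pos] with t q1 q2
      rw [← q1, hWd]
      simp only
      rw [gp t q2]
    rw [eLpNorm_congr_ae this]
    refine (w5.trans bw).trans ?_
    gcongr
    exact le_self_add
  · rw [← ql_nuW μ u']
    have : (fun t => t ^ (1 - μ) • u' t) =ᵐ[qlm] w' - (1 - μ) • Y := by
      filter_upwards [k2, pos] with t q1 q2
      rw [Pi.sub_apply, ← q1, hWd']
      simp only [Pi.smul_apply, hY]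
      rw [gp t q2, zero_add, smul_smul, add_sub_cancel_left]
    rw [eLpNorm_congr_ae this, add_mul]
    refine (eLpNorm_sub_le w2.1 (eY.const_smul _).1 (qlFactP p).out).trans ?_
    exact add_le_add (w6.trans bw) bY2
end qllin5

section qllin6
open Filter Topology intervalIntegral
open scoped ENNReal NNReal
variable {p : ℝ} [hp : Fact (1 < p)] {μ : ℝ} [hμ : Fact (1 / p < μ)] [hμ1 : Fact (μ ≤ 1)]
  {ι A : X₁ →L[ℂ] X₀} {M : ℝ≥0}

theorem ql_nu_small (p μ : ℝ) [hp : Fact (1 < p)] [hμ1 : Fact (μ ≤ 1)] {η : ℝ} (hη : η ≤ 1) :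
    qlnu p μ (Ioo 0 η) ≤ ENNReal.ofReal η := by
  have p0 : 0 < p := by linarith [hp.out]
  have := ql_lint p μ (measurableSet_Ioo (a := (0:ℝ)) (b := η)) (fun t ht => ht.1) (fun _ => 1)
  rw [setLIntegral_one] at this
  rw [this]
  calc _ ≤ ∫⁻ t in Ioo 0 η, (1 : ℝ≥0∞) := by
        refine setLIntegral_mono' measurableSet_Ioo fun t ht => ?_
        rw [mul_one, ← ENNReal.ofReal_one]
        refine ENNReal.ofReal_le_ofReal (Real.rpow_le_one ht.1.le (ht.2.le.trans hη) ?_)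
        exact mul_nonneg (by linarith [hμ1.out]) p0.le
    _ = _ := by rw [setLIntegral_one, Real.volume_Ioo, sub_zero]

theorem ql_memLp_away {X : Type*} [NormedAddCommGroup X] {f : ℝ → X} (hf : MemLp f (ENNReal.ofReal p) (qlnu p μ))
    {ε : ℝ} (hε : 0 < ε) (h0 : ∀ t, 0 < t → t < ε → f t = 0) : MemLp f (ENNReal.ofReal p) qlm := by
  have p0 : 0 < p := by linarith [hp.out]
  have hk : 0 ≤ (1 - μ) * p := mul_nonneg (by linarith [hμ1.out]) p0.le
  refine ⟨(ql_asm p μ f).1 hf.1, ?_⟩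
  have h2 := hf.2
  rw [ql_eLp] at h2 ⊢
  rw [ENNReal.rpow_lt_top_iff_of_pos (by positivity)] at h2 ⊢
  rw [ql_nu_lint] at h2
  have : ∫⁻ t, ‖f t‖ₑ ^ p ∂qlm ≤ ENNReal.ofReal (ε ^ (-((1 - μ) * p))) *
      ∫⁻ t in Ioi 0, ENNReal.ofReal (t ^ ((1 - μ) * p)) * ‖f t‖ₑ ^ p := by
    rw [← lintegral_const_mul' _ _ ENNReal.ofReal_ne_top]
    refine setLIntegral_mono' measurableSet_Ioi fun t ht => ?_
    have ht' : (0:ℝ) < t := ht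
    rcases lt_or_ge t ε with h | h
    · rw [h0 t ht h]; simp [p0]
    · rw [← mul_assoc, ← ENNReal.ofReal_mul (by positivity)]
      have : (1:ℝ) ≤ ε ^ (-((1 - μ) * p)) * t ^ ((1 - μ) * p) := by
        rw [Real.rpow_neg hε.le, inv_mul_eq_div, one_le_div (by positivity)]
        exact Real.rpow_le_rpow hε.le h hk
      calc _ = ENNReal.ofReal 1 * ‖f t‖ₑ ^ p := by simp
        _ ≤ _ := by gcongr
  exact this.trans_lt (ENNReal.mul_lt_top ENNReal.ofReal_lt_top h2)

theorem ql_approx {X : Type*} [NormedAddCommGroup X] {f : ℝ → X} (hf : MemLp f (ENNReal.ofReal p) (qlnu p μ))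
    {η : ℝ} (hη : 0 < η) : ∃ ε > 0, ∃ g : ℝ → X, MemLp g (ENNReal.ofReal p) (qlnu p μ) ∧
      (∀ t, 0 < t → t < ε → g t = 0) ∧ eLpNorm (f - g) (ENNReal.ofReal p) (qlnu p μ) ≤ ENNReal.ofReal η := by
  obtain ⟨δ, δ0, hδ⟩ := hf.eLpNorm_indicator_le (qlFactP p).out ENNReal.ofReal_ne_top hη
  refine ⟨min δ 1, by positivity, (Ioo 0 (min δ 1))ᶜ.indicator f, hf.indicator measurableSet_Ioo.compl, ?_, ?_⟩
  · intro t h1 h2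
    exact indicator_of_notMem (fun h : t ∈ (Ioo 0 (min δ 1))ᶜ => h ⟨h1, h2⟩) _
  · have : f - (Ioo 0 (min δ 1))ᶜ.indicator f = (Ioo 0 (min δ 1)).indicator f := by
      rw [sub_eq_iff_eq_add, indicator_self_add_compl]
    rw [this]
    refine hδ _ measurableSet_Ioo ((ql_nu_small p μ (min_le_right _ _)).trans (ENNReal.ofReal_le_ofReal (min_le_left _ _)))

theorem ql_inj (h : QMR p ι A M) (e : QTT X₀ X₁ p μ) (he : e ∈ QZZ p μ ι) (h0 : QDD p μ A e = 0) : e = 0 := by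
  obtain ⟨he1, he2⟩ := (QZZ_mem p μ ι e).1 he
  have hz := Lp.coeFn_zero X₀ (ENNReal.ofReal p) (qlnu p μ)
  rw [ql_ae] at hz
  have hq : ∀ b, QPr ι b 0 e.2.1 e.2.2 := fun b => he2 ▸ he1 b
  have hq0 : ∀ b, QPr ι b 0 (fun _ => (0:X₁)) (fun _ => (0:X₀)) := fun b => by
    simpa using (hq b).sub (hq b)
  obtain ⟨k1, k2⟩ := ql_globeq h hq hq0 (by
    filter_upwards [QDD_ae p μ A e, hz] with t q1 q2
    rw [← q1, h0, q2]; simp)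
  refine Prod.ext he2 (Prod.ext ?_ ?_)
  · show e.2.1 = 0
    rw [Lp.eq_zero_iff_ae_eq_zero, ql_ae]; exact k1
  · show e.2.2 = 0
    rw [Lp.eq_zero_iff_ae_eq_zero, ql_ae]; exact k2

theorem ql_Sinv (h : QMR p ι A M) (μ : ℝ) [hμ : Fact (1 / p < μ)] [hμ1 : Fact (μ ≤ 1)] :
    ∃ S : Lp X₀ (ENNReal.ofReal p) (qlnu p μ) →L[ℂ] QTT X₀ X₁ p μ,
      (∀ f, S f ∈ QZZ p μ ι) ∧ (∀ f, QDD p μ A (S f) = f) := by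
  obtain ⟨C, hC⟩ := ql_fact8 h μ
  -- bound
  have bd : ∀ e ∈ QZZ p μ ι, ∀ ε > 0, ∀ g : ℝ → X₀, MemLp g (ENNReal.ofReal p) (qlnu p μ) →
      (∀ t, 0 < t → t < ε → g t = 0) → QDD p μ A e =ᵐ[qlnu p μ] g → ‖e‖ ≤ C * ‖QDD p μ A e‖ := by
    intro e he ε hε g hg hg0 heg
    obtain ⟨he1, he2⟩ := (QZZ_mem p μ ι e).1 he
    have hq : ∀ b, QPr ι b 0 e.2.1 e.2.2 := fun b => he2 ▸ he1 b
    have heg' := heg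
    rw [ql_ae] at heg'
    obtain ⟨c1, c2⟩ := hC ε g e.2.1 e.2.2 hε (ql_memLp_away hg hε hg0) hq (by
      filter_upwards [QDD_ae p μ A e, heg'] with t q1 q2
      rw [← q1, q2]) hg0 hg
    rw [← eLpNorm_congr_ae heg, ← Lp.enorm_def, ← Lp.enorm_def, enorm_eq_nnnorm, enorm_eq_nnnorm] at c1 c2
    have c1' : ‖e.2.1‖₊ ≤ C * ‖QDD p μ A e‖₊ := by exact_mod_cast c1
    have c2' : ‖e.2.2‖₊ ≤ C * ‖QDD p μ A e‖₊ := by exact_mod_cast c2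
    rw [Prod.norm_def, Prod.norm_def, he2, norm_zero]
    refine max_le (by positivity) (max_le ?_ ?_)
    · exact_mod_cast c1'
    · exact_mod_cast c2'
  have ex : ∀ ε > 0, ∀ g : ℝ → X₀, ∀ hg : MemLp g (ENNReal.ofReal p) (qlnu p μ),
      (∀ t, 0 < t → t < ε → g t = 0) → ∃ e ∈ QZZ p μ ι, QDD p μ A e = hg.toLp g := by
    intro ε hε g hg hg0
    have hgq := ql_memLp_away hg hε hg0
    obtain ⟨u, u', u1, u2, u3, u4, -, -⟩ := h.1 g hgq
    obtain ⟨c1, c2⟩ := hC ε g u u' hε hgq u3 u4 hg0 hg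
    have ft : C * eLpNorm g (ENNReal.ofReal p) (qlnu p μ) < ⊤ := ENNReal.mul_lt_top ENNReal.coe_lt_top hg.2
    have l1 : MemLp u (ENNReal.ofReal p) (qlnu p μ) := ⟨(ql_asm p μ u).2 u1.1, c1.trans_lt ft⟩
    have l2 : MemLp u' (ENNReal.ofReal p) (qlnu p μ) := ⟨(ql_asm p μ u').2 u2.1, c2.trans_lt ft⟩
    refine ⟨(0, l1.toLp u, l2.toLp u'), ⟨ql_pack l1 l2 u3, rfl⟩, ?_⟩
    refine Lp.ext ?_
    have m1 := l1.coeFn_toLp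
    have m2 := l2.coeFn_toLp
    have m3 := hg.coeFn_toLp
    rw [ql_ae] at m1 m2 m3 ⊢
    filter_upwards [m1, m2, m3, QDD_ae p μ A (0, l1.toLp u, l2.toLp u'), u4] with t q1 q2 q0 q3 q4
    rw [q3, q1, q2, q4, q0]
  refine ql_inverse p μ ι A (fun e he h0 => ql_inj h e he h0) ?_
  intro f
  have hn : ∀ n : ℕ, ∃ e ∈ QZZ p μ ι, ‖f - QDD p μ A e‖ ≤ 1 / ((n:ℝ) + 1) ∧ ∃ ε > 0, ∃ g : ℝ → X₀,
      MemLp g (ENNReal.ofReal p) (qlnu p μ) ∧ (∀ t, 0 < t → t < ε → g t = 0) ∧ QDD p μ A e =ᵐ[qlnu p μ] g := by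
    intro n
    have hpos : 0 < 1 / ((n:ℝ) + 1) := by positivity
    obtain ⟨ε, hε, g, g1, g2, g3⟩ := ql_approx (Lp.memLp f) hpos
    obtain ⟨e, he, he2⟩ := ex ε hε g g1 g2
    refine ⟨e, he, ?_, ε, hε, g, g1, g2, by rw [he2]; exact g1.coeFn_toLp⟩
    rw [he2, Lp.norm_def]
    refine ENNReal.toReal_le_of_le_ofReal hpos.le (le_trans (le_of_eq ?_) g3)
    refine eLpNorm_congr_ae ((Lp.coeFn_sub _ _).trans ?_)
    filter_upwards [g1.coeFn_toLp] with t ht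
    rw [Pi.sub_apply, Pi.sub_apply, ht]
  choose e he hb hv using hn
  have lim : Tendsto (fun n => QDD p μ A (e n)) atTop (𝓝 f) := by
    rw [tendsto_iff_norm_sub_tendsto_zero]
    refine squeeze_zero (fun _ => norm_nonneg _) (fun n => ?_) tendsto_one_div_add_atTop_nhds_zero_nat
    rw [norm_sub_rev]; exact hb n
  have cau : CauchySeq e := by
    have c0 := lim.cauchySeq
    rw [Metric.cauchySeq_iff] at c0 ⊢
    intro η hη
    obtain ⟨N, hN⟩ := c0 (η / (C + 1)) (by positivity)
    refine ⟨N, fun m hm n hn => ?_⟩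
    have k := hN m hm n hn
    rw [dist_eq_norm] at k ⊢
    obtain ⟨ε1, p1, g1, a1, b1, c1⟩ := hv m
    obtain ⟨ε2, p2, g2, a2, b2, c2⟩ := hv n
    have := bd (e m - e n) (Submodule.sub_mem _ (he m) (he n)) (min ε1 ε2) (lt_min p1 p2) (g1 - g2) (a1.sub a2)
      (fun t h1 h2 => by
        rw [Pi.sub_apply, b1 t h1 (h2.trans_le (min_le_left _ _)), b2 t h1 (h2.trans_le (min_le_right _ _)), sub_zero])
      (by
        rw [map_sub]
        filter_upwards [Lp.coeFn_sub (QDD p μ A (e m)) (QDD p μ A (e n)), c1, c2] with t q1 q2 q3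
        rw [q1, Pi.sub_apply, Pi.sub_apply, q2, q3])
    rw [map_sub] at this
    refine this.trans_lt ?_
    rw [lt_div_iff₀ (by positivity)] at k
    have := norm_nonneg (QDD p μ A (e m) - QDD p μ A (e n))
    nlinarith
  obtain ⟨e0, he0⟩ := cauchySeq_tendsto_of_complete cau
  refine ⟨e0, (QZZ_closed p μ ι).mem_of_tendsto he0 (Eventually.of_forall he), ?_⟩
  exact tendsto_nhds_unique (((QDD p μ A).continuous.tendsto e0).comp he0) lim
end qllin6

section qlshift
open Filter Topology intervalIntegral
open scoped ENNReal NNReal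
variable {p : ℝ} [hp : Fact (1 < p)] {μ : ℝ} [hμ : Fact (1 / p < μ)] [hμ1 : Fact (μ ≤ 1)]
  {ι A : X₁ →L[ℂ] X₀} {M : ℝ≥0}

theorem ql_qlm_qmp {t : ℝ} (ht : 0 ≤ t) : Measure.QuasiMeasurePreserving (fun s => t + s) qlm qlm := by
  refine ⟨measurable_const_add t, ?_⟩
  have h1 : Measure.map (fun s => t + s) qlm ≤ qlm := by
    unfold qlm
    have h2 := (measurePreserving_add_left volume t).restrict_preimage (measurableSet_Ioi (a := t))
    rw [preimage_const_add_Ioi, sub_self] at h2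
    rw [h2.map_eq]
    exact Measure.restrict_mono (Ioi_subset_Ioi ht) le_rfl
  exact h1.absolutelyContinuous

theorem ql_lsh {X : Type*} [NormedAddCommGroup X] {f : ℝ → X} (hf : MemLp f (ENNReal.ofReal p) (qlnu p μ))
    {t : ℝ} (ht : 0 ≤ t) : MemLp (fun s => f (t + s)) (ENNReal.ofReal p) (qlnu p μ) ∧
      eLpNorm (fun s => f (t + s)) (ENNReal.ofReal p) (qlnu p μ) ≤ eLpNorm f (ENNReal.ofReal p) (qlnu p μ) := by
  have p0 : 0 < p := by linarith [hp.out]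
  have hk : 0 ≤ (1 - μ) * p := mul_nonneg (by linarith [hμ1.out]) p0.le
  have hle : eLpNorm (fun s => f (t + s)) (ENNReal.ofReal p) (qlnu p μ) ≤ eLpNorm f (ENNReal.ofReal p) (qlnu p μ) := by
    rw [ql_eLp, ql_eLp]
    refine ENNReal.rpow_le_rpow ?_ (by positivity)
    rw [ql_nu_lint, ql_nu_lint]
    have h1 := (measurePreserving_add_left volume t).setLIntegral_comp_preimage_emb
      (measurableEmbedding_addLeft t) (fun s => ENNReal.ofReal (s ^ ((1 - μ) * p)) * ‖f s‖ₑ ^ p) (Ioi t)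
    rw [preimage_const_add_Ioi, sub_self] at h1
    refine le_trans ?_ (h1.le.trans (lintegral_mono_set (Ioi_subset_Ioi ht)))
    refine setLIntegral_mono' measurableSet_Ioi fun s hs => ?_
    have hs' : (0:ℝ) < s := hs
    exact mul_le_mul_left (ENNReal.ofReal_le_ofReal (Real.rpow_le_rpow hs'.le (by linarith) hk)) _
  refine ⟨⟨?_, hle.trans_lt hf.2⟩, hle⟩
  have := (ql_asm p μ f).1 hf.1
  exact (ql_asm p μ _).2 (this.comp_quasiMeasurePreserving (ql_qlm_qmp ht))

instance ql_nu_locfin (p μ : ℝ) [hp : Fact (1 < p)] [hμ1 : Fact (μ ≤ 1)] : IsLocallyFiniteMeasure (qlnu p μ) := by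
  have p0 : 0 < p := by linarith [hp.out]
  have hk : 0 ≤ (1 - μ) * p := mul_nonneg (by linarith [hμ1.out]) p0.le
  unfold qlnu qlm
  exact IsLocallyFiniteMeasure.withDensity_ofReal (Real.continuous_rpow_const hk)

theorem ql_lsh_cont {X : Type*} [NormedAddCommGroup X] [NormedSpace ℝ X] {f : ℝ → X} (hf : MemLp f (ENNReal.ofReal p) (qlnu p μ))
    {ε : ℝ} (hε : 0 < ε) : ∃ δ > 0, ∀ h, 0 ≤ h → h < δ →
      eLpNorm (fun s => f (h + s) - f s) (ENNReal.ofReal p) (qlnu p μ) ≤ ENNReal.ofReal ε := by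
  have p0 : 0 < p := by linarith [hp.out]
  obtain ⟨g, g1, g2, g3, g4⟩ := hf.exists_hasCompactSupport_eLpNorm_sub_le ENNReal.ofReal_ne_top
    (ε := ENNReal.ofReal (ε / 3)) (by simpa using hε)
  obtain ⟨R, hR⟩ := g1.isCompact.isBounded.subset_closedBall 0
  rw [Real.closedBall_eq_Icc] at hR
  set s : Set ℝ := Icc (-R - 1) (R + 1)
  have hsf : qlnu p μ s ≠ ⊤ := isCompact_Icc.measure_lt_top.ne
  obtain ⟨c, c0, hc⟩ : ∃ c > 0, ENNReal.ofReal c * qlnu p μ s ^ (1 / (ENNReal.ofReal p).toReal) ≤ ENNReal.ofReal (ε / 3) := by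
    have hK : qlnu p μ s ^ (1 / (ENNReal.ofReal p).toReal) ≠ ⊤ := ENNReal.rpow_ne_top_of_nonneg (by positivity) hsf
    set K := (qlnu p μ s ^ (1 / (ENNReal.ofReal p).toReal)).toReal with hKd
    refine ⟨ε / 3 / (K + 1), by positivity, ?_⟩
    rw [← ENNReal.ofReal_toReal hK, ← hKd, ← ENNReal.ofReal_mul (by positivity)]
    refine ENNReal.ofReal_le_ofReal ?_
    rw [div_mul_eq_mul_div, div_le_iff₀ (by positivity)]
    nlinarith
  have hu := g1.uniformContinuous_of_continuous g3
  rw [Metric.uniformContinuous_iff] at hu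
  obtain ⟨δ, δ0, hδ⟩ := hu c c0
  refine ⟨min δ 1, by positivity, fun h h0 h1 => ?_⟩
  have e1 := (ql_lsh (hf.sub g4) h0)
  have e3 : eLpNorm ((fun s => g (h + s)) - g) (ENNReal.ofReal p) (qlnu p μ) ≤ ENNReal.ofReal (ε / 3) := by
    refine (eLpNorm_sub_le_of_dist_bdd (qlnu p μ) ENNReal.ofReal_ne_top (measurableSet_Icc : MeasurableSet s) c0.le ?_ ?_ ?_).trans hc
    · intro x
      refine (hδ ?_).le
      rw [Real.dist_eq, add_sub_cancel_right, abs_of_nonneg h0]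
      exact h1.trans_le (min_le_left _ _)
    · intro x hx
      have := hR (subset_tsupport g hx)
      have h2 := h1.trans_le (min_le_right _ _)
      simp only [zero_sub, zero_add, mem_Icc] at this
      exact ⟨by linarith [this.1], by linarith [this.2]⟩
    · intro x hx
      have := hR (subset_tsupport g hx)
      simp only [zero_sub, zero_add, mem_Icc] at this
      exact ⟨by linarith [this.1], by linarith [this.2]⟩
  have e4 : (fun s => f (h + s) - f s) = (fun s => (f - g) (h + s)) + (((fun s => g (h + s)) - g) - (f - g)) := by
    funext s
    simp only [Pi.add_apply, Pi.sub_apply]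
    abel
  have m1 := (ql_lsh g4 h0).1.sub g4
  rw [e4]
  refine (eLpNorm_add_le e1.1.1 (m1.sub (hf.sub g4)).1 (qlFactP p).out).trans ?_
  have e5 := eLpNorm_sub_le m1.1 (hf.sub g4).1 (qlFactP p).out
  calc _ ≤ ENNReal.ofReal (ε / 3) + (ENNReal.ofReal (ε / 3) + ENNReal.ofReal (ε / 3)) :=
        add_le_add (e1.2.trans g2) (e5.trans (add_le_add e3 g2))
    _ = _ := by
      rw [← ENNReal.ofReal_add (by positivity) (by positivity), ← ENNReal.ofReal_add (by positivity) (by positivity)]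
      congr 1
      ring

end qlshift

section qltr
open Filter Topology intervalIntegral
open scoped ENNReal NNReal
variable {p : ℝ} [hp : Fact (1 < p)] {μ : ℝ} [hμ : Fact (1 / p < μ)] [hμ1 : Fact (μ ≤ 1)]
  {ι A : X₁ →L[ℂ] X₀} {M : ℝ≥0}

def qrep (e : QTT X₀ X₁ p μ) (t : ℝ) : X₀ := e.1 + ∫ r in (0:ℝ)..t, e.2.2 r

theorem qrep_zero (e : QTT X₀ X₁ p μ) : qrep e 0 = e.1 := by simp [qrep]

theorem qrep_add (e f : QTT X₀ X₁ p μ) {t : ℝ} (ht : 0 ≤ t) : qrep (e + f) t = qrep e t + qrep f t := by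
  unfold qrep
  have : ∫ r in (0:ℝ)..t, (e + f).2.2 r = (∫ r in (0:ℝ)..t, e.2.2 r) + ∫ r in (0:ℝ)..t, f.2.2 r := by
    rw [← intervalIntegral.integral_add (ql_ii (ql_Lp_int t _) le_rfl ht ht le_rfl) (ql_ii (ql_Lp_int t _) le_rfl ht ht le_rfl)]
    exact ql_icongr (b := t) (ql_ae_nu t (Lp.coeFn_add e.2.2 f.2.2)) ht le_rfl
  rw [this]
  simp only [Prod.fst_add]
  abel

theorem qrep_sub (e f : QTT X₀ X₁ p μ) {t : ℝ} (ht : 0 ≤ t) : qrep (e - f) t = qrep e t - qrep f t := by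
  have := qrep_add (e - f) f ht
  rw [sub_add_cancel] at this
  rw [this, add_sub_cancel_right]

theorem ql_avg (p μ : ℝ) [hp : Fact (1 < p)] [hμ : Fact (1 / p < μ)] [hμ1 : Fact (μ ≤ 1)] (ι : X₁ →L[ℂ] X₀) :
    ∃ C : ℝ, 1 ≤ C ∧ ∀ e ∈ QEE p μ ι, ‖e‖ ≤ C * ‖e.2‖ := by
  obtain ⟨C0, hC0, h0⟩ := ql_Lp_bd p μ X₀ 1
  obtain ⟨C1, hC1, h1⟩ := ql_Lp_bd p μ X₁ 1
  refine ⟨‖ι‖ * C1 + C0 + 1, by nlinarith [norm_nonneg ι, mul_nonneg (norm_nonneg ι) hC1], fun e he => ?_⟩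
  have k : ‖e.1‖ ≤ (‖ι‖ * C1 + C0) * ‖e.2‖ := by
    have a1 : ∀ᵐ t ∂(volume.restrict (Ioo (0:ℝ) 1)), ‖e.1‖ ≤ ‖ι‖ * ‖e.2.1 t‖ + C0 * ‖e.2‖ := by
      filter_upwards [(he 1).2.2, ae_restrict_mem measurableSet_Ioo] with t q1 q2
      have : e.1 = ι (e.2.1 t) - ∫ r in (0:ℝ)..t, e.2.2 r := by rw [q1]; abel
      rw [this]
      refine (norm_sub_le _ _).trans (add_le_add (ι.le_opNorm _) ?_)
      refine (ql_norm_prim_le (ql_Lp_int 1 _) q2.1.le q2.2.le).trans ((h0 _).trans ?_)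
      exact mul_le_mul_of_nonneg_left (norm_snd_le _) hC0
    have i1 : IntegrableOn (fun t => ‖ι‖ * ‖e.2.1 t‖) (Ioo 0 1) :=
      (ql_Lp_int 1 e.2.1).norm.const_mul _
    have i2 : IntegrableOn (fun t : ℝ => C0 * ‖e.2‖) (Ioo 0 1) := integrableOn_const (by simp)
    have i3 : IntegrableOn (fun t : ℝ => ‖e.1‖) (Ioo 0 1) := integrableOn_const (by simp)
    have := integral_mono_ae i3 (i1.add i2) a1
    have e2 : ∫ t in Ioo (0:ℝ) 1, (‖ι‖ * ‖e.2.1 t‖ + C0 * ‖e.2‖)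
        = ‖ι‖ * (∫ t in Ioo 0 1, ‖e.2.1 t‖) + C0 * ‖e.2‖ := by
      rw [integral_add i1 i2, MeasureTheory.integral_const_mul, setIntegral_const]
      simp
    have e3 : ∫ t in Ioo (0:ℝ) 1, ‖e.1‖ = ‖e.1‖ := by
      rw [setIntegral_const]; simp
    have e4 := this.trans e2.le
    rw [e3] at e4
    have h2 := (h1 e.2.1).trans (mul_le_mul_of_nonneg_left (norm_fst_le e.2) hC1)
    have := mul_le_mul_of_nonneg_left h2 (norm_nonneg ι)
    nlinarith
  rw [Prod.norm_def]
  refine max_le (k.trans ?_) ?_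
  · nlinarith [norm_nonneg e.2]
  · nlinarith [norm_nonneg e.2, norm_nonneg ι, mul_nonneg (norm_nonneg ι) hC1, mul_nonneg (add_nonneg (mul_nonneg (norm_nonneg ι) hC1) hC0) (norm_nonneg e.2)]

theorem ql_shift_ex {e : QTT X₀ X₁ p μ} (he : e ∈ QEE p μ ι) {t : ℝ} (ht : 0 ≤ t) :
    ∃ s ∈ QEE p μ ι, s.1 = qrep e t ∧ (s.2.1 =ᵐ[qlnu p μ] fun r => e.2.1 (t + r)) ∧
      (s.2.2 =ᵐ[qlnu p μ] fun r => e.2.2 (t + r)) ∧ ‖s.2‖ ≤ ‖e.2‖ := by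
  have h1 := ql_lsh (Lp.memLp e.2.1) ht
  have h2 := ql_lsh (Lp.memLp e.2.2) ht
  refine ⟨(qrep e t, h1.1.toLp _, h2.1.toLp _), ?_, rfl, h1.1.coeFn_toLp, h2.1.coeFn_toLp, ?_⟩
  · refine ql_pack h1.1 h2.1 fun b => ?_
    have := (he (b + t)).shift ht
    rwa [add_sub_cancel_right] at this
  · rw [Prod.norm_def, Prod.norm_def]
    refine max_le_max ?_ ?_
    · rw [Lp.norm_toLp, Lp.norm_def]
      exact ENNReal.toReal_mono (Lp.memLp _).2.ne h1.2
    · rw [Lp.norm_toLp, Lp.norm_def]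
      exact ENNReal.toReal_mono (Lp.memLp _).2.ne h2.2

variable (p μ ι) in
def QTr (x : X₀) (r : ℝ) : Prop := ∃ e ∈ QEE p μ ι, e.1 = x ∧ ‖e‖ ≤ r

theorem QTr.mono {x : X₀} {r s : ℝ} (h : QTr p μ ι x r) (hrs : r ≤ s) : QTr p μ ι x s :=
  let ⟨e, h1, h2, h3⟩ := h
  ⟨e, h1, h2, h3.trans hrs⟩

theorem QTr.add {x y : X₀} {r s : ℝ} (h : QTr p μ ι x r) (k : QTr p μ ι y s) : QTr p μ ι (x + y) (r + s) := by
  obtain ⟨e, h1, h2, h3⟩ := h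
  obtain ⟨f, k1, k2, k3⟩ := k
  exact ⟨e + f, add_mem h1 k1, by rw [Prod.fst_add, h2, k2], (norm_add_le _ _).trans (add_le_add h3 k3)⟩

theorem QTr.neg {x : X₀} {r : ℝ} (h : QTr p μ ι x r) : QTr p μ ι (-x) r := by
  obtain ⟨e, h1, h2, h3⟩ := h
  exact ⟨-e, neg_mem h1, by rw [Prod.fst_neg, h2], by rwa [norm_neg]⟩

theorem QTr.zero : QTr p μ ι 0 0 := ⟨0, zero_mem _, rfl, by simp⟩

theorem QTr.norm_le {x : X₀} {r : ℝ} (h : QTr p μ ι x r) : ‖x‖ ≤ r := by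
  obtain ⟨e, h1, h2, h3⟩ := h
  rw [← h2]
  exact (norm_fst_le e).trans h3

/-- uniform trace bound -/
theorem ql_rep_bd (p μ : ℝ) [hp : Fact (1 < p)] [hμ : Fact (1 / p < μ)] [hμ1 : Fact (μ ≤ 1)] (ι : X₁ →L[ℂ] X₀) :
    ∃ C : ℝ, 1 ≤ C ∧ ∀ e ∈ QEE p μ ι, ∀ t, 0 ≤ t → QTr p μ ι (qrep e t) (C * ‖e‖) := by
  obtain ⟨C, hC, h⟩ := ql_avg p μ ι
  refine ⟨C, hC, fun e he t ht => ?_⟩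
  obtain ⟨s, s1, s2, -, -, s5⟩ := ql_shift_ex he ht
  refine ⟨s, s1, s2, (h s s1).trans ?_⟩
  exact mul_le_mul_of_nonneg_left (s5.trans (norm_snd_le e)) (by linarith)

theorem ql_Lp_norm_le {X : Type*} [NormedAddCommGroup X] {f : Lp X (ENNReal.ofReal p) (qlnu p μ)} {g : ℝ → X} {r : ℝ}
    (hr : 0 ≤ r) (h : f =ᵐ[qlnu p μ] g) (hg : eLpNorm g (ENNReal.ofReal p) (qlnu p μ) ≤ ENNReal.ofReal r) : ‖f‖ ≤ r := by
  rw [Lp.norm_def, eLpNorm_congr_ae h]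
  exact ENNReal.toReal_le_of_le_ofReal hr hg

theorem qrep_shift {e s : QTT X₀ X₁ p μ} {h t : ℝ} (hh : 0 ≤ h) (ht : 0 ≤ t) (h1 : s.1 = qrep e h)
    (h2 : s.2.2 =ᵐ[qlnu p μ] fun r => e.2.2 (h + r)) : qrep s t = qrep e (h + t) := by
  have e1 : ∫ r in (0:ℝ)..t, s.2.2 r = ∫ r in h..(h + t), e.2.2 r := by
    rw [ql_icongr (b := t) (ql_ae_nu t h2) ht le_rfl,
      intervalIntegral.integral_comp_add_left (fun r => e.2.2 r), add_zero]
  unfold qrep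
  rw [e1, h1, qrep, add_assoc, integral_add_adjacent_intervals]
  · exact ql_ii (ql_Lp_int h _) le_rfl hh hh le_rfl
  · exact ql_ii (ql_Lp_int (h + t) _) hh (by linarith) (by linarith) le_rfl

theorem ql_rep_cont {e : QTT X₀ X₁ p μ} (he : e ∈ QEE p μ ι) {ε : ℝ} (hε : 0 < ε) :
    ∃ δ > 0, ∀ t t', 0 ≤ t → 0 ≤ t' → |t' - t| < δ → QTr p μ ι (qrep e t' - qrep e t) ε := by
  obtain ⟨C, hC, hav⟩ := ql_avg p μ ι
  obtain ⟨C1, hC1, hrep⟩ := ql_rep_bd p μ ι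
  set η := ε / (C * C1) with hη
  have C0 : 0 < C := by linarith
  have C10 : 0 < C1 := by linarith
  have η0 : 0 < η := by positivity
  obtain ⟨δ1, d1, k1⟩ := ql_lsh_cont (Lp.memLp e.2.1) η0
  obtain ⟨δ2, d2, k2⟩ := ql_lsh_cont (Lp.memLp e.2.2) η0
  have main : ∀ t h, 0 ≤ t → 0 ≤ h → h < min δ1 δ2 → QTr p μ ι (qrep e (h + t) - qrep e t) ε := by
    intro t h ht hh hd
    obtain ⟨s, s1, s2, s3, s4, -⟩ := ql_shift_ex he hh
    have hm : s - e ∈ QEE p μ ι := sub_mem s1 he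
    have n2 : ‖(s - e).2‖ ≤ η := by
      rw [Prod.norm_def]
      refine max_le ?_ ?_
      · refine ql_Lp_norm_le η0.le ?_ (k1 h hh (hd.trans_le (min_le_left _ _)))
        filter_upwards [Lp.coeFn_sub s.2.1 e.2.1, s3] with r r1 r2
        have : (s - e).2.1 r = s.2.1 r - e.2.1 r := r1
        rw [this, r2]
      · refine ql_Lp_norm_le η0.le ?_ (k2 h hh (hd.trans_le (min_le_right _ _)))
        filter_upwards [Lp.coeFn_sub s.2.2 e.2.2, s4] with r r1 r2
        have : (s - e).2.2 r = s.2.2 r - e.2.2 r := r1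
        rw [this, r2]
    have n1 : ‖s - e‖ ≤ C * η := (hav _ hm).trans (mul_le_mul_of_nonneg_left n2 C0.le)
    have := hrep _ hm t ht
    rw [qrep_sub _ _ ht, qrep_shift hh ht s2 s4] at this
    refine this.mono ((mul_le_mul_of_nonneg_left n1 C10.le).trans (le_of_eq ?_))
    rw [hη]; field_simp
  refine ⟨min δ1 δ2, lt_min d1 d2, fun t t' ht ht' hd => ?_⟩
  rcases le_total t t' with h | h
  · rw [abs_of_nonneg (by linarith)] at hd
    have := main t (t' - t) ht (by linarith) hd
    rwa [sub_add_cancel] at this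
  · rw [abs_of_nonpos (by linarith), neg_sub] at hd
    have := (main t' (t - t') ht' (by linarith) hd).neg
    rwa [sub_add_cancel, neg_sub] at this

theorem ql_eNorm {u : ℝ → X₁} {u' : ℝ → X₀} (hu : MemWLp p μ (Ioi 0) u) (hu' : MemWLp p μ (Ioi 0) u') :
    eNorm p μ (Ioi 0) u u' = ((eLpNorm u (ENNReal.ofReal p) (qlnu p μ)).toReal ^ p +
      (eLpNorm u' (ENNReal.ofReal p) (qlnu p μ)).toReal ^ p) ^ (1 / p) := by
  unfold eNorm
  rw [ql_wLpNorm μ measurableSet_Ioi le_rfl _ hu, ql_wLpNorm μ measurableSet_Ioi le_rfl _ hu', ql_nu_Ioi]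

theorem QTr.trace {x : X₀} {r : ℝ} (h : QTr p μ ι x r) : InTrace p μ ι x ∧ traceNorm p μ ι x ≤ 2 * r := by
  have p1 := hp.out
  obtain ⟨e, h1, h2, h3⟩ := h
  obtain ⟨k1, k2⟩ := ql_glob_of (Lp.memLp e.2.1) (Lp.memLp e.2.2) h1
  rw [h2] at k2
  refine ⟨⟨_, _, k1, k2⟩, ?_⟩
  have : eNorm p μ (Ioi 0) (e.2.1 : ℝ → X₁) (e.2.2 : ℝ → X₀) ≤ 2 * r := by
    rw [ql_eNorm k1.1 k1.2.2.1, ← Lp.norm_def, ← Lp.norm_def]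
    have q1 : ‖e.2.1‖ ≤ r := ((norm_fst_le e.2).trans (norm_snd_le e)).trans h3
    have q2 : ‖e.2.2‖ ≤ r := ((norm_snd_le e.2).trans (norm_snd_le e)).trans h3
    have := NNReal.coe_le_coe.2 (NNReal.rpow_add_rpow_le_add ‖e.2.1‖₊ ‖e.2.2‖₊ p1.le)
    push_cast at this
    linarith
  rw [traceNorm]
  refine (csInf_le ?_ (by exact ⟨_, _, k1, k2, rfl⟩)).trans this
  refine ⟨0, ?_⟩
  rintro _ ⟨u, u', -, -, rfl⟩
  unfold eNorm wLpNorm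
  have : ∀ (Y : Type _) [NormedAddCommGroup Y] (f : ℝ → Y), 0 ≤ ∫ t in Ioi (0:ℝ), (t ^ (1 - μ) * ‖f t‖) ^ p := by
    intro Y _ f
    refine setIntegral_nonneg measurableSet_Ioi fun t ht => ?_
    have : (0:ℝ) < t := ht
    positivity
  have h1 := this _ u
  have h2 : 0 ≤ ∫ t in Ioi (0:ℝ), (t ^ (1 - μ) * ‖u' t‖) ^ p := by
    refine setIntegral_nonneg measurableSet_Ioi fun t ht => ?_
    have : (0:ℝ) < t := ht
    positivity
  positivity

theorem ql_tr_of (p μ : ℝ) [hp : Fact (1 < p)] [hμ : Fact (1 / p < μ)] [hμ1 : Fact (μ ≤ 1)] (ι : X₁ →L[ℂ] X₀) :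
    ∃ C : ℝ, 1 ≤ C ∧ ∀ x δ, InTrace p μ ι x → traceNorm p μ ι x < δ → QTr p μ ι x (C * δ) := by
  obtain ⟨C, hC, hav⟩ := ql_avg p μ ι
  have p0 : 0 < p := by linarith [hp.out]
  refine ⟨C, hC, fun x δ hx hδ => ?_⟩
  obtain ⟨u0, u0', a1, a2⟩ := hx
  rw [traceNorm] at hδ
  obtain ⟨_, ⟨u, u', b1, b2, rfl⟩, b3⟩ := exists_lt_of_csInf_lt (by exact ⟨_, u0, u0', a1, a2, rfl⟩) hδ
  rw [ql_eNorm b1.1 b1.2.2.1] at b3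
  obtain ⟨c1, c2, c3⟩ := ql_glob_to b1 b2
  refine ⟨_, ql_pack c1 c2 c3, rfl, (hav _ (ql_pack c1 c2 c3)).trans (mul_le_mul_of_nonneg_left ?_ (by linarith))⟩
  refine le_trans ?_ b3.le
  rw [Prod.norm_def]
  have key : ∀ a b : ℝ, 0 ≤ a → 0 ≤ b → a ≤ (a ^ p + b ^ p) ^ (1 / p) := by
    intro a b ha hb
    calc a = (a ^ p) ^ (1 / p) := by rw [← Real.rpow_mul ha, mul_one_div_cancel p0.ne', Real.rpow_one]
      _ ≤ _ := Real.rpow_le_rpow (by positivity) (by have := Real.rpow_nonneg hb p; linarith) (by positivity)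
  refine max_le ?_ ?_
  · rw [Lp.norm_toLp]
    exact key _ _ ENNReal.toReal_nonneg ENNReal.toReal_nonneg
  · rw [Lp.norm_toLp, add_comm]
    exact key _ _ ENNReal.toReal_nonneg ENNReal.toReal_nonneg

end qltr

section qlhyp
open Filter Topology intervalIntegral
open scoped ENNReal NNReal
variable {p : ℝ} [hp : Fact (1 < p)] {μ : ℝ} [hμ : Fact (1 / p < μ)] [hμ1 : Fact (μ ≤ 1)]
  {ι : X₁ →L[ℂ] X₀}

variable (p μ ι) in
def QHyp (A : X₀ → X₁ →L[ℂ] X₀) (F : X₀ → X₀) (V : Set X₀) : Prop :=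
  ∀ x ∈ V, ∃ r > 0, ∃ L > 0, (∀ y, QTr p μ ι (y - x) r → y ∈ V) ∧
    ∀ y z, QTr p μ ι (y - x) r → QTr p μ ι (z - x) r → ∀ d, QTr p μ ι (y - z) d →
      ‖A y - A z‖ ≤ L * d ∧ ‖F y - F z‖ ≤ L * d

theorem ql_hyp {A : X₀ → X₁ →L[ℂ] X₀} {F : X₀ → X₀} {V : Set X₀} (hV : TraceOpen p μ ι V)
    (hL : LocLip p μ ι A F V) : QHyp p μ ι A F V := by
  intro x hx
  obtain ⟨ε, ε0, L, L0, h⟩ := hL x hx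
  obtain ⟨r, r0, hr⟩ := hV.2 x hx
  obtain ⟨C, hC, htr⟩ := ql_tr_of p μ ι
  have hx2 := htr x _ (hV.1 x hx) (lt_add_one _)
  have hin : ∀ y, QTr p μ ι (y - x) (min (ε / 2) (r / 4)) → y ∈ V := by
    intro y hy
    refine hr y ?_ ?_
    · have := hy.add hx2
      rw [sub_add_cancel] at this
      exact this.trace.1
    · have := hy.trace.2
      have h2 := min_le_right (ε / 2) (r / 4)
      linarith
  refine ⟨min (ε / 2) (r / 4), by positivity, 2 * L, by positivity, hin, ?_⟩
  intro y z hy hz d hd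
  have h2 := min_le_left (ε / 2) (r / 4)
  obtain ⟨k1, k2⟩ := h y (hin y hy) z (hin z hz) (by linarith [hy.trace.2]) (by linarith [hz.trace.2])
  have := mul_le_mul_of_nonneg_left hd.trace.2 L0.le
  exact ⟨by linarith, by linarith⟩

theorem ql_nu_Ioo {a b B : ℝ} (ha : 0 ≤ a) (hb : b ≤ B) :
    qlnu p μ (Ioo a b) ≤ ENNReal.ofReal (B ^ ((1 - μ) * p) * (b - a)) := by
  have p0 : 0 < p := by linarith [hp.out]
  have hk : 0 ≤ (1 - μ) * p := mul_nonneg (by linarith [hμ1.out]) p0.le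
  rcases le_or_gt b a with hba | hba
  · simp [hba]
  have B0 : 0 ≤ B := by linarith
  have := ql_lint p μ (measurableSet_Ioo (a := a) (b := b)) (fun t ht => ha.trans_lt ht.1) (fun _ => 1)
  rw [setLIntegral_one] at this
  rw [this]
  calc _ ≤ ∫⁻ t in Ioo a b, ENNReal.ofReal (B ^ ((1 - μ) * p)) := by
        refine setLIntegral_mono' measurableSet_Ioo fun t ht => ?_
        rw [mul_one]
        exact ENNReal.ofReal_le_ofReal (Real.rpow_le_rpow (ha.trans ht.1.le) (ht.2.le.trans hb) hk)
    _ = _ := by rw [setLIntegral_const, Real.volume_Ioo, ENNReal.ofReal_mul (by positivity)]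

theorem ql_small {X : Type*} [NormedAddCommGroup X] {f : ℝ → X} (hf : MemLp f (ENNReal.ofReal p) (qlnu p μ))
    {t0 : ℝ} (ht0 : 0 ≤ t0) {ε : ℝ} (hε : 0 < ε) : ∃ τ > 0, ∀ a b, 0 ≤ a → t0 - τ < a → b < t0 + τ →
      eLpNorm ((Ioo a b).indicator f) (ENNReal.ofReal p) (qlnu p μ) ≤ ENNReal.ofReal ε := by
  obtain ⟨δ, δ0, hδ⟩ := hf.eLpNorm_indicator_le (qlFactP p).out ENNReal.ofReal_ne_top hε
  have hB : 0 < (t0 + 1) ^ ((1 - μ) * p) := by positivity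
  refine ⟨min 1 (δ / (2 * (t0 + 1) ^ ((1 - μ) * p))), by positivity, fun a b ha h1 h2 => ?_⟩
  set τ := min 1 (δ / (2 * (t0 + 1) ^ ((1 - μ) * p))) with hτ
  refine hδ _ measurableSet_Ioo ((ql_nu_Ioo ha (show b ≤ t0 + 1 by linarith [min_le_left 1 (δ / (2 * (t0 + 1) ^ ((1 - μ) * p)))])).trans
    (ENNReal.ofReal_le_ofReal ?_))
  have h3 : τ ≤ δ / (2 * (t0 + 1) ^ ((1 - μ) * p)) := min_le_right _ _
  calc _ ≤ (t0 + 1) ^ ((1 - μ) * p) * (2 * τ) := mul_le_mul_of_nonneg_left (by linarith) hB.le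
    _ ≤ (t0 + 1) ^ ((1 - μ) * p) * (2 * (δ / (2 * (t0 + 1) ^ ((1 - μ) * p)))) := by gcongr
    _ = δ := by field_simp

theorem ql_small1 {t0 : ℝ} (ht0 : 0 ≤ t0) {ε : ℝ} (hε : 0 < ε) : ∃ τ > 0, ∀ a b, 0 ≤ a → t0 - τ < a → b < t0 + τ →
      eLpNorm ((Ioo a b).indicator (fun _ => (1:ℝ))) (ENNReal.ofReal p) (qlnu p μ) ≤ ENNReal.ofReal ε := by
  have hm : MemLp ((Ioo 0 (t0 + 1)).indicator (fun _ => (1:ℝ))) (ENNReal.ofReal p) (qlnu p μ) := by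
    refine memLp_indicator_const _ measurableSet_Ioo _ (Or.inr ?_)
    exact ((ql_nu_Ioo le_rfl le_rfl).trans_lt ENNReal.ofReal_lt_top).ne
  obtain ⟨τ, τ0, h⟩ := ql_small hm ht0 hε
  refine ⟨min τ 1, by positivity, fun a b ha h1 h2 => ?_⟩
  have := h a b ha (by linarith [min_le_left τ 1]) (by linarith [min_le_left τ 1])
  rwa [indicator_indicator, inter_eq_left.2 (Ioo_subset_Ioo ha (by linarith [min_le_right τ 1]))] at this

/-- continuity of the coefficient functions along a path -/
theorem ql_coef_cont {A : X₀ → X₁ →L[ℂ] X₀} {F : X₀ → X₀} {V : Set X₀} (hH : QHyp p μ ι A F V)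
    {g : QTT X₀ X₁ p μ} (hg : g ∈ QEE p μ ι) {s : Set ℝ} (hs : ∀ t ∈ s, 0 ≤ t ∧ qrep g t ∈ V) :
    ContinuousOn (fun t => A (qrep g t)) s ∧ ContinuousOn (fun t => F (qrep g t)) s := by
  have key : ∀ t ∈ s, ∀ ε > 0, ∃ δ > 0, ∀ t' ∈ s, dist t' t < δ →
      dist (A (qrep g t')) (A (qrep g t)) < ε ∧ dist (F (qrep g t')) (F (qrep g t)) < ε := by
    intro t ht ε ε0
    obtain ⟨r, r0, L, L0, -, h⟩ := hH _ (hs t ht).2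
    obtain ⟨δ, δ0, hδ⟩ := ql_rep_cont hg (show 0 < min r (ε / (2 * L)) by positivity)
    refine ⟨δ, δ0, fun t' ht' hd => ?_⟩
    have h1 := hδ t t' (hs t ht).1 (hs t' ht').1 hd
    have h2 := h (qrep g t') (qrep g t) (h1.mono (min_le_left _ _))
      (by rw [sub_self]; exact QTr.zero.mono r0.le) _ (h1.mono (min_le_right _ _))
    have h3 : L * (ε / (2 * L)) = ε / 2 := by field_simp
    rw [h3] at h2
    rw [dist_eq_norm, dist_eq_norm]
    exact ⟨by linarith [h2.1], by linarith [h2.2]⟩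
  constructor
  · rw [Metric.continuousOn_iff]
    intro t ht ε ε0
    obtain ⟨δ, δ0, h⟩ := key t ht ε ε0
    exact ⟨δ, δ0, fun t' h1 h2 => (h t' h1 h2).1⟩
  · rw [Metric.continuousOn_iff]
    intro t ht ε ε0
    obtain ⟨δ, δ0, h⟩ := key t ht ε ε0
    exact ⟨δ, δ0, fun t' h1 h2 => (h t' h1 h2).2⟩

theorem ql_asm_ind {X : Type*} [NormedAddCommGroup X] {f : ℝ → X} {a b : ℝ} (ha : 0 ≤ a)
    (hf : AEStronglyMeasurable f (volume.restrict (Ioo a b))) :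
    AEStronglyMeasurable ((Ioo a b).indicator f) (qlnu p μ) := by
  rw [aestronglyMeasurable_indicator_iff measurableSet_Ioo, ql_asm_restrict p μ measurableSet_Ioo (fun t ht => ha.trans_lt ht.1)]
  exact hf

/-- the nonlinear residual is in `Lp` -/
theorem ql_resid_memLp {A : X₀ → X₁ →L[ℂ] X₀} {F : X₀ → X₀} {V : Set X₀} (hH : QHyp p μ ι A F V)
    {g : QTT X₀ X₁ p μ} (hg : g ∈ QEE p μ ι) {a b : ℝ} (ha : 0 ≤ a) (hs : ∀ t ∈ Icc a b, qrep g t ∈ V)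
    {w w' : ℝ → X₀} (hw : MemLp w (ENNReal.ofReal p) (qlnu p μ)) (hw' : MemLp w' (ENNReal.ofReal p) (qlnu p μ)) :
    MemLp ((Ioo a b).indicator fun t => w t + F (qrep g t) - A (qrep g t) (g.2.1 t) - w' t)
      (ENNReal.ofReal p) (qlnu p μ) := by
  obtain ⟨c1, c2⟩ := ql_coef_cont hH hg (s := Icc a b) (fun t ht => ⟨ha.trans ht.1, hs t ht⟩)
  obtain ⟨K1, hK1⟩ := isCompact_Icc.exists_bound_of_continuousOn c1
  obtain ⟨K2, hK2⟩ := isCompact_Icc.exists_bound_of_continuousOn c2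
  have m1 : AEStronglyMeasurable (fun t => A (qrep g t) (g.2.1 t)) (volume.restrict (Ioo a b)) := by
    have q1 := (c1.mono Ioo_subset_Icc_self).aestronglyMeasurable measurableSet_Ioo (μ := volume)
    have q2 : AEStronglyMeasurable g.2.1 (volume.restrict (Ioo a b)) :=
      (ql_asm_restrict p μ measurableSet_Ioo (fun t ht => ha.trans_lt ht.1) _).1 (Lp.memLp g.2.1).1.restrict
    exact (ContinuousLinearMap.apply ℂ X₀).flip.aestronglyMeasurable_comp₂ q1 q2
  have t1 : MemLp ((Ioo a b).indicator fun t => F (qrep g t)) (ENNReal.ofReal p) (qlnu p μ) := by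
    have : MemLp ((Ioo a b).indicator fun _ : ℝ => K2) (ENNReal.ofReal p) (qlnu p μ) :=
      memLp_indicator_const _ measurableSet_Ioo _ (Or.inr ((ql_nu_Ioo ha le_rfl).trans_lt ENNReal.ofReal_lt_top).ne)
    refine this.mono (ql_asm_ind ha ((c2.mono Ioo_subset_Icc_self).aestronglyMeasurable measurableSet_Ioo)) (Eventually.of_forall fun t => ?_)
    by_cases h : t ∈ Ioo a b
    · rw [indicator_of_mem h, indicator_of_mem h]
      exact (hK2 t (Ioo_subset_Icc_self h)).trans (le_abs_self _)
    · rw [indicator_of_notMem h, indicator_of_notMem h]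
      simp
  have t2 : MemLp ((Ioo a b).indicator fun t => A (qrep g t) (g.2.1 t)) (ENNReal.ofReal p) (qlnu p μ) := by
    refine (Lp.memLp g.2.1).of_le_mul (c := |K1|) (ql_asm_ind ha m1) (Eventually.of_forall fun t => ?_)
    by_cases h : t ∈ Ioo a b
    · rw [indicator_of_mem h]
      refine (ContinuousLinearMap.le_opNorm _ _).trans (mul_le_mul_of_nonneg_right ?_ (norm_nonneg _))
      exact (hK1 t (Ioo_subset_Icc_self h)).trans (le_abs_self _)
    · rw [indicator_of_notMem h, norm_zero]
      positivity
  have := (((hw.indicator (measurableSet_Ioo (a := a) (b := b))).add t1).sub t2).sub (hw'.indicator (measurableSet_Ioo (a := a) (b := b)))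
  convert this using 1
  funext t
  by_cases h : t ∈ Ioo a b
  · simp only [Pi.add_apply, Pi.sub_apply, indicator_of_mem h]
  · simp only [Pi.add_apply, Pi.sub_apply, indicator_of_notMem h]
    simp

end qlhyp

section qlstep
open Filter Topology intervalIntegral
open scoped ENNReal NNReal
variable {p : ℝ} [hp : Fact (1 < p)] {μ : ℝ} [hμ : Fact (1 / p < μ)] [hμ1 : Fact (μ ≤ 1)]
  {ι : X₁ →L[ℂ] X₀} {A : X₀ → X₁ →L[ℂ] X₀} {F : X₀ → X₀} {V : Set X₀}

def qPhi (A : X₀ → X₁ →L[ℂ] X₀) (F : X₀ → X₀) (A0 : X₁ →L[ℂ] X₀) (w z : QTT X₀ X₁ p μ) (a b : ℝ) : ℝ → X₀ :=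
  (Ioo a b).indicator fun t => A0 (z.2.1 t) + F (qrep (w + z) t) - A (qrep (w + z) t) ((w + z).2.1 t) - w.2.2 t

theorem ql_contr {x : X₀} {r r1 L D ε1 ε2 a b : ℝ} (ha : 0 ≤ a) (hr1 : 0 ≤ r1) (hr : r1 ≤ r) (hL : 0 ≤ L) (hD : 0 ≤ D)
    (e1 : 0 ≤ ε1) (e2 : 0 ≤ ε2)
    (hlip : ∀ y z, QTr p μ ι (y - x) r → QTr p μ ι (z - x) r → ∀ d, QTr p μ ι (y - z) d →
      ‖A y - A z‖ ≤ L * d ∧ ‖F y - F z‖ ≤ L * d) (w z1 z2 : QTT X₀ X₁ p μ)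
    (h1 : ∀ t ∈ Ioo a b, QTr p μ ι (qrep (w + z1) t - x) r1)
    (h2 : ∀ t ∈ Ioo a b, QTr p μ ι (qrep (w + z2) t - x) r1)
    (h3 : ∀ t ∈ Ioo a b, QTr p μ ι (qrep (z1 - z2) t) D)
    (k1 : eLpNorm ((Ioo a b).indicator (fun _ => (1:ℝ))) (ENNReal.ofReal p) (qlnu p μ) ≤ ENNReal.ofReal ε1)
    (k2 : eLpNorm ((Ioo a b).indicator ((w + z2).2.1 : ℝ → X₁)) (ENNReal.ofReal p) (qlnu p μ) ≤ ENNReal.ofReal ε2) :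
    eLpNorm (qPhi A F (A x) w z1 a b - qPhi A F (A x) w z2 a b) (ENNReal.ofReal p) (qlnu p μ) ≤
      ENNReal.ofReal (L * r1 * ‖z1 - z2‖ + L * D * (ε1 + ε2)) := by
  have hx : QTr p μ ι (x - x) r := by rw [sub_self]; exact QTr.zero.mono (hr1.trans hr)
  have hb : ∀ᵐ t ∂(qlnu p μ), ‖(qPhi A F (A x) w z1 a b - qPhi A F (A x) w z2 a b) t‖ ≤
      ((fun t => (L * r1) • ‖(z1 - z2).2.1 t‖) + fun t => (L * D) • ((Ioo a b).indicator (fun _ => (1:ℝ)) t + ‖(Ioo a b).indicator ((w + z2).2.1 : ℝ → X₁) t‖)) t := by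
    filter_upwards [Lp.coeFn_sub z1.2.1 z2.2.1, Lp.coeFn_add w.2.1 z1.2.1, Lp.coeFn_add w.2.1 z2.2.1] with t q1 q2 q3
    simp only [Pi.sub_apply, Pi.add_apply, smul_eq_mul, qPhi]
    by_cases ht : t ∈ Ioo a b
    · simp only [indicator_of_mem ht]
      have q1' : (z1 - z2).2.1 t = z1.2.1 t - z2.2.1 t := q1
      have q2' : (w + z1).2.1 t = w.2.1 t + z1.2.1 t := q2
      have q3' : (w + z2).2.1 t = w.2.1 t + z2.2.1 t := q3
      have t0 : 0 ≤ t := ha.trans ht.1.le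
      have hd : QTr p μ ι (qrep (w + z1) t - qrep (w + z2) t) D := by
        rw [← qrep_sub _ _ t0, add_sub_add_left_eq_sub]
        exact h3 t ht
      have s1 := (hlip _ _ ((h1 t ht).mono hr) hx _ (h1 t ht)).1
      have s2 := hlip _ _ ((h1 t ht).mono hr) ((h2 t ht).mono hr) _ hd
      have id1 : A x (z1.2.1 t) + F (qrep (w + z1) t) - A (qrep (w + z1) t) ((w + z1).2.1 t) - w.2.2 t -
          (A x (z2.2.1 t) + F (qrep (w + z2) t) - A (qrep (w + z2) t) ((w + z2).2.1 t) - w.2.2 t) =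
          -((A (qrep (w + z1) t) - A x) ((z1 - z2).2.1 t)) + ((F (qrep (w + z1) t) - F (qrep (w + z2) t)) -
            (A (qrep (w + z1) t) - A (qrep (w + z2) t)) ((w + z2).2.1 t)) := by
        rw [q1', q2', q3']
        simp only [ContinuousLinearMap.sub_apply, map_sub, map_add]
        abel
      rw [id1]
      refine (norm_add_le _ _).trans (add_le_add ?_ ((norm_sub_le _ _).trans ?_))
      · rw [norm_neg]
        exact (ContinuousLinearMap.le_opNorm _ _).trans (mul_le_mul_of_nonneg_right s1 (norm_nonneg _))
      · rw [mul_add, mul_one]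
        exact add_le_add s2.2 ((ContinuousLinearMap.le_opNorm _ _).trans (mul_le_mul_of_nonneg_right s2.1 (norm_nonneg _)))
    · simp only [indicator_of_notMem ht]
      simp
      positivity
  have mi : MemLp ((Ioo a b).indicator (fun _ => (1:ℝ))) (ENNReal.ofReal p) (qlnu p μ) :=
    ⟨ql_asm_ind ha aestronglyMeasurable_const, k1.trans_lt ENNReal.ofReal_lt_top⟩
  have mj : MemLp (fun t => ‖(Ioo a b).indicator ((w + z2).2.1 : ℝ → X₁) t‖) (ENNReal.ofReal p) (qlnu p μ) :=
    ((Lp.memLp (w + z2).2.1).indicator measurableSet_Ioo).norm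
  have mk : MemLp (fun t => ‖(z1 - z2).2.1 t‖) (ENNReal.ofReal p) (qlnu p μ) := (Lp.memLp (z1 - z2).2.1).norm
  refine (eLpNorm_mono_ae_real hb).trans ?_
  refine (eLpNorm_add_le (mk.const_smul (L * r1)).1 ((mi.add mj).const_smul (L * D)).1 (qlFactP p).out).trans ?_
  rw [ENNReal.ofReal_add (by positivity) (by positivity)]
  refine add_le_add ?_ ?_
  · rw [eLpNorm_const_smul, eLpNorm_norm, Real.enorm_eq_ofReal (by positivity), ENNReal.ofReal_mul (p := L * r1) (by positivity)]
    refine mul_le_mul_right ?_ _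
    rw [← ENNReal.ofReal_toReal (Lp.memLp (z1 - z2).2.1).2.ne, ← Lp.norm_def]
    exact ENNReal.ofReal_le_ofReal ((norm_fst_le _).trans (norm_snd_le (z1 - z2)))
  · rw [eLpNorm_const_smul, Real.enorm_eq_ofReal (by positivity), ENNReal.ofReal_mul (p := L * D) (by positivity)]
    refine mul_le_mul_right ?_ _
    refine (eLpNorm_add_le mi.1 mj.1 (qlFactP p).out).trans ?_
    rw [eLpNorm_norm, ENNReal.ofReal_add e1 e2]
    exact add_le_add k1 k2

theorem ql_step (hH : QHyp p μ ι A F V) (hMR : ∀ x ∈ V, ∃ M, QMR p ι (A x) M) {v : QTT X₀ X₁ p μ}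
    (hv : v ∈ QEE p μ ι) {t0 : ℝ} (ht0 : 0 ≤ t0) (hV : qrep v t0 ∈ V) :
    ∃ τ > 0, ∃ σ > 0, ∃ S : Lp X₀ (ENNReal.ofReal p) (qlnu p μ) →L[ℂ] QTT X₀ X₁ p μ,
      (∀ f, S f ∈ QZZ p μ ι) ∧ (∀ f, QDD p μ (A (qrep v t0)) (S f) = f) ∧
      ∀ a b y, 0 ≤ a → t0 - τ < a → b < t0 + τ → y ∈ QEE p μ ι → ‖y‖ ≤ σ →
        (∀ f : Lp X₀ (ENNReal.ofReal p) (qlnu p μ), ‖f‖ ≤ σ → ∀ t ∈ Icc a b, qrep (v + y + S f) t ∈ V) ∧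
        (∀ ρ, 0 < ρ → ρ ≤ σ → eLpNorm ((Ioo a b).indicator fun t => F (qrep (v + y) t) -
          A (qrep (v + y) t) ((v + y).2.1 t) - (v + y).2.2 t) (ENNReal.ofReal p) (qlnu p μ) ≤ ENNReal.ofReal (ρ / 2) →
          ∃ f : Lp X₀ (ENNReal.ofReal p) (qlnu p μ), ‖f‖ ≤ ρ ∧ f =ᵐ[qlnu p μ] qPhi A F (A (qrep v t0)) (v + y) (S f) a b) ∧
        ∀ f1 f2 : Lp X₀ (ENNReal.ofReal p) (qlnu p μ), ‖f1‖ ≤ σ → ‖f2‖ ≤ σ → f1 =ᵐ[qlnu p μ] qPhi A F (A (qrep v t0)) (v + y) (S f1) a b →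
          f2 =ᵐ[qlnu p μ] qPhi A F (A (qrep v t0)) (v + y) (S f2) a b → f1 = f2 := by
  obtain ⟨M, hM⟩ := hMR _ hV
  obtain ⟨S, hS1, hS2⟩ := ql_Sinv hM μ
  obtain ⟨r, r0, L, L0, hin, hlip⟩ := hH _ hV
  obtain ⟨C, hC, hrep⟩ := ql_rep_bd p μ ι
  set x := qrep v t0 with hx
  set N := ‖S‖ with hN
  have N0 : 0 ≤ N := norm_nonneg _
  have C0 : 0 < C := by linarith
  set Q := 1 + C + C * N with hQ
  have Q0 : 0 < Q := by positivity
  set K := L * Q * N + L * (C * N) * (3 + N) with hK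
  have K0 : 0 ≤ K := by positivity
  set σ := min (r / Q) (1 / (2 * (K + 1))) with hσ
  have σ0 : 0 < σ := by positivity
  have σ1 : σ * Q ≤ r := by
    rw [← le_div_iff₀ Q0]
    exact min_le_left _ _
  have σ2 : K * σ ≤ 1 / 2 := by
    have : σ ≤ 1 / (2 * (K + 1)) := min_le_right _ _
    rw [le_div_iff₀ (by positivity)] at this
    nlinarith
  obtain ⟨τ1, τ10, hτ1⟩ := ql_rep_cont hv σ0
  obtain ⟨τ2, τ20, hτ2⟩ := ql_small (Lp.memLp v.2.1) ht0 σ0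
  obtain ⟨τ3, τ30, hτ3⟩ := ql_small1 (p := p) (μ := μ) ht0 σ0
  refine ⟨min τ1 (min τ2 τ3), by positivity, σ, σ0, S, hS1, hS2, ?_⟩
  intro a b y ha h1 h2 hy hyσ
  have l1 : min τ1 (min τ2 τ3) ≤ τ1 := min_le_left _ _
  have l2 : min τ1 (min τ2 τ3) ≤ τ2 := (min_le_right _ _).trans (min_le_left _ _)
  have l3 : min τ1 (min τ2 τ3) ≤ τ3 := (min_le_right _ _).trans (min_le_right _ _)
  have b1 := hτ2 a b ha (by linarith) (by linarith)
  have b2 := hτ3 a b ha (by linarith) (by linarith)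
  have hSn : ∀ f, ‖S f‖ ≤ N * ‖f‖ := fun f => S.le_opNorm f
  have val : ∀ f : Lp X₀ (ENNReal.ofReal p) (qlnu p μ), ‖f‖ ≤ σ → ∀ t ∈ Icc a b, QTr p μ ι (qrep (v + y + S f) t - x) (σ * Q) := by
    intro f hf t ht
    have t0' : 0 ≤ t := ha.trans ht.1
    have c1 := hτ1 t0 t ht0 t0' (by rw [abs_lt]; constructor <;> linarith [ht.1, ht.2])
    have c2 := hrep y hy t t0'
    have c3 := hrep _ ((QZZ_mem p μ ι _).1 (hS1 f)).1 t t0'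
    have := (c1.add c2).add c3
    rw [qrep_add _ _ t0', qrep_add _ _ t0']
    have e : qrep v t - qrep v t0 + qrep y t + qrep (S f) t = qrep v t + qrep y t + qrep (S f) t - x := by
      rw [hx]; abel
    rw [e] at this
    refine this.mono ?_
    have d1 := mul_le_mul_of_nonneg_left hyσ C0.le
    have d2 := mul_le_mul_of_nonneg_left ((hSn f).trans (mul_le_mul_of_nonneg_left hf N0)) C0.le
    rw [hQ]
    nlinarith
  have valV : ∀ f : Lp X₀ (ENNReal.ofReal p) (qlnu p μ), ‖f‖ ≤ σ → ∀ t ∈ Icc a b, qrep (v + y + S f) t ∈ V :=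
    fun f hf t ht => hin _ ((val f hf t ht).mono σ1)
  have mem : ∀ f : Lp X₀ (ENNReal.ofReal p) (qlnu p μ), ‖f‖ ≤ σ → MemLp (qPhi A F (A x) (v + y) (S f) a b) (ENNReal.ofReal p) (qlnu p μ) := by
    intro f hf
    exact ql_resid_memLp hH (add_mem (add_mem hv hy) ((QZZ_mem p μ ι _).1 (hS1 f)).1) ha (valV f hf)
      ((A x).comp_memLp' (Lp.memLp (S f).2.1)) (Lp.memLp (v + y).2.2)
  have contr : ∀ f1 f2 : Lp X₀ (ENNReal.ofReal p) (qlnu p μ), ‖f1‖ ≤ σ → ‖f2‖ ≤ σ →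
      eLpNorm (qPhi A F (A x) (v + y) (S f1) a b - qPhi A F (A x) (v + y) (S f2) a b) (ENNReal.ofReal p) (qlnu p μ)
        ≤ ENNReal.ofReal (1 / 2 * ‖f1 - f2‖) := by
    intro f1 f2 hf1 hf2
    have hz : ‖S f1 - S f2‖ ≤ N * ‖f1 - f2‖ := by rw [← map_sub]; exact hSn _
    have k2 : eLpNorm ((Ioo a b).indicator ((v + y + S f2).2.1 : ℝ → X₁)) (ENNReal.ofReal p) (qlnu p μ) ≤
        ENNReal.ofReal (σ + (σ + N * σ)) := by
      have e : (Ioo a b).indicator ((v + y + S f2).2.1 : ℝ → X₁) =ᵐ[qlnu p μ]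
          (Ioo a b).indicator (v.2.1 : ℝ → X₁) + (Ioo a b).indicator ((y + S f2).2.1 : ℝ → X₁) := by
        have : v + y + S f2 = v + (y + S f2) := add_assoc _ _ _
        rw [this, ← indicator_add']
        filter_upwards [Lp.coeFn_add v.2.1 (y + S f2).2.1] with t ht
        have ht' : (v + (y + S f2)).2.1 t = v.2.1 t + (y + S f2).2.1 t := ht
        simp only [indicator, Pi.add_apply, ht']
      rw [eLpNorm_congr_ae e]
      refine (eLpNorm_add_le ((Lp.memLp v.2.1).indicator measurableSet_Ioo).1
        ((Lp.memLp (y + S f2).2.1).indicator measurableSet_Ioo).1 (qlFactP p).out).trans ?_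
      rw [ENNReal.ofReal_add (by positivity) (by positivity)]
      refine add_le_add b1 ((eLpNorm_indicator_le _).trans ?_)
      rw [← ENNReal.ofReal_toReal (Lp.memLp (y + S f2).2.1).2.ne, ← Lp.norm_def]
      refine ENNReal.ofReal_le_ofReal (((norm_fst_le _).trans (norm_snd_le (y + S f2))).trans ((norm_add_le _ _).trans ?_))
      exact add_le_add hyσ ((hSn f2).trans (mul_le_mul_of_nonneg_left hf2 N0))
    have main := ql_contr (ι := ι) (a := a) (b := b) (D := C * (N * ‖f1 - f2‖)) ha (by positivity) σ1 L0.le (by positivity)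
      σ0.le (by positivity) hlip
      (v + y) (S f1) (S f2) (fun t ht => val f1 hf1 t (Ioo_subset_Icc_self ht))
      (fun t ht => val f2 hf2 t (Ioo_subset_Icc_self ht))
      (fun t ht => (hrep _ (sub_mem ((QZZ_mem p μ ι _).1 (hS1 f1)).1 ((QZZ_mem p μ ι _).1 (hS1 f2)).1) t (ha.trans ht.1.le)).mono
        (mul_le_mul_of_nonneg_left hz C0.le)) b2 k2
    refine main.trans (ENNReal.ofReal_le_ofReal ?_)
    calc L * (σ * Q) * ‖S f1 - S f2‖ + L * (C * (N * ‖f1 - f2‖)) * (σ + (σ + (σ + N * σ)))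
        ≤ L * (σ * Q) * (N * ‖f1 - f2‖) + L * (C * (N * ‖f1 - f2‖)) * (σ + (σ + (σ + N * σ))) := by gcongr
      _ = K * σ * ‖f1 - f2‖ := by rw [hK]; ring
      _ ≤ _ := mul_le_mul_of_nonneg_right σ2 (norm_nonneg _)
  refine ⟨valV, ?_, ?_⟩
  · intro ρ ρ0 ρσ hres
    classical
    let Φ : Lp X₀ (ENNReal.ofReal p) (qlnu p μ) → Lp X₀ (ENNReal.ofReal p) (qlnu p μ) := fun f =>
      if h : MemLp (qPhi A F (A x) (v + y) (S f) a b) (ENNReal.ofReal p) (qlnu p μ) then h.toLp else 0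
    have hΦ : ∀ f (hf : ‖f‖ ≤ σ), Φ f = (mem f hf).toLp := fun f hf => dif_pos (mem f hf)
    have hd : ∀ f1 f2 : Lp X₀ (ENNReal.ofReal p) (qlnu p μ), ‖f1‖ ≤ σ → ‖f2‖ ≤ σ → ‖Φ f1 - Φ f2‖ ≤ 1 / 2 * ‖f1 - f2‖ := by
      intro f1 f2 hf1 hf2
      rw [hΦ f1 hf1, hΦ f2 hf2, ← MemLp.toLp_sub, Lp.norm_toLp]
      exact ENNReal.toReal_le_of_le_ofReal (by positivity) (contr f1 f2 hf1 hf2)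
    have h0σ : ‖(0 : Lp X₀ (ENNReal.ofReal p) (qlnu p μ))‖ ≤ σ := by rw [norm_zero]; exact σ0.le
    have h0 : ‖Φ 0‖ ≤ ρ / 2 := by
      rw [hΦ 0 h0σ, Lp.norm_toLp]
      refine ENNReal.toReal_le_of_le_ofReal (by positivity) (le_trans (le_of_eq (eLpNorm_congr_ae ?_)) hres)
      filter_upwards [Lp.coeFn_zero X₁ (ENNReal.ofReal p) (qlnu p μ)] with t ht
      have ht' : (0 : QTT X₀ X₁ p μ).2.1 t = 0 := ht
      unfold qPhi
      simp only [map_zero, add_zero, indicator, ht', zero_add]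
    have hmaps : MapsTo Φ (Metric.closedBall 0 ρ) (Metric.closedBall 0 ρ) := by
      intro f hf
      rw [mem_closedBall_zero_iff] at hf ⊢
      have := hd f 0 (hf.trans ρσ) h0σ
      rw [sub_zero] at this
      have h2 := norm_sub_norm_le (Φ f) (Φ 0)
      linarith
    have hcon : ContractingWith (1 / 2) (hmaps.restrict Φ _ _) := by
      refine ⟨by rw [← NNReal.coe_lt_coe]; norm_num, LipschitzWith.of_dist_le_mul fun f1 f2 => ?_⟩
      rw [Subtype.dist_eq, Subtype.dist_eq, dist_eq_norm, dist_eq_norm]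
      have := hd f1 f2 ((mem_closedBall_zero_iff.1 f1.2).trans ρσ) ((mem_closedBall_zero_iff.1 f2.2).trans ρσ)
      simpa using this
    obtain ⟨f, hf, hfix, -⟩ := hcon.exists_fixedPoint' (Metric.isClosed_closedBall.isComplete) hmaps
      (x := 0) (Metric.mem_closedBall_self ρ0.le) (edist_ne_top _ _)
    rw [mem_closedBall_zero_iff] at hf
    refine ⟨f, hf, ?_⟩
    have e1 : Φ f = f := hfix
    rw [hΦ f (hf.trans ρσ)] at e1
    have := (mem f (hf.trans ρσ)).coeFn_toLp
    rw [e1] at this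
    exact this
  · intro f1 f2 hf1 hf2 e1 e2
    have c := contr f1 f2 hf1 hf2
    have e3 : (f1 - f2 : Lp X₀ (ENNReal.ofReal p) (qlnu p μ)) =ᵐ[qlnu p μ] qPhi A F (A x) (v + y) (S f1) a b - qPhi A F (A x) (v + y) (S f2) a b := by
      filter_upwards [Lp.coeFn_sub f1 f2, e1, e2] with t q1 q2 q3
      rw [q1, Pi.sub_apply, Pi.sub_apply, q2, q3]
    have := ql_Lp_norm_le (by positivity) e3 c
    have h0 : ‖f1 - f2‖ = 0 := le_antisymm (by linarith [norm_nonneg (f1 - f2)]) (norm_nonneg _)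
    exact sub_eq_zero.1 (norm_eq_zero.1 h0)

end qlstep

section qlglue
open Filter Topology intervalIntegral
open scoped ENNReal NNReal
variable {p : ℝ} [hp : Fact (1 < p)] {μ : ℝ} [hμ : Fact (1 / p < μ)] [hμ1 : Fact (μ ≤ 1)]
  {ι : X₁ →L[ℂ] X₀} {A : X₀ → X₁ →L[ℂ] X₀} {F : X₀ → X₀} {V : Set X₀}

theorem ql_van {d : QTT X₀ X₁ p μ} (hd : d ∈ QZZ p μ ι) {b : ℝ}
    (h : ∀ᵐ t ∂(volume.restrict (Ioo 0 b)), d.2.1 t = 0) :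
    (∀ᵐ t ∂(volume.restrict (Ioo 0 b)), d.2.2 t = 0) ∧ ∀ t ∈ Icc 0 b, qrep d t = 0 := by
  obtain ⟨h1, h2⟩ := (QZZ_mem p μ ι _).1 hd
  obtain ⟨q1, q2, q3⟩ := h1 b
  have k : ∀ᵐ t ∂(volume.restrict (Ioo 0 b)), d.2.2 t = 0 := by
    refine ql_zero_deriv (x := d.1) (ql_Lp_int b _) ?_
    filter_upwards [h, q3] with t e1 e2
    rw [← e2, e1, map_zero]
  refine ⟨k, fun t ht => ?_⟩
  unfold qrep
  rw [ql_icongr (g := fun _ => 0) k ht.1 ht.2, h2]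
  simp

def QS (A : X₀ → X₁ →L[ℂ] X₀) (F : X₀ → X₀) (V : Set X₀) (b : ℝ) (g : QTT X₀ X₁ p μ) : Prop :=
  (∀ t ∈ Icc 0 b, qrep g t ∈ V) ∧
    ∀ᵐ t ∂(volume.restrict (Ioo 0 b)), g.2.2 t + A (qrep g t) (g.2.1 t) = F (qrep g t)

theorem ql_ae_up {P : ℝ → Prop} {b : ℝ} (h : ∀ᵐ t ∂(volume.restrict (Ioo 0 b)), P t) : ∀ᵐ t ∂qlm, t ∈ Ioo 0 b → P t :=
  ae_restrict_of_ae ((ae_restrict_iff' measurableSet_Ioo).1 h)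

theorem ql_ae_split {P : ℝ → Prop} {a b : ℝ} (h1 : ∀ᵐ t ∂(volume.restrict (Ioo 0 a)), P t)
    (h2 : ∀ᵐ t ∂(volume.restrict (Ioo 0 b)), t ∈ Ioo a b → P t) : ∀ᵐ t ∂(volume.restrict (Ioo 0 b)), P t := by
  rw [ae_restrict_iff' measurableSet_Ioo] at *
  filter_upwards [h1, h2, (Set.finite_singleton a).countable.ae_notMem volume] with t q1 q2 q3 ht
  rcases lt_trichotomy t a with h | h | h
  · exact q1 ⟨ht.1, h⟩
  · exact absurd h q3
  · exact q2 ht ⟨h, ht.2⟩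

theorem ql_glue {A0 : X₁ →L[ℂ] X₀} {M : ℝ≥0} (hM : QMR p ι A0 M)
    {S : Lp X₀ (ENNReal.ofReal p) (qlnu p μ) →L[ℂ] QTT X₀ X₁ p μ} (hS1 : ∀ f, S f ∈ QZZ p μ ι)
    (hS2 : ∀ f, QDD p μ A0 (S f) = f) {w : QTT X₀ X₁ p μ} {a b : ℝ} (ha : 0 ≤ a)
    (hw : QS A F V a w) {f : Lp X₀ (ENNReal.ofReal p) (qlnu p μ)}
    (hf : f =ᵐ[qlnu p μ] qPhi A F A0 w (S f) a b) (hV : ∀ t ∈ Icc a b, qrep (w + S f) t ∈ V) :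
    QS A F V b (w + S f) ∧ ∀ᵐ t ∂(volume.restrict (Ioo 0 a)), (S f).2.1 t = 0 := by
  have hf' : ∀ᵐ t ∂qlm, f t = qPhi A F A0 w (S f) a b t := by rwa [EventuallyEq, ql_ae] at hf
  have hq : ∀ᵐ t ∂qlm, (S f).2.2 t + A0 ((S f).2.1 t) = qPhi A F A0 w (S f) a b t := by
    have := QDD_ae p μ A0 (S f)
    rw [hS2] at this
    filter_upwards [this, hf'] with t h1 h2
    rw [← h1, h2]
  obtain ⟨z1, z2⟩ := (QZZ_mem p μ ι _).1 (hS1 f)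
  have hz : ∀ᵐ t ∂(volume.restrict (Ioo 0 a)), (S f).2.1 t = 0 := by
    refine ql_uniq hM (d' := (S f).2.2) ?_ ?_
    · rw [← z2]; exact z1 a
    · filter_upwards [ql_ae_loc a hq, ae_restrict_mem measurableSet_Ioo] with t h1 h2
      rw [h1, qPhi, indicator_of_notMem]
      exact fun h => absurd h.1 (not_lt.2 h2.2.le)
  obtain ⟨z3, z4⟩ := ql_van (hS1 f) hz
  have e1 : ∀ᵐ t ∂qlm, (w + S f).2.1 t = w.2.1 t + (S f).2.1 t := by
    rw [← ql_ae p μ]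
    exact Lp.coeFn_add w.2.1 (S f).2.1
  have e2 : ∀ᵐ t ∂qlm, (w + S f).2.2 t = w.2.2 t + (S f).2.2 t := by
    rw [← ql_ae p μ]
    exact Lp.coeFn_add w.2.2 (S f).2.2
  refine ⟨⟨fun t ht => ?_, ?_⟩, hz⟩
  · rcases le_total t a with h | h
    · rw [qrep_add _ _ ht.1, z4 t ⟨ht.1, h⟩, add_zero]
      exact hw.1 t ⟨ht.1, h⟩
    · exact hV t ⟨h, ht.2⟩
  · refine ql_ae_split (a := a) ?_ ?_
    · filter_upwards [hz, z3, ql_ae_loc a e1, ql_ae_loc a e2, hw.2, ae_restrict_mem measurableSet_Ioo] with t h1 h2 h3 h4 h5 h6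
      rw [h3, h4, h1, h2, add_zero, add_zero, qrep_add _ _ h6.1.le, z4 t ⟨h6.1.le, h6.2.le⟩, add_zero, h5]
    · filter_upwards [ql_ae_loc b e2, ql_ae_loc b hq] with t h2 h3 h4
      rw [qPhi, indicator_of_mem h4] at h3
      rw [h2]
      have h5 := eq_sub_of_add_eq h3
      rw [h5]
      abel

theorem ql_induct {P : ℝ → Prop} {T : ℝ} (hT : 0 ≤ T) (h0 : P 0)
    (h : ∀ c ∈ Icc 0 T, ∃ τ > 0, ∀ a b, 0 ≤ a → a ≤ b → b ≤ T → c - τ < a → b < c + τ → P a → P b) : P T := by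
  set S := {t | t ∈ Icc 0 T ∧ P t} with hS
  have h0S : (0:ℝ) ∈ S := ⟨⟨le_rfl, hT⟩, h0⟩
  have hbd : BddAbove S := ⟨T, fun t ht => ht.1.2⟩
  have c0 : 0 ≤ sSup S := le_csSup hbd h0S
  have cT : sSup S ≤ T := csSup_le ⟨0, h0S⟩ fun t ht => ht.1.2
  obtain ⟨τ, τ0, hτ⟩ := h _ ⟨c0, cT⟩
  obtain ⟨a, ha, ha2⟩ := exists_lt_of_lt_csSup ⟨0, h0S⟩ (show sSup S - τ < sSup S by linarith)
  have hac := le_csSup hbd ha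
  have hb := hτ a (min T (sSup S + τ / 2)) ha.1.1 (le_min ha.1.2 (by linarith)) (min_le_left _ _) ha2
    (lt_of_le_of_lt (min_le_right _ _) (by linarith)) ha.2
  rcases le_total T (sSup S + τ / 2) with h1 | h1
  · rwa [min_eq_left h1] at hb
  · rw [min_eq_right h1] at hb
    have := le_csSup hbd (show sSup S + τ / 2 ∈ S from ⟨⟨by linarith, h1⟩, hb⟩)
    linarith

/-- uniqueness -/
theorem ql_unq (hH : QHyp p μ ι A F V) (hMR : ∀ x ∈ V, ∃ M, QMR p ι (A x) M) {v g : QTT X₀ X₁ p μ}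
    (hv : v ∈ QEE p μ ι) (hg : g ∈ QEE p μ ι) {T : ℝ} (hT : 0 ≤ T) (h1 : g.1 = v.1) (sv : QS A F V T v)
    (sg : QS A F V T g) : ∀ᵐ t ∂(volume.restrict (Ioo 0 T)), g.2.1 t = v.2.1 t := by
  set d := g - v with hd
  have hdZ : d ∈ QZZ p μ ι := (QZZ_mem p μ ι _).2 ⟨sub_mem hg hv, sub_eq_zero.2 h1⟩
  obtain ⟨d1, d2⟩ := (QZZ_mem p μ ι _).1 hdZ
  have e1 : ∀ᵐ t ∂qlm, d.2.1 t = g.2.1 t - v.2.1 t := by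
    rw [← ql_ae p μ]
    exact Lp.coeFn_sub g.2.1 v.2.1
  have e2 : ∀ᵐ t ∂qlm, d.2.2 t = g.2.2 t - v.2.2 t := by
    rw [← ql_ae p μ]
    exact Lp.coeFn_sub g.2.2 v.2.2
  have main : ∀ᵐ t ∂(volume.restrict (Ioo 0 T)), d.2.1 t = 0 := by
    refine ql_induct (P := fun T => ∀ᵐ t ∂(volume.restrict (Ioo 0 T)), d.2.1 t = 0) hT (by simp) ?_
    intro c hc
    obtain ⟨M, hM⟩ := hMR _ (sv.1 c hc)
    obtain ⟨τ1, τ10, σ, σ0, S, hS1, hS2, hst⟩ := ql_step hH hMR hv hc.1 (sv.1 c hc)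
    set A0 := A (qrep v c) with hA0
    obtain ⟨τ2, τ20, hτ2⟩ := ql_small (Lp.memLp (QDD p μ A0 d)) hc.1 σ0
    refine ⟨min τ1 τ2, by positivity, fun a b ha hab hbT k1 k2 hPa => ?_⟩
    have l1 := min_le_left τ1 τ2
    have l2 := min_le_right τ1 τ2
    obtain ⟨-, -, huq⟩ := hst a b 0 ha (by linarith) (by linarith) (zero_mem _) (by rw [norm_zero]; exact σ0.le)
    rw [add_zero] at huq
    have fm : MemLp ((Ioo a b).indicator (QDD p μ A0 d : ℝ → X₀)) (ENNReal.ofReal p) (qlnu p μ) :=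
      (Lp.memLp (QDD p μ A0 d)).indicator measurableSet_Ioo
    set f := fm.toLp with hf
    have hfa : ∀ᵐ t ∂qlm, f t = (Ioo a b).indicator (QDD p μ A0 d : ℝ → X₀) t := by
      rw [← ql_ae p μ]
      exact fm.coeFn_toLp
    have hDD := QDD_ae p μ A0 d
    obtain ⟨d3, d4⟩ := ql_van hdZ hPa
    have hfb : ∀ᵐ t ∂(volume.restrict (Ioo 0 b)), f t = d.2.2 t + A0 (d.2.1 t) := by
      refine ql_ae_split (a := a) ?_ ?_
      · filter_upwards [hPa, d3, ql_ae_loc a hfa, ae_restrict_mem measurableSet_Ioo] with t h1 h2 h3 h4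
        rw [h1, h2, h3, indicator_of_notMem (fun h => absurd h.1 (not_lt.2 h4.2.le))]
        simp
      · filter_upwards [ql_ae_loc b hfa, ql_ae_loc b hDD] with t h1 h2 h3
        rw [h1, indicator_of_mem h3, h2]
    have hSd : S f - d ∈ QZZ p μ ι := sub_mem (hS1 f) hdZ
    obtain ⟨s1, s2⟩ := (QZZ_mem p μ ι _).1 hSd
    have hSD := QDD_ae p μ A0 (S f)
    rw [hS2] at hSD
    have e3 : ∀ᵐ t ∂qlm, (S f - d).2.1 t = (S f).2.1 t - d.2.1 t := by
      rw [← ql_ae p μ]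
      exact Lp.coeFn_sub (S f).2.1 d.2.1
    have e4 : ∀ᵐ t ∂qlm, (S f - d).2.2 t = (S f).2.2 t - d.2.2 t := by
      rw [← ql_ae p μ]
      exact Lp.coeFn_sub (S f).2.2 d.2.2
    have hz : ∀ᵐ t ∂(volume.restrict (Ioo 0 b)), (S f - d).2.1 t = 0 := by
      refine ql_uniq hM (d' := (S f - d).2.2) ?_ ?_
      · rw [← s2]; exact s1 b
      · filter_upwards [ql_ae_loc b e3, ql_ae_loc b e4, ql_ae_loc b hSD, hfb] with t q1 q2 q3 q4
        rw [q1, q2, map_sub]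
        have := q3.symm.trans q4
        rw [sub_add_sub_comm, this, sub_self]
    obtain ⟨z1, z2⟩ := ql_van hSd hz
    have e5 : ∀ᵐ t ∂qlm, (v + S f).2.1 t = v.2.1 t + (S f).2.1 t := by
      rw [← ql_ae p μ]
      exact Lp.coeFn_add v.2.1 (S f).2.1
    have fixf : f =ᵐ[qlnu p μ] qPhi A F A0 v (S f) a b := by
      rw [EventuallyEq, ql_ae]
      have key : ∀ᵐ t ∂(volume.restrict (Ioo 0 b)), f t = A0 ((S f).2.1 t) + F (qrep (v + S f) t) -
          A (qrep (v + S f) t) ((v + S f).2.1 t) - v.2.2 t := by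
        filter_upwards [hfb, hz, ql_ae_loc b e3, ql_ae_loc b e5, ql_ae_loc b e1, ql_ae_loc b e2,
          ae_restrict_mem measurableSet_Ioo, ae_restrict_of_ae_restrict_of_subset (Ioo_subset_Ioo_right hbT) sg.2]
          with t q1 q2 q3 q4 q5 q6 q7 q8
        have r1 : (S f).2.1 t = d.2.1 t := sub_eq_zero.1 (q3.symm.trans q2)
        have r2 : qrep (v + S f) t = qrep g t := by
          have := z2 t ⟨q7.1.le, q7.2.le⟩
          rw [qrep_sub _ _ q7.1.le, hd, qrep_sub _ _ q7.1.le] at this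
          rw [qrep_add _ _ q7.1.le, sub_eq_zero.1 this, add_sub_cancel]
        rw [q1, q4, r1, r2, ← q8, q6, q5, add_sub_cancel]
        abel
      filter_upwards [hfa, ql_ae_up key] with t h1 h2
      by_cases ht : t ∈ Ioo a b
      · rw [qPhi, indicator_of_mem ht]
        exact h2 ⟨ha.trans_lt ht.1, ht.2⟩
      · rw [h1, qPhi, indicator_of_notMem ht, indicator_of_notMem ht]
    have fix0 : (0 : Lp X₀ (ENNReal.ofReal p) (qlnu p μ)) =ᵐ[qlnu p μ] qPhi A F A0 v (S 0) a b := by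
      rw [EventuallyEq, ql_ae]
      have h1 := Lp.coeFn_zero X₀ (ENNReal.ofReal p) (qlnu p μ)
      have h2 := Lp.coeFn_zero X₁ (ENNReal.ofReal p) (qlnu p μ)
      rw [EventuallyEq, ql_ae] at h1 h2
      have key := ql_ae_up (ae_restrict_of_ae_restrict_of_subset (Ioo_subset_Ioo_right hbT) sv.2)
      filter_upwards [h1, h2, key] with t k1 k2 k3
      rw [k1, map_zero, qPhi, add_zero]
      have k2' : (0 : QTT X₀ X₁ p μ).2.1 t = 0 := k2
      by_cases ht : t ∈ Ioo a b
      · rw [indicator_of_mem ht, ← k3 ⟨ha.trans_lt ht.1, ht.2⟩, k2', map_zero]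
        simp
      · rw [indicator_of_notMem ht]
        rfl
    have hfσ : ‖f‖ ≤ σ := ql_Lp_norm_le σ0.le fm.coeFn_toLp (hτ2 a b ha (by linarith) (by linarith))
    have f0 := huq f 0 hfσ (by rw [norm_zero]; exact σ0.le) fixf fix0
    refine ql_uniq hM (d' := d.2.2) (by rw [← d2]; exact d1 b) ?_
    have f00 : ∀ᵐ t ∂qlm, f t = 0 := by
      rw [← ql_ae p μ, f0]
      exact Lp.coeFn_zero _ _ _
    filter_upwards [hfb, ql_ae_loc b f00] with t q1 q2
    rw [← q1, q2]
  filter_upwards [main, ql_ae_loc T e1] with t h2 h3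
  exact sub_eq_zero.1 (h3.symm.trans h2)

end qlglue

section qllsc
open Filter Topology intervalIntegral
open scoped ENNReal NNReal
variable {p : ℝ} [hp : Fact (1 < p)] {μ : ℝ} [hμ : Fact (1 / p < μ)] [hμ1 : Fact (μ ≤ 1)]
  {ι : X₁ →L[ℂ] X₀} {A : X₀ → X₁ →L[ℂ] X₀} {F : X₀ → X₀} {V : Set X₀}

theorem ql_ext (hH : QHyp p μ ι A F V) (hMR : ∀ x ∈ V, ∃ M, QMR p ι (A x) M) {v : QTT X₀ X₁ p μ}
    (hv : v ∈ QEE p μ ι) {T : ℝ} (hT : 0 ≤ T) (sv : QS A F V T v) :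
    ∃ T', T < T' ∧ ∃ g ∈ QEE p μ ι, g.1 = v.1 ∧ QS A F V T' g := by
  have hVT := sv.1 T ⟨hT, le_rfl⟩
  obtain ⟨M, hM⟩ := hMR _ hVT
  obtain ⟨τ, τ0, σ, σ0, S, hS1, hS2, hst⟩ := ql_step hH hMR hv hT hVT
  have z0 : ‖(0 : QTT X₀ X₁ p μ)‖ ≤ σ := by rw [norm_zero]; exact σ0.le
  have hV0 : ∀ t ∈ Icc T (T + τ / 2), qrep v t ∈ V := by
    intro t ht
    have := (hst T (T + τ / 2) 0 hT (by linarith) (by linarith) (zero_mem _) z0).1 0 (by rw [norm_zero]; exact σ0.le) t ht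
    rwa [map_zero, add_zero, add_zero] at this
  have hm := ql_resid_memLp hH hv hT hV0 (w := fun _ => 0) MemLp.zero (Lp.memLp v.2.2)
  simp only [zero_add] at hm
  obtain ⟨τ2, τ20, hτ2⟩ := ql_small hm hT (half_pos σ0)
  have l1 := min_le_left τ τ2
  have l2 := min_le_right τ τ2
  have l0 : 0 < min τ τ2 := by positivity
  obtain ⟨k1, k2, -⟩ := hst T (T + min τ τ2 / 2) 0 hT (by linarith) (by linarith) (zero_mem _) z0
  rw [add_zero] at k1 k2
  have hr := hτ2 T (T + min τ τ2 / 2) hT (by linarith) (by linarith)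
  rw [indicator_indicator, inter_eq_left.2 (Ioo_subset_Ioo_right (by linarith))] at hr
  obtain ⟨f, hf, hfix⟩ := k2 σ σ0 le_rfl hr
  obtain ⟨g1, -⟩ := ql_glue hM hS1 hS2 hT sv hfix (k1 f hf)
  obtain ⟨s1, s2⟩ := (QZZ_mem p μ ι _).1 (hS1 f)
  refine ⟨T + min τ τ2 / 2, by linarith, v + S f, add_mem hv s1, ?_, g1⟩
  rw [Prod.fst_add, s2, add_zero]

theorem ql_res (hH : QHyp p μ ι A F V) {v : QTT X₀ X₁ p μ}
    (hv : v ∈ QEE p μ ι) {t0 : ℝ} (ht0 : 0 ≤ t0) (hV : qrep v t0 ∈ V) :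
    ∃ τ > 0, ∃ σ > 0, ∃ K : ℝ, 0 ≤ K ∧ ∀ a b y, 0 ≤ a → t0 - τ < a → b < t0 + τ → y ∈ QEE p μ ι → ‖y‖ ≤ σ →
      (∀ᵐ t ∂(volume.restrict (Ioo 0 b)), v.2.2 t + A (qrep v t) (v.2.1 t) = F (qrep v t)) →
      eLpNorm ((Ioo a b).indicator fun t => F (qrep (v + y) t) -
          A (qrep (v + y) t) ((v + y).2.1 t) - (v + y).2.2 t) (ENNReal.ofReal p) (qlnu p μ) ≤ ENNReal.ofReal (K * ‖y‖) := by
  obtain ⟨r, r0, L, L0, hin, hlip⟩ := hH _ hV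
  obtain ⟨C, hC, hrep⟩ := ql_rep_bd p μ ι
  set x := qrep v t0 with hx
  have C0 : 0 < C := by linarith
  set σ := r / (1 + C) with hσ
  have σ0 : 0 < σ := by positivity
  have σ1 : σ * (1 + C) = r := by rw [hσ]; field_simp
  obtain ⟨τ1, τ10, hτ1⟩ := ql_rep_cont hv σ0
  obtain ⟨τ2, τ20, hτ2⟩ := ql_small (Lp.memLp v.2.1) ht0 one_pos
  obtain ⟨τ3, τ30, hτ3⟩ := ql_small1 (p := p) (μ := μ) ht0 one_pos
  set N := ‖QDD p μ (A x)‖ with hN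
  refine ⟨min τ1 (min τ2 τ3), by positivity, σ, σ0, L * r + L * C * 2 + N, by positivity, ?_⟩
  intro a b y ha h1 h2 hy hyσ heq
  have l1 : min τ1 (min τ2 τ3) ≤ τ1 := min_le_left _ _
  have l2 : min τ1 (min τ2 τ3) ≤ τ2 := (min_le_right _ _).trans (min_le_left _ _)
  have l3 : min τ1 (min τ2 τ3) ≤ τ3 := (min_le_right _ _).trans (min_le_right _ _)
  have b1 := hτ2 a b ha (by linarith) (by linarith)
  have b2 := hτ3 a b ha (by linarith) (by linarith)
  have val : ∀ z ∈ QEE p μ ι, ‖z‖ ≤ σ → ∀ t ∈ Icc a b, QTr p μ ι (qrep (v + z) t - x) r := by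
    intro z hz hzσ t ht
    have t0' : 0 ≤ t := ha.trans ht.1
    have c1 := hτ1 t0 t ht0 t0' (by rw [abs_lt]; constructor <;> linarith [ht.1, ht.2])
    have := c1.add (hrep z hz t t0')
    rw [qrep_add _ _ t0']
    have e : qrep v t - qrep v t0 + qrep z t = qrep v t + qrep z t - x := by
      rw [hx]; abel
    rw [e] at this
    refine this.mono ?_
    have d1 := mul_le_mul_of_nonneg_left hzσ C0.le
    nlinarith
  have z0 : ‖(0 : QTT X₀ X₁ p μ)‖ ≤ σ := by rw [norm_zero]; exact σ0.le
  have mem : ∀ z ∈ QEE p μ ι, ‖z‖ ≤ σ → MemLp (qPhi A F (A x) v z a b) (ENNReal.ofReal p) (qlnu p μ) := by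
    intro z hz hzσ
    exact ql_resid_memLp hH (add_mem hv hz) ha (fun t ht => hin _ (val z hz hzσ t ht))
      ((A x).comp_memLp' (Lp.memLp z.2.1)) (Lp.memLp v.2.2)
  have main := ql_contr (ι := ι) (a := a) (b := b) (D := C * ‖y‖) ha r0.le le_rfl L0.le (by positivity) one_pos.le one_pos.le hlip
    v y 0 (fun t ht => val y hy hyσ t (Ioo_subset_Icc_self ht)) (fun t ht => val 0 (zero_mem _) z0 t (Ioo_subset_Icc_self ht))
    (fun t ht => by rw [sub_zero]; exact hrep y hy t (ha.trans ht.1.le)) b2 (by rw [add_zero]; exact b1)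
  have hD : MemLp ((Ioo a b).indicator (QDD p μ (A x) y : ℝ → X₀)) (ENNReal.ofReal p) (qlnu p μ) :=
    (Lp.memLp (QDD p μ (A x) y)).indicator measurableSet_Ioo
  have hDn : eLpNorm ((Ioo a b).indicator (QDD p μ (A x) y : ℝ → X₀)) (ENNReal.ofReal p) (qlnu p μ) ≤ ENNReal.ofReal (N * ‖y‖) := by
    refine (eLpNorm_indicator_le _).trans ?_
    rw [← ENNReal.ofReal_toReal (Lp.memLp (QDD p μ (A x) y)).2.ne, ← Lp.norm_def]
    exact ENNReal.ofReal_le_ofReal ((QDD p μ (A x)).le_opNorm y)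
  have e : ((Ioo a b).indicator fun t => F (qrep (v + y) t) -
          A (qrep (v + y) t) ((v + y).2.1 t) - (v + y).2.2 t) =ᵐ[qlnu p μ]
      (qPhi A F (A x) v y a b - qPhi A F (A x) v 0 a b) - (Ioo a b).indicator (QDD p μ (A x) y : ℝ → X₀) := by
    have q1 := QDD_ae p μ (A x) y
    have q2 := ql_ae_up heq
    have q3 := Lp.coeFn_zero X₁ (ENNReal.ofReal p) (qlnu p μ)
    have q4 := Lp.coeFn_add v.2.2 y.2.2
    rw [EventuallyEq, ql_ae] at q3 q4 ⊢
    filter_upwards [q1, q2, q3, q4] with t k1 k2 k3 k4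
    have k3' : (0 : QTT X₀ X₁ p μ).2.1 t = 0 := k3
    have k4' : (v + y).2.2 t = v.2.2 t + y.2.2 t := k4
    rw [Pi.sub_apply, Pi.sub_apply, qPhi, qPhi]
    by_cases ht : t ∈ Ioo a b
    · simp only [indicator_of_mem ht]
      rw [k1, add_zero v, k3', k4', ← k2 ⟨ha.trans_lt ht.1, ht.2⟩, map_zero]
      abel
    · simp only [indicator_of_notMem ht, sub_zero]
  rw [eLpNorm_congr_ae e]
  refine (eLpNorm_sub_le ((mem y hy hyσ).sub (mem 0 (zero_mem _) z0)).1 hD.1 (qlFactP p).out).trans ?_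
  refine (add_le_add main hDn).trans ?_
  rw [← ENNReal.ofReal_add (by positivity) (by positivity), sub_zero]
  exact ENNReal.ofReal_le_ofReal (le_of_eq (by ring))

theorem ql_lsc (hH : QHyp p μ ι A F V) (hMR : ∀ x ∈ V, ∃ M, QMR p ι (A x) M) {v : QTT X₀ X₁ p μ}
    (hv : v ∈ QEE p μ ι) {T : ℝ} (hT : 0 ≤ T) (sv : QS A F V T v) :
    ∀ ε > 0, ∃ δ > 0, ∀ x, QTr p μ ι x δ → ∃ y ∈ QEE p μ ι, ‖y‖ ≤ ε ∧ y.1 = x ∧ QS A F V T (v + y) := by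
  refine ql_induct (P := fun T => ∀ ε > 0, ∃ δ > 0, ∀ x, QTr p μ ι x δ → ∃ y ∈ QEE p μ ι, ‖y‖ ≤ ε ∧ y.1 = x ∧ QS A F V T (v + y))
    hT ?_ ?_
  · intro ε ε0
    obtain ⟨r, r0, L, L0, hin, -⟩ := hH _ (sv.1 0 ⟨le_rfl, hT⟩)
    refine ⟨min ε r, by positivity, fun x hx => ?_⟩
    obtain ⟨y, hy, hy1, hyn⟩ := hx.mono (min_le_left _ _)
    refine ⟨y, hy, hyn, hy1, fun t ht => ?_, by simp⟩
    have t0 : t = 0 := le_antisymm ht.2 ht.1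
    refine hin _ ?_
    rw [t0, qrep_add _ _ le_rfl, add_sub_cancel_left, qrep_zero y, hy1]
    exact hx.mono (min_le_right _ _)
  · intro c hc
    obtain ⟨M, hM⟩ := hMR _ (sv.1 c hc)
    obtain ⟨τ1, τ10, σ1, σ10, S, hS1, hS2, hst⟩ := ql_step hH hMR hv hc.1 (sv.1 c hc)
    obtain ⟨τ2, τ20, σ2, σ20, K, K0, hres⟩ := ql_res hH hv hc.1 (sv.1 c hc)
    refine ⟨min τ1 τ2, by positivity, fun a b ha hab hbT k1 k2 hPa ε ε0 => ?_⟩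
    have l1 := min_le_left τ1 τ2
    have l2 := min_le_right τ1 τ2
    have N0 : 0 ≤ ‖S‖ := norm_nonneg _
    set ρ := min σ1 (ε / (2 * (‖S‖ + 1))) with hρ
    have ρ0 : 0 < ρ := by positivity
    have ρ1 : ρ ≤ σ1 := min_le_left _ _
    have ρ2 : ‖S‖ * ρ ≤ ε / 2 := by
      have : ρ ≤ ε / (2 * (‖S‖ + 1)) := min_le_right _ _
      rw [le_div_iff₀ (by positivity)] at this
      nlinarith
    obtain ⟨δ, δ0, hδ⟩ := hPa (min (min σ1 σ2) (min (ε / 2) (ρ / (2 * (K + 1))))) (by positivity)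
    refine ⟨δ, δ0, fun x hx => ?_⟩
    obtain ⟨y, hy, hyn, hy1, hys⟩ := hδ x hx
    have n1 : ‖y‖ ≤ σ1 := hyn.trans ((min_le_left _ _).trans (min_le_left _ _))
    have n2 : ‖y‖ ≤ σ2 := hyn.trans ((min_le_left _ _).trans (min_le_right _ _))
    have n3 : ‖y‖ ≤ ε / 2 := hyn.trans ((min_le_right _ _).trans (min_le_left _ _))
    have n4 : K * ‖y‖ ≤ ρ / 2 := by
      have : ‖y‖ ≤ ρ / (2 * (K + 1)) := hyn.trans ((min_le_right _ _).trans (min_le_right _ _))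
      rw [le_div_iff₀ (by positivity)] at this
      nlinarith [norm_nonneg y]
    have hr := hres a b y ha (by linarith) (by linarith) hy n2
      (ae_restrict_of_ae_restrict_of_subset (Ioo_subset_Ioo_right hbT) sv.2)
    obtain ⟨w1, w2, -⟩ := hst a b y ha (by linarith) (by linarith) hy n1
    obtain ⟨f, hf, hfix⟩ := w2 ρ ρ0 ρ1 (hr.trans (ENNReal.ofReal_le_ofReal n4))
    obtain ⟨g1, -⟩ := ql_glue hM hS1 hS2 ha hys hfix (w1 f (hf.trans ρ1))
    obtain ⟨s1, s2⟩ := (QZZ_mem p μ ι _).1 (hS1 f)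
    refine ⟨y + S f, add_mem hy s1, (norm_add_le _ _).trans ?_, ?_, ?_⟩
    · have := (S.le_opNorm f).trans (mul_le_mul_of_nonneg_left hf N0)
      linarith
    · rw [Prod.fst_add, s2, add_zero, hy1]
    · rw [← add_assoc]; exact g1

end qllsc

section qlfin
open Filter Topology intervalIntegral
open scoped ENNReal NNReal
variable {p : ℝ} [hp : Fact (1 < p)] {μ : ℝ} [hμ : Fact (1 / p < μ)] [hμ1 : Fact (μ ≤ 1)]
  {ι : X₁ →L[ℂ] X₀} {A : X₀ → X₁ →L[ℂ] X₀} {F : X₀ → X₀} {V : Set X₀}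

theorem ql_extend {A0 : X₁ →L[ℂ] X₀} {M : ℝ≥0} (hM : QMR p ι A0 M) {T : ℝ} {u : ℝ → X₁} {u' : ℝ → X₀} {e0 : QTT X₀ X₁ p μ}
    (he0 : e0 ∈ QEE p μ ι) (hu : MemLp u (ENNReal.ofReal p) ((qlnu p μ).restrict (Ioo 0 T)))
    (hu' : MemLp u' (ENNReal.ofReal p) ((qlnu p μ).restrict (Ioo 0 T))) (hq : QPr ι T e0.1 u u') :
    ∃ e ∈ QEE p μ ι, e.1 = e0.1 ∧ (∀ᵐ t ∂(volume.restrict (Ioo 0 T)), e.2.1 t = u t) ∧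
      ∀ᵐ t ∂(volume.restrict (Ioo 0 T)), e.2.2 t = u' t := by
  obtain ⟨S, hS1, hS2⟩ := ql_Sinv hM μ
  have hm : MemLp ((Ioo 0 T).indicator fun t => (u' t - e0.2.2 t) + A0 (u t - e0.2.1 t)) (ENNReal.ofReal p) (qlnu p μ) := by
    rw [memLp_indicator_iff_restrict measurableSet_Ioo]
    exact (hu'.sub ((Lp.memLp e0.2.2).restrict _)).add (A0.comp_memLp' (hu.sub ((Lp.memLp e0.2.1).restrict _)))
  set f := hm.toLp with hf
  have hfa := hm.coeFn_toLp
  rw [EventuallyEq, ql_ae] at hfa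
  have hSD := QDD_ae p μ A0 (S f)
  rw [hS2] at hSD
  obtain ⟨s1, s2⟩ := (QZZ_mem p μ ι _).1 (hS1 f)
  have hE : e0 + S f ∈ QEE p μ ι := add_mem he0 s1
  have h1 : (e0 + S f).1 = e0.1 := by rw [Prod.fst_add, s2, add_zero]
  have e1 : ∀ᵐ t ∂qlm, (e0 + S f).2.1 t = e0.2.1 t + (S f).2.1 t := by
    rw [← ql_ae p μ]
    exact Lp.coeFn_add e0.2.1 (S f).2.1
  have e2 : ∀ᵐ t ∂qlm, (e0 + S f).2.2 t = e0.2.2 t + (S f).2.2 t := by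
    rw [← ql_ae p μ]
    exact Lp.coeFn_add e0.2.2 (S f).2.2
  have hd : QPr ι T 0 (fun t => (e0 + S f).2.1 t - u t) (fun t => (e0 + S f).2.2 t - u' t) := by
    have := (hE T).sub hq
    rwa [h1, sub_self] at this
  have hz := ql_uniq hM hd (by
    filter_upwards [ql_ae_loc T hfa, ql_ae_loc T hSD, ql_ae_loc T e1, ql_ae_loc T e2, ae_restrict_mem measurableSet_Ioo]
      with t q1 q2 q3 q4 q5
    rw [indicator_of_mem q5] at q1
    have q6 : (S f).2.2 t = (u' t - e0.2.2 t + A0 (u t - e0.2.1 t)) - A0 ((S f).2.1 t) :=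
      eq_sub_of_add_eq (q2.symm.trans q1)
    rw [q3, q4, q6]
    simp only [map_sub, map_add]
    abel)
  have hz' := ql_zero_deriv (x := 0) hd.2.1 (by
    filter_upwards [hz, hd.2.2] with t q1 q2
    rw [← q2, q1, map_zero])
  refine ⟨e0 + S f, hE, h1, ?_, ?_⟩
  · filter_upwards [hz] with t q
    exact sub_eq_zero.1 q
  · filter_upwards [hz'] with t q
    exact sub_eq_zero.1 q

theorem ql_in_ex {x : X₀} (h : InTrace p μ ι x) : ∃ e ∈ QEE p μ ι, e.1 = x := by
  obtain ⟨C, -, htr⟩ := ql_tr_of p μ ι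
  obtain ⟨e, h1, h2, -⟩ := htr x _ h (lt_add_one _)
  exact ⟨e, h1, h2⟩

theorem ql_in_sub {x y : X₀} (hx : InTrace p μ ι x) (hy : InTrace p μ ι y) : InTrace p μ ι (x - y) := by
  obtain ⟨C, -, htr⟩ := ql_tr_of p μ ι
  rw [sub_eq_add_neg]
  exact ((htr x _ hx (lt_add_one _)).add (htr y _ hy (lt_add_one _)).neg).trace.1

theorem ql_to (hV : TraceOpen p μ ι V) (hMR : ∀ x ∈ V, ∃ M, QMR p ι (A x) M) {T : ℝ} (hT : 0 < T) {x : X₀} {u : ℝ → X₁} {u' : ℝ → X₀}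
    (h : IsQLSol p μ T ι A F V x u u') : ∃ e ∈ QEE p μ ι, e.1 = x ∧ QS A F V T e ∧
      ∀ᵐ t ∂(volume.restrict (Ioo 0 T)), e.2.1 t = u t := by
  obtain ⟨hE, heq, w, hwu, hw0, hwV, hwc⟩ := h
  obtain ⟨C, hC, htr⟩ := ql_tr_of p μ ι
  have C0 : 0 < C := by linarith
  have wc : ContinuousOn w (Icc 0 T) := by
    rw [Metric.continuousOn_iff]
    intro t ht ε ε0
    obtain ⟨δ, δ0, hδ⟩ := hwc t ht (ε / (2 * C)) (by positivity)
    refine ⟨δ, δ0, fun t' ht' hd => ?_⟩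
    have := (htr _ _ (ql_in_sub (hV.1 _ (hwV t' ht')) (hV.1 _ (hwV t ht))) (hδ t' ht' hd)).norm_le
    rw [dist_eq_norm]
    have e : C * (ε / (2 * C)) = ε / 2 := by field_simp
    linarith
  obtain ⟨mu, mu', c, hq⟩ := ql_loc_to hT hE
  have hweq := ql_trace_eq hT hq (wc.mono Ico_subset_Icc_self) hwu
  have hc : c = x := by
    have := hweq ⟨le_rfl, hT⟩
    rw [hw0] at this
    simpa using this.symm
  subst hc
  have hxV : c ∈ V := by rw [← hw0]; exact hwV 0 ⟨le_rfl, hT.le⟩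
  obtain ⟨e0, he0, he1⟩ := ql_in_ex (hV.1 _ hxV)
  obtain ⟨M, hM⟩ := hMR _ hxV
  obtain ⟨e, he, h1, h2, h3⟩ := ql_extend hM he0 mu mu' (by rw [he1]; exact hq)
  have hr : EqOn w (qrep e) (Icc 0 T) := by
    refine EqOn.of_subset_closure (s := Ico 0 T) ?_ wc (ql_prim_cont e.1 (ql_Lp_int T _)) Ico_subset_Icc_self
      (by rw [closure_Ico hT.ne])
    intro t ht
    rw [hweq ht, qrep, h1, he1]
    beta_reduce
    exact congrArg (c + ·) (ql_icongr h3 ht.1 ht.2.le).symm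
  refine ⟨e, he, h1.trans he1, ⟨fun t ht => ?_, ?_⟩, h2⟩
  · rw [← hr ht]; exact hwV t ht
  · filter_upwards [heq, hwu, h2, h3, ae_restrict_mem measurableSet_Ioo] with t q1 q2 q3 q4 q5
    rw [q3, q4, ← hr (Ioo_subset_Icc_self q5), q2, q1]

theorem ql_from {T : ℝ} {e : QTT X₀ X₁ p μ} (he : e ∈ QEE p μ ι) (hs : QS A F V T e) {u : ℝ → X₁} {u' : ℝ → X₀}
    (h1 : ∀ᵐ t ∂(volume.restrict (Ioo 0 T)), e.2.1 t = u t) (h2 : ∀ᵐ t ∂(volume.restrict (Ioo 0 T)), e.2.2 t = u' t) :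
    IsQLSol p μ T ι A F V e.1 u u' := by
  have hsub : Ioo 0 T ⊆ Ioi (0:ℝ) := fun t ht => ht.1
  have hq := ((he T).congr h1 h2).2.2
  have hr : ∀ t ∈ Icc 0 T, qrep e t = e.1 + ∫ r in (0:ℝ)..t, u' r := by
    intro t ht
    rw [qrep, ql_icongr h2 ht.1 ht.2]
  have hq2 : ∀ᵐ t ∂(volume.restrict (Ioo 0 T)), qrep e t = ι (u t) := by
    filter_upwards [hq, ae_restrict_mem measurableSet_Ioo] with t k1 k2
    rw [hr t (Ioo_subset_Icc_self k2), k1]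
  refine ⟨ql_memE_of (x := e.1) isOpen_Ioo hsub (fun t ht s hs => ⟨hs.1, hs.2.trans_lt ht.2⟩) ?_ ?_ hq, ?_, qrep e, hq2,
    qrep_zero e, hs.1, ?_⟩
  · refine ((Lp.memLp e.2.1).restrict (Ioo 0 T)).ae_eq ?_
    rw [EventuallyEq, ql_ae_restrict p μ measurableSet_Ioo hsub]
    exact h1
  · refine ((Lp.memLp e.2.2).restrict (Ioo 0 T)).ae_eq ?_
    rw [EventuallyEq, ql_ae_restrict p μ measurableSet_Ioo hsub]
    exact h2
  · filter_upwards [hs.2, h1, h2, hq2] with t k1 k2 k3 k4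
    rw [← k4, ← k2, ← k3, k1]
  · intro t ht ε ε0
    obtain ⟨δ, δ0, hδ⟩ := ql_rep_cont he (show 0 < ε / 4 by positivity)
    refine ⟨δ, δ0, fun t' ht' hd => ?_⟩
    have := (hδ t t' ht.1 ht'.1 hd).trace.2
    linarith

variable (p μ ι) in
def QEx (A : X₀ → X₁ →L[ℂ] X₀) (F : X₀ → X₀) (V : Set X₀) (x : X₀) (T : ℝ) : Prop :=
  ∃ e ∈ QEE p μ ι, e.1 = x ∧ QS A F V T e

theorem QS.mono {T T' : ℝ} {e : QTT X₀ X₁ p μ} (h : QS A F V T e) (hT : T' ≤ T) : QS A F V T' e :=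
  ⟨fun t ht => h.1 t ⟨ht.1, ht.2.trans hT⟩, ae_restrict_of_ae_restrict_of_subset (Ioo_subset_Ioo_right hT) h.2⟩

theorem ql_unq2 (hH : QHyp p μ ι A F V) (hMR : ∀ x ∈ V, ∃ M, QMR p ι (A x) M) {v g : QTT X₀ X₁ p μ}
    (hv : v ∈ QEE p μ ι) (hg : g ∈ QEE p μ ι) {T : ℝ} (hT : 0 ≤ T) (h1 : g.1 = v.1) (sv : QS A F V T v)
    (sg : QS A F V T g) : ∀ᵐ t ∂(volume.restrict (Ioo 0 T)), g.2.1 t = v.2.1 t ∧ g.2.2 t = v.2.2 t := by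
  have k := ql_unq hH hMR hv hg hT h1 sv sg
  have e1 : ∀ᵐ t ∂qlm, (g - v).2.1 t = g.2.1 t - v.2.1 t := by
    rw [← ql_ae p μ]
    exact Lp.coeFn_sub g.2.1 v.2.1
  have e2 : ∀ᵐ t ∂qlm, (g - v).2.2 t = g.2.2 t - v.2.2 t := by
    rw [← ql_ae p μ]
    exact Lp.coeFn_sub g.2.2 v.2.2
  have hdZ : g - v ∈ QZZ p μ ι := (QZZ_mem p μ ι _).2 ⟨sub_mem hg hv, sub_eq_zero.2 h1⟩
  have hz := (ql_van hdZ (b := T) (by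
    filter_upwards [k, ql_ae_loc T e1] with t q1 q2
    rw [q2, q1, sub_self])).1
  filter_upwards [k, hz, ql_ae_loc T e2] with t q1 q2 q3
  exact ⟨q1, sub_eq_zero.1 (q3.symm.trans q2)⟩

theorem ql_max (hH : QHyp p μ ι A F V) (hMR : ∀ x ∈ V, ∃ M, QMR p ι (A x) M) (x : X₀) :
    ∃ u u', ∀ T T' : ℝ, 0 < T → T < T' → QEx p μ ι A F V x T' → IsQLSol p μ T ι A F V x u u' := by
  classical
  have hch : ∀ q : ℚ, ∃ e, QEx p μ ι A F V x q → (e ∈ QEE p μ ι ∧ e.1 = x ∧ QS A F V q e) := by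
    intro q
    by_cases h : QEx p μ ι A F V x q
    · obtain ⟨e, h1, h2, h3⟩ := h
      exact ⟨e, fun _ => ⟨h1, h2, h3⟩⟩
    · exact ⟨0, fun h' => absurd h' h⟩
  choose e he using hch
  have compat : ∀ᵐ (t : ℝ) ∂(volume : Measure ℝ), ∀ q q' : ℚ, 0 < t → t < (q : ℝ) → t < (q' : ℝ) → QEx p μ ι A F V x q → QEx p μ ι A F V x q' →
      (e q).2.1 t = (e q').2.1 t ∧ (e q).2.2 t = (e q').2.2 t := by
    rw [ae_all_iff]; intro q
    rw [ae_all_iff]; intro q'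
    by_cases h : QEx p μ ι A F V x q ∧ QEx p μ ι A F V x q' ∧ (0:ℝ) ≤ min (q:ℝ) q'
    · obtain ⟨h1, h2, h3⟩ := h
      obtain ⟨a1, a2, a3⟩ := he q h1
      obtain ⟨b1, b2, b3⟩ := he q' h2
      have := ql_unq2 hH hMR b1 a1 h3 (a2.trans b2.symm) (b3.mono (min_le_right _ _)) (a3.mono (min_le_left _ _))
      rw [ae_restrict_iff' measurableSet_Ioo] at this
      filter_upwards [this] with t ht t0 k1 k2 _ _
      exact ht ⟨t0, lt_min k1 k2⟩
    · refine Eventually.of_forall fun t t0 k1 k2 k3 k4 => absurd ⟨k3, k4, ?_⟩ h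
      exact le_min (t0.trans k1).le (t0.trans k2).le
  refine ⟨fun t : ℝ => if h : ∃ q : ℚ, t < (q : ℝ) ∧ QEx p μ ι A F V x q then (e h.choose).2.1 t else 0,
    fun t : ℝ => if h : ∃ q : ℚ, t < (q : ℝ) ∧ QEx p μ ι A F V x q then (e h.choose).2.2 t else 0, ?_⟩
  intro T T' hT hTT' hx
  obtain ⟨q, hq1, hq2⟩ := exists_rat_btwn hTT'
  have hqx : QEx p μ ι A F V x q := by
    obtain ⟨e', h1, h2, h3⟩ := hx
    exact ⟨e', h1, h2, h3.mono hq2.le⟩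
  obtain ⟨a1, a2, a3⟩ := he q hqx
  have key : ∀ᵐ (t : ℝ) ∂(volume.restrict (Ioo 0 T)), ∀ h : ∃ q : ℚ, t < (q : ℝ) ∧ QEx p μ ι A F V x q,
      (e q).2.1 t = (e h.choose).2.1 t ∧ (e q).2.2 t = (e h.choose).2.2 t := by
    filter_upwards [ae_restrict_of_ae compat, ae_restrict_mem measurableSet_Ioo] with t k1 k2 h
    exact k1 q h.choose k2.1 (k2.2.trans hq1) h.choose_spec.1 hqx h.choose_spec.2
  have := ql_from (u := fun t : ℝ => if h : ∃ q : ℚ, t < (q : ℝ) ∧ QEx p μ ι A F V x q then (e h.choose).2.1 t else 0)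
    (u' := fun t : ℝ => if h : ∃ q : ℚ, t < (q : ℝ) ∧ QEx p μ ι A F V x q then (e h.choose).2.2 t else 0) a1 (a3.mono hq1.le) ?_ ?_
  · rwa [a2] at this
  · filter_upwards [key, ae_restrict_mem measurableSet_Ioo] with t k1 k2
    have h : ∃ q : ℚ, t < (q : ℝ) ∧ QEx p μ ι A F V x q := ⟨q, k2.2.trans hq1, hqx⟩
    rw [dif_pos h]
    exact (k1 h).1
  · filter_upwards [key, ae_restrict_mem measurableSet_Ioo] with t k1 k2
    have h : ∃ q : ℚ, t < (q : ℝ) ∧ QEx p μ ι A F V x q := ⟨q, k2.2.trans hq1, hqx⟩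
    rw [dif_pos h]
    exact (k1 h).2

end qlfin

/-- **Maximal interval of existence and lower semicontinuity of the
existence time.** Let `1 < p < ∞`, `μ ∈ (1/p,1]`, `V ⊆ X_{γ,μ}` open nonempty,
`(A,F)` locally Lipschitz on `V`, and `A(v) ∈ MR_p(X₀)` for all `v ∈ V`. Then there is a
map `t⁺ : V → (0,∞]` such that for each `u₀ ∈ V`: there are `(u,u')` solving the
quasilinear problem with initial value `u₀` on every `[0,T]` with `T < t⁺(u₀)` (so
`u ∈ E_{1,μ}(0,T) ∩ C([0,T];X_{γ,μ})` on each such interval), the solution on each such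
interval is unique, and no solution exists on `[0,T]` once `T ≥ t⁺(u₀)` (maximality).
Moreover `u₀ ↦ t⁺(u₀)` is lower semicontinuous on `V` w.r.t. the trace norm. -/
theorem statement13 (p μ : ℝ) (hp : 1 < p) (hμ : 1 / p < μ) (hμ1 : μ ≤ 1)
    (ι : X₁ →L[ℂ] X₀) (hinj : Function.Injective ι) (hdense : DenseRange ι)
    (A : X₀ → X₁ →L[ℂ] X₀) (F : X₀ → X₀) (V : Set X₀)
    (hVne : V.Nonempty) (hVopen : TraceOpen p μ ι V) (hLip : LocLip p μ ι A F V)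
    (hgraph : ∀ v ∈ V, GraphNormEquiv ι (A v))
    (hMR : ∀ v ∈ V, MRw p 1 ι (A v)) :
    ∃ tplus : X₀ → ENNReal,
      (∀ u₀ ∈ V,
        0 < tplus u₀ ∧
        (∃ u u', ∀ T : ℝ, 0 < T → ENNReal.ofReal T < tplus u₀ →
          IsQLSol p μ T ι A F V u₀ u u') ∧
        (∀ T : ℝ, 0 < T → ENNReal.ofReal T < tplus u₀ →
          ∀ u u' v v', IsQLSol p μ T ι A F V u₀ u u' → IsQLSol p μ T ι A F V u₀ v v' →
            ∀ᵐ t ∂(volume.restrict (Set.Ioo 0 T)), u t = v t) ∧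
        (∀ T : ℝ, 0 < T → (∃ u u', IsQLSol p μ T ι A F V u₀ u u') →
          ENNReal.ofReal T < tplus u₀)) ∧
      ∀ u₀ ∈ V, ∀ r : ENNReal, r < tplus u₀ →
        ∃ δ > (0 : ℝ), ∀ u₁ ∈ V, traceNorm p μ ι (u₁ - u₀) < δ → r < tplus u₁ := by
  haveI : Fact (1 < p) := ⟨hp⟩
  haveI : Fact (1 / p < μ) := ⟨hμ⟩
  haveI : Fact (μ ≤ 1) := ⟨hμ1⟩
  have hH := ql_hyp hVopen hLip
  have hMQ : ∀ x ∈ V, ∃ M, QMR p ι (A x) M := fun x hx => ql_QMR (hMR x hx)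
  have hlt : ∀ x T, 0 ≤ T → QEx p μ ι A F V x T →
      ENNReal.ofReal T < ⨆ (T : ℝ) (_ : QEx p μ ι A F V x T), ENNReal.ofReal T := by
    rintro x T hT ⟨e, h1, h2, h3⟩
    obtain ⟨T', hT', g, k1, k2, k3⟩ := ql_ext hH hMQ h1 hT h3
    refine lt_of_lt_of_le ((ENNReal.ofReal_lt_ofReal_iff (by linarith)).2 hT') ?_
    exact le_iSup₂ (f := fun (T : ℝ) (_ : QEx p μ ι A F V x T) => ENNReal.ofReal T) T' ⟨g, k1, k2.trans h2, k3⟩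
  have hgt : ∀ x (r : ENNReal), (r < ⨆ (T : ℝ) (_ : QEx p μ ι A F V x T), ENNReal.ofReal T) →
      ∃ T, QEx p μ ι A F V x T ∧ r < ENNReal.ofReal T := by
    intro x r h
    obtain ⟨T, h⟩ := lt_iSup_iff.1 h
    obtain ⟨h1, h2⟩ := lt_iSup_iff.1 h
    exact ⟨T, h1, h2⟩
  refine ⟨fun x => ⨆ (T : ℝ) (_ : QEx p μ ι A F V x T), ENNReal.ofReal T, ?_, ?_⟩
  · intro u₀ hu₀
    refine ⟨?_, ?_, ?_, ?_⟩
    · obtain ⟨e, h1, h2⟩ := ql_in_ex (hVopen.1 u₀ hu₀)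
      have := hlt u₀ 0 le_rfl ⟨e, h1, h2, fun t ht => ?_, by simp⟩
      · rwa [ENNReal.ofReal_zero] at this
      · rw [le_antisymm ht.2 ht.1, qrep_zero, h2]
        exact hu₀
    · obtain ⟨u, u', h⟩ := ql_max hH hMQ u₀
      refine ⟨u, u', fun T hT hlt' => ?_⟩
      obtain ⟨T', h1, h2⟩ := hgt _ _ hlt'
      exact h T T' hT ((ENNReal.ofReal_lt_ofReal_iff_of_nonneg hT.le).1 h2) h1
    · intro T hT _ u u' v v' hu hv
      obtain ⟨e, h1, h2, h3, h4⟩ := ql_to hVopen hMQ hT hu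
      obtain ⟨g, k1, k2, k3, k4⟩ := ql_to hVopen hMQ hT hv
      filter_upwards [h4, k4, ql_unq hH hMQ k1 h1 hT.le (h2.trans k2.symm) k3 h3] with t q1 q2 q3
      rw [← q1, ← q2, q3]
    · rintro T hT ⟨u, u', hu⟩
      obtain ⟨e, h1, h2, h3, -⟩ := ql_to hVopen hMQ hT hu
      exact hlt u₀ T hT.le ⟨e, h1, h2, h3⟩
  · intro u₀ hu₀ r hr
    obtain ⟨T, ⟨v, h1, h2, h3⟩, hrT⟩ := hgt _ _ hr
    have hT : 0 < T := ENNReal.ofReal_pos.1 (lt_of_le_of_lt (zero_le) hrT)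
    obtain ⟨δ, δ0, hδ⟩ := ql_lsc hH hMQ h1 hT.le h3 1 one_pos
    obtain ⟨C, hC, htr⟩ := ql_tr_of p μ ι
    refine ⟨δ / C, by positivity, fun u₁ hu₁ hd => ?_⟩
    have hq := htr _ _ (ql_in_sub (hVopen.1 u₁ hu₁) (hVopen.1 u₀ hu₀)) hd
    rw [mul_div_cancel₀ _ (by positivity)] at hq
    obtain ⟨y, y1, -, y2, y3⟩ := hδ _ hq
    refine hrT.trans (hlt u₁ T hT.le ⟨v + y, add_mem h1 y1, ?_, y3⟩)
    rw [Prod.fst_add, h2, y2, add_sub_cancel]
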